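/- Let p_k → p and q_k → q be convergent sequences in Y, and for each k let σ_k : [0,1] → Y be the constant-speed parametrization of the Y-geodesic from p_k to q_k. Then the maps σ_k converge uniformly, with respect to the metric of X, to the constant-speed parametrization σ : [0,1] → Y of the Y-geodesic from p to q. -/

import Mathlib

open Set Metric Filter

noncomputable section

namespace Cat2Cx

/-! ### Comparison angles -/

/-- Inverse hyperbolic cosine. -/
def arcosh (x : ℝ) : ℝ := Real.log (x + Real.sqrt (x ^ 2 - 1))

/-- The Euclidean comparison angle at the vertex of a (comparison) triangle whose adjacent
sides have lengths `a`, `b` and whose opposite side has length `c`, via the law of cosines. -/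
def euclCompAngle (a b c : ℝ) : ℝ :=
  Real.arccos ((a ^ 2 + b ^ 2 - c ^ 2) / (2 * a * b))

/-- The comparison angle in the model plane `M_κ²` of constant curvature `κ ≤ 0`, via the
(Euclidean or hyperbolic) law of cosines. -/
def compAngle (κ a b c : ℝ) : ℝ :=
  if κ = 0 then euclCompAngle a b c
  else
    Real.arccos
      ((Real.cosh (Real.sqrt (-κ) * a) * Real.cosh (Real.sqrt (-κ) * b) -
          Real.cosh (Real.sqrt (-κ) * c)) /
        (Real.sinh (Real.sqrt (-κ) * a) * Real.sinh (Real.sqrt (-κ) * b)))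

variable {Z : Type*}

/-! ### Geodesics with respect to a distance function -/

/-- `f` restricted to `[a,b]` is a unit-speed geodesic for the distance function `d`
(an isometric embedding of the compact interval `[a,b]`). -/
def IsGeodesicWrt (d : Z → Z → ℝ) (f : ℝ → Z) (a b : ℝ) : Prop :=
  a ≤ b ∧ ∀ s ∈ Icc a b, ∀ t ∈ Icc a b, d (f s) (f t) = |s - t|

/-- `f` is a unit-speed geodesic from `x` to `y` (for the distance function `d`),
staying inside `S`. -/
def IsGeodesicFromTo (d : Z → Z → ℝ) (S : Set Z) (f : ℝ → Z) (x y : Z) : Prop :=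
  f 0 = x ∧ f (d x y) = y ∧ IsGeodesicWrt d f 0 (d x y) ∧ MapsTo f (Icc 0 (d x y)) S

/-- `S`, with the distance function `d`, is a geodesic space. -/
def GeodesicSpaceWrt (d : Z → Z → ℝ) (S : Set Z) : Prop :=
  ∀ x ∈ S, ∀ y ∈ S, ∃ f, IsGeodesicFromTo d S f x y

/-- The geodesic segment `[x,y]`: the union of (the images of) all geodesics from `x` to `y`
inside `S`.  In a uniquely geodesic space this is the image of the unique geodesic. -/
def geodSeg (d : Z → Z → ℝ) (S : Set Z) (x y : Z) : Set Z :=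
  ⋃ f ∈ {f : ℝ → Z | IsGeodesicFromTo d S f x y}, f '' Icc 0 (d x y)

/-- `C ⊆ S` is geodesically convex with respect to `d`: every geodesic (in `S`) between two
points of `C` lies in `C`. -/
def ConvexWrtIn (d : Z → Z → ℝ) (S C : Set Z) : Prop :=
  ∀ x ∈ C, ∀ y ∈ C, geodSeg d S x y ⊆ C

/-- `C` is geodesically convex with respect to `d`. -/
abbrev ConvexWrt (d : Z → Z → ℝ) (C : Set Z) : Prop := ConvexWrtIn d univ C

/-- The geodesically convex hull of `A` with respect to `d`. -/
def convexHullWrt (d : Z → Z → ℝ) (A : Set Z) : Set Z :=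
  ⋂₀ {C | ConvexWrt d C ∧ A ⊆ C}

/-- The Alexandrov (upper) angle at `p` between two paths `σ`, `τ` issuing from `p`
(each parametrized so that `σ 0 = τ 0 = p`): the limit as `ε → 0⁺` (i.e. the infimum over
`ε > 0`) of the supremum over `0 < s, t < ε` of the Euclidean comparison angles. -/
def upperAngleWrt (d : Z → Z → ℝ) (p : Z) (σ τ : ℝ → Z) : ℝ :=
  sInf {a | ∃ ε > 0, a = sSup {b | ∃ s t : ℝ, 0 < s ∧ s < ε ∧ 0 < t ∧ t < ε ∧
      b = euclCompAngle (d p (σ s)) (d p (τ t)) (d (σ s) (τ t))}}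

/-- The CAT(κ) condition (for `κ ≤ 0`), in the angle-comparison form
(Bridson–Haefliger II.1.7(4)): `S` is geodesic and for every triple of distinct points the
Alexandrov angle between geodesics is at most the comparison angle in `M_κ²`. -/
def IsCATWrt (κ : ℝ) (d : Z → Z → ℝ) (S : Set Z) : Prop :=
  GeodesicSpaceWrt d S ∧
    ∀ p ∈ S, ∀ q ∈ S, ∀ r ∈ S, p ≠ q → p ≠ r → q ≠ r →
      ∀ σ τ : ℝ → Z, IsGeodesicFromTo d S σ p q → IsGeodesicFromTo d S τ p r →
        upperAngleWrt d p σ τ ≤ compAngle κ (d p q) (d p r) (d q r)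

/-- Completeness of `S` with respect to the distance function `d`:
every Cauchy sequence converges. -/
def CompleteWrt (d : Z → Z → ℝ) (S : Set Z) : Prop :=
  ∀ u : ℕ → Z, (∀ n, u n ∈ S) →
    (∀ ε > 0, ∃ N, ∀ m ≥ N, ∀ n ≥ N, d (u m) (u n) < ε) →
    ∃ x ∈ S, ∀ ε > 0, ∃ N, ∀ n ≥ N, d (u n) x < ε

variable {X : Type*} [MetricSpace X]

/-- `X` is a CAT(κ) metric space. -/
def IsCATSpace (κ : ℝ) (X : Type*) [MetricSpace X] : Prop :=
  IsCATWrt κ (fun x y : X => dist x y) univ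

/-- The distance function of the metric space `X`. -/
abbrev xDist (X : Type*) [MetricSpace X] : X → X → ℝ := fun x y => dist x y

/-! ### The model plane `M_κ²` and polyhedral 2-complexes -/

/-- The distance function of the model plane `M_κ²` of constant curvature `κ ≤ 0`, in global
coordinates `ℝ²`: the Euclidean distance for `κ = 0`, and for `κ < 0` the distance of the
hyperboloid model rescaled by `1/√(-κ)` (so that the curvature is `κ`). -/
def mDist (κ : ℝ) (u v : ℝ × ℝ) : ℝ :=
  if κ = 0 then Real.sqrt ((u.1 - v.1) ^ 2 + (u.2 - v.2) ^ 2)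
  else
    (1 / Real.sqrt (-κ)) *
      arcosh (Real.sqrt (1 + u.1 ^ 2 + u.2 ^ 2) * Real.sqrt (1 + v.1 ^ 2 + v.2 ^ 2) -
        u.1 * v.1 - u.2 * v.2)

/-- A convex polygonal 2-cell in `M_κ²`: the geodesically convex hull of a finite set of
points, with nonempty interior. -/
def IsPolygonalCell (κ : ℝ) (P : Set (ℝ × ℝ)) : Prop :=
  ∃ F : Finset (ℝ × ℝ), P = convexHullWrt (mDist κ) (F : Set (ℝ × ℝ)) ∧ (interior P).Nonempty

/-- The subset `S` of `X` embeds isometrically into the model plane `M_κ²`. -/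
def IsomEmbedsInModelPlane (κ : ℝ) (S : Set X) : Prop :=
  ∃ f : X → ℝ × ℝ, ∀ x ∈ S, ∀ y ∈ S, mDist κ (f x) (f y) = dist x y

/-- A locally finite `M_κ`-polyhedral 2-complex structure on the metric space `X`:
`X` is partitioned into open 2-cells (faces), open 1-cells (edges) and vertices; the closure of
each face is isometric to a compact convex polygon of the model plane `M_κ²` (so each face has
constant curvature `κ`), each edge is a geodesic arc, and the complex is locally finite. -/
structure PolyComplex2 (κ : ℝ) (X : Type*) [MetricSpace X] where
  faces : Set (Set X)
  edges : Set (Set X)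
  vertices : Set X
  faces_open : ∀ F ∈ faces, IsOpen F
  cover : ⋃₀ faces ∪ ⋃₀ edges ∪ vertices = univ
  cells_disjoint : ∀ c ∈ faces ∪ edges, ∀ c' ∈ faces ∪ edges, c ≠ c' → c ∩ c' = ∅
  cells_vertex_disjoint : ∀ c ∈ faces ∪ edges, c ∩ vertices = ∅
  face_chart : ∀ F ∈ faces, ∃ (f : X → ℝ × ℝ) (P : Set (ℝ × ℝ)),
    IsPolygonalCell κ P ∧ InjOn f (closure F) ∧ f '' closure F = P ∧ f '' F = interior P ∧
    ∀ x ∈ closure F, ∀ y ∈ closure F, mDist κ (f x) (f y) = dist x y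
  edge_geodesic : ∀ e ∈ edges, ∃ (f : ℝ → X) (L : ℝ), 0 < L ∧
    IsGeodesicWrt (fun x y : X => dist x y) f 0 L ∧ f '' Ioo 0 L = e
  edge_closure : ∀ e ∈ edges, closure e \ e ⊆ vertices
  face_closure : ∀ F ∈ faces, closure F \ F ⊆ ⋃₀ edges ∪ vertices
  locally_finite : ∀ x : X, ∃ ε > 0,
    {c | (c ∈ faces ∨ c ∈ edges) ∧ (c ∩ ball x ε).Nonempty}.Finite ∧
    (vertices ∩ ball x ε).Finite

/-! ### Simple closed curves, their interiors, and first homology -/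

/-- A simple closed curve in `X` (identified with its image). -/
structure SCC (X : Type*) [TopologicalSpace X] where
  toFun : ℝ → X
  contOn : ContinuousOn toFun (Icc 0 1)
  loop : toFun 0 = toFun 1
  inj : InjOn toFun (Ico 0 1)

/-- The image of a simple closed curve. -/
def SCC.img {X : Type*} [TopologicalSpace X] (γ : SCC X) : Set X := γ.toFun '' Icc 0 1

/-- The first singular homology class of a loop, via the Hurewicz isomorphism: the class of
the loop in the abelianization of the fundamental group (of its path component); the loop is
nullhomologous iff this class is trivial. -/
def loopClassH1 {B : Type*} [TopologicalSpace B] {x : B} (p : Path x x) :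
    Abelianization (FundamentalGroup B x) :=
  Abelianization.of (FundamentalGroup.fromPath (X := TopCat.of B) ⟦p⟧)

/-- The basepoint of a simple closed curve, regarded in a subspace `B` containing it. -/
def SCC.basePoint {X : Type*} [TopologicalSpace X] (γ : SCC X) (B : Set X)
    (h : γ.img ⊆ B) : B :=
  ⟨γ.toFun 0, h ⟨0, ⟨le_rfl, zero_le_one⟩, rfl⟩⟩

/-- The loop of a simple closed curve, as a `Path` in a subspace `B` containing it. -/
def SCC.pathIn {X : Type*} [TopologicalSpace X] (γ : SCC X) (B : Set X) (h : γ.img ⊆ B) :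
    Path (γ.basePoint B h) (γ.basePoint B h) where
  toFun t := ⟨γ.toFun t, h ⟨(t : ℝ), t.2, rfl⟩⟩
  continuous_toFun := by
    apply Continuous.subtype_mk
    exact γ.contOn.comp_continuous continuous_subtype_val fun t => t.2
  source' := by
    apply Subtype.ext
    rfl
  target' := by
    apply Subtype.ext
    exact γ.loop.symm

/-- The simple closed curve `γ` is nullhomologous in the subspace `B` of `X`:
its class in `H₁(B)` vanishes. -/
def SCC.NullhomologousIn {X : Type*} [TopologicalSpace X] (γ : SCC X) (B : Set X) : Prop :=
  ∀ h : γ.img ⊆ B, loopClassH1 (γ.pathIn B h) = 1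

/-- The interior of a simple closed curve `γ`:
`Int γ = {x ∈ X \ γ | [γ] ≠ 0 ∈ H₁(X \ {x})}`. -/
def SCC.interiorSet {X : Type*} [TopologicalSpace X] (γ : SCC X) : Set X :=
  {x | x ∉ γ.img ∧ ¬ γ.NullhomologousIn {x}ᶜ}

/-- The first singular homology of `B` vanishes: every loop in `B` is nullhomologous
(via the Hurewicz isomorphism on each path component). -/
def H1Trivial (B : Type*) [TopologicalSpace B] : Prop :=
  ∀ (x : B) (p : Path x x), loopClassH1 p = 1

/-! ### Rectifiable connectedness and the induced path metric -/

/-- `g` is a path from `x` to `y` (parametrized by `[0,1]`) inside `E`. -/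
def IsPathIn {X : Type*} [TopologicalSpace X] (E : Set X) (g : ℝ → X) (x y : X) : Prop :=
  ContinuousOn g (Icc 0 1) ∧ g 0 = x ∧ g 1 = y ∧ MapsTo g (Icc 0 1) E

/-- `E` is rectifiably connected: any two of its points are joined by a rectifiable
(finite length) path in `E`. -/
def RectConnected {X : Type*} [MetricSpace X] (E : Set X) : Prop :=
  ∀ x ∈ E, ∀ y ∈ E, ∃ g : ℝ → X, IsPathIn E g x y ∧ eVariationOn g (Icc 0 1) ≠ ⊤

/-- The induced path metric on `E`: the infimum of the lengths of rectifiable paths in `E`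
joining the two points. -/
def pathDistIn {X : Type*} [MetricSpace X] (E : Set X) (x y : X) : ℝ :=
  (⨅ g : {g : ℝ → X // IsPathIn E g x y}, eVariationOn g.1 (Icc 0 1)).toReal


universe u
/-! ### Conical neighborhoods -/


/-- The distance function of the `κ`-cone (κ ≤ 0) over a space with distance function `dL`:
a point is a pair (radius, link point), all points of radius `0` being identified (the cone
point); the distance is given by the law of cosines in curvature `κ`, with angle
`min π (dL ℓ ℓ')`. -/
def coneDist (κ : ℝ) {L : Type*} (dL : L → L → ℝ) (a b : ℝ × L) : ℝ :=
  if κ = 0 then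
    Real.sqrt (a.1 ^ 2 + b.1 ^ 2 - 2 * a.1 * b.1 * Real.cos (min Real.pi (dL a.2 b.2)))
  else
    (1 / Real.sqrt (-κ)) *
      arcosh (Real.cosh (Real.sqrt (-κ) * a.1) * Real.cosh (Real.sqrt (-κ) * b.1) -
        Real.sinh (Real.sqrt (-κ) * a.1) * Real.sinh (Real.sqrt (-κ) * b.1) *
          Real.cos (min Real.pi (dL a.2 b.2)))

/-- `V` is a conical neighborhood of `p` in `X`: an open neighborhood of `p` isometric to a
convex open subset of the `κ`-cone over a metric space (the link of `p`), the isometry taking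
`p` to the cone point. -/
def IsConicalNbhd (κ : ℝ) (p : X) (V : Set X) : Prop :=
  IsOpen V ∧ p ∈ V ∧
    ∃ (L : Type u) (dL : L → L → ℝ) (f : X → ℝ × L),
      (∀ a, dL a a = 0) ∧ (∀ a b, 0 ≤ dL a b) ∧ (∀ a b, dL a b = dL b a) ∧
      (∀ a b c, dL a c ≤ dL a b + dL b c) ∧
      (∀ x ∈ V, 0 ≤ (f x).1) ∧ (f p).1 = 0 ∧
      (∀ x ∈ V, ∀ y ∈ V, dist x y = coneDist κ dL (f x) (f y)) ∧
      (∀ x ∈ V, (f x).1 = 0 → x = p) ∧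
      ConvexWrtIn (coneDist κ dL) {w : ℝ × L | 0 ≤ w.1} (f '' V) ∧
      (∀ z ∈ f '' V, ∃ ε > 0, ∀ w : ℝ × L, 0 ≤ w.1 → coneDist κ dL z w < ε → w ∈ f '' V)

/-! ### Geodesics, triangles, and limit segments in `Y = (E, induced path metric)` -/

/-- The set `α` is (the image of) a geodesic arc of `Y = (E, pathDistIn E)`. -/
def IsYGeodesicArc (E : Set X) (α : Set X) : Prop :=
  ∃ (f : ℝ → X) (a b : ℝ), IsGeodesicWrt (pathDistIn E) f a b ∧
    MapsTo f (Icc a b) E ∧ f '' Icc a b = α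

/-- `T` is a geodesic triangle of `Y = (E, pathDistIn E)` with vertices `p`, `q`, `r`:
the union of the three `Y`-geodesics joining the vertices. -/
def IsYTriangle (E : Set X) (T : Set X) (p q r : X) : Prop :=
  p ∈ E ∧ q ∈ E ∧ r ∈ E ∧
    T = geodSeg (pathDistIn E) E p q ∪ geodSeg (pathDistIn E) E q r ∪
        geodSeg (pathDistIn E) E r p

/-- The set `γim` (a curve in `E`) is locally geodesic in `Y` at `p`: some subarc of `γim`
containing `p` in its relative interior is a geodesic of `Y`. -/
def LocallyYGeodesicAt (E γim : Set X) (p : X) : Prop :=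
  ∃ (f : ℝ → X) (a b t : ℝ), t ∈ Ioo a b ∧ f t = p ∧
    IsGeodesicWrt (pathDistIn E) f a b ∧ MapsTo f (Icc a b) E ∧ f '' Icc a b ⊆ γim

/-- `f : [0,1] → E` is the constant-speed parametrization of the `Y`-geodesic
from `x` to `y`. -/
def IsConstSpeedYGeodesic (E : Set X) (f : ℝ → X) (x y : X) : Prop :=
  f 0 = x ∧ f 1 = y ∧ MapsTo f (Icc 0 1) E ∧
    ∀ s ∈ Icc (0:ℝ) 1, ∀ t ∈ Icc (0:ℝ) 1,
      pathDistIn E (f s) (f t) = pathDistIn E x y * |s - t|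

/-- `R` is the limit segment of length `ε` at `p` of the `Y`-geodesic side from `p` to `q`:
`R` is an `X`-geodesic of length `ε` issuing from `p`, and the `X`-geodesics of length `ε`
from `p` through `σ t` (σ the `Y`-geodesic from `p` to `q`) converge uniformly to `R`
as `t → 0⁺`. -/
def IsLimitSegment (E : Set X) (p q : X) (ε : ℝ) (R : ℝ → X) : Prop :=
  0 < ε ∧ R 0 = p ∧ IsGeodesicWrt (fun x y : X => dist x y) R 0 ε ∧
    ∀ σ : ℝ → X, IsGeodesicFromTo (pathDistIn E) E σ p q →
      ∀ δ > 0, ∃ t₀ > 0, ∀ t, 0 < t → t ≤ t₀ → t ≤ pathDistIn E p q →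
        ∀ g : ℝ → X, IsGeodesicWrt (fun x y : X => dist x y) g 0 ε → g 0 = p →
          g (dist p (σ t)) = σ t → ∀ s ∈ Icc 0 ε, dist (g s) (R s) ≤ δ


end Cat2Cx

end

namespace Cat2Cx

/-! ### The CN inequality -/

theorem cosh_sqrt_hasSum {s : ℝ} (hs : 0 ≤ s) :
    HasSum (fun n : ℕ => s ^ n / (2 * n).factorial) (Real.cosh (Real.sqrt s)) := by
  have h := Real.hasSum_cosh (Real.sqrt s)
  simpa only [pow_mul, Real.sq_sqrt hs] using h

theorem cosh_sqrt_convex : ConvexOn ℝ (Ici 0) fun s : ℝ => Real.cosh (Real.sqrt s) := by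
  refine ⟨convex_Ici 0, ?_⟩
  intro x hx y hy a b ha hb hab
  have hx' : (0:ℝ) ≤ x := hx
  have hy' : (0:ℝ) ≤ y := hy
  have hxy : 0 ≤ a * x + b * y := by positivity
  have h := ((cosh_sqrt_hasSum hx').mul_left a).add ((cosh_sqrt_hasSum hy').mul_left b)
  refine hasSum_le (fun n => ?_) (cosh_sqrt_hasSum hxy) h
  have := (convexOn_pow (𝕜 := ℝ) n).2 hx hy ha hb hab
  simp only [smul_eq_mul] at this
  calc (a * x + b * y) ^ n / ((2 * n).factorial : ℝ)
      ≤ (a * x ^ n + b * y ^ n) / ((2 * n).factorial : ℝ) := by gcongr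
    _ = _ := by ring

/-- The Euclidean law of cosines bounds the hyperbolic one. -/
theorem cosh_sqrt_lawOfCosines_le (a b : ℝ) {x : ℝ} (hx : x ∈ Icc (-1 : ℝ) 1) :
    Real.cosh (Real.sqrt (a ^ 2 + b ^ 2 - 2 * a * b * x)) ≤
      Real.cosh a * Real.cosh b - Real.sinh a * Real.sinh b * x := by
  obtain ⟨h1, h2⟩ := hx
  have h := cosh_sqrt_convex.2 (show (a - b) ^ 2 ∈ Ici (0:ℝ) from sq_nonneg (a - b))
    (show (a + b) ^ 2 ∈ Ici (0:ℝ) from sq_nonneg (a + b))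
    (show 0 ≤ (1 + x) / 2 by linarith) (show 0 ≤ (1 - x) / 2 by linarith) (by ring)
  simp only [smul_eq_mul, Real.sqrt_sq_eq_abs, Real.cosh_abs, Real.cosh_sub, Real.cosh_add] at h
  have e : a ^ 2 + b ^ 2 - 2 * a * b * x =
      (1 + x) / 2 * (a - b) ^ 2 + (1 - x) / 2 * (a + b) ^ 2 := by ring
  rw [e]
  linarith

theorem le_cos_compAngle {κ a b c : ℝ} (hκ : κ ≤ 0) (ha : 0 < a) (hb : 0 < b)
    (hab : c ≤ a + b) (hac : a ≤ b + c) (hbc : b ≤ a + c) :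
    a ^ 2 + b ^ 2 - c ^ 2 ≤ 2 * a * b * Real.cos (compAngle κ a b c) := by
  unfold compAngle euclCompAngle
  split_ifs with h0
  · have hp : 0 < 2 * a * b := by positivity
    rw [Real.cos_arccos]
    · rw [mul_div_cancel₀ _ hp.ne']
    · rw [le_div_iff₀ hp]; nlinarith
    · rw [div_le_iff₀ hp]; nlinarith
  · have hk : 0 < Real.sqrt (-κ) := Real.sqrt_pos.2 (by
      rcases hκ.lt_or_eq with h | h
      · linarith
      · exact absurd h h0)
    set k := Real.sqrt (-κ)
    have hka : 0 < k * a := by positivity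
    have hkb : 0 < k * b := by positivity
    have hp : 0 < Real.sinh (k * a) * Real.sinh (k * b) :=
      mul_pos (Real.sinh_pos_iff.2 hka) (Real.sinh_pos_iff.2 hkb)
    have hc : 0 ≤ c := by linarith
    have hlow : Real.cosh (k * a - k * b) ≤ Real.cosh (k * c) := by
      rw [Real.cosh_le_cosh, abs_of_nonneg (by positivity : 0 ≤ k * c), ← mul_sub, abs_mul,
        abs_of_pos hk]
      gcongr
      rw [abs_le]; constructor <;> linarith
    have hup : Real.cosh (k * c) ≤ Real.cosh (k * a + k * b) := by
      rw [Real.cosh_le_cosh, abs_of_nonneg (by positivity : 0 ≤ k * c), ← mul_add, abs_mul,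
        abs_of_pos hk]
      gcongr
      rw [abs_of_nonneg (by positivity)]; exact hab
    rw [Real.cosh_sub] at hlow
    rw [Real.cosh_add] at hup
    set x := (Real.cosh (k * a) * Real.cosh (k * b) - Real.cosh (k * c)) /
      (Real.sinh (k * a) * Real.sinh (k * b)) with hx
    have hx1 : -1 ≤ x := by rw [hx, le_div_iff₀ hp]; linarith
    have hx2 : x ≤ 1 := by rw [hx, div_le_iff₀ hp]; linarith
    rw [Real.cos_arccos hx1 hx2]
    have h := cosh_sqrt_lawOfCosines_le (k * a) (k * b) ⟨hx1, hx2⟩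
    have e : Real.cosh (k * a) * Real.cosh (k * b) - Real.sinh (k * a) * Real.sinh (k * b) * x
        = Real.cosh (k * c) := by
      rw [hx]; field_simp; ring
    rw [e, Real.cosh_le_cosh, abs_of_nonneg (Real.sqrt_nonneg _),
      abs_of_nonneg (by positivity : 0 ≤ k * c)] at h
    have h' := (Real.sqrt_le_left (by positivity)).1 h
    have hk2 : 0 < k ^ 2 := by positivity
    have : k ^ 2 * (a ^ 2 + b ^ 2 - 2 * a * b * x) ≤ k ^ 2 * c ^ 2 := by
      calc _ = (k * a) ^ 2 + (k * b) ^ 2 - 2 * (k * a) * (k * b) * x := by ring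
        _ ≤ (k * c) ^ 2 := h'
        _ = _ := by ring
    have := le_of_mul_le_mul_left this hk2
    linarith

section
variable {X : Type*} [MetricSpace X]

theorem exists_lt_of_upperAngleWrt_le {o : X} {σ τ : ℝ → X} {A η : ℝ}
    (hA : upperAngleWrt (fun x y : X => dist x y) o σ τ ≤ A) (hη : 0 < η) :
    ∃ ε > 0, ∀ s t : ℝ, 0 < s → s < ε → 0 < t → t < ε →
      euclCompAngle (dist o (σ s)) (dist o (τ t)) (dist (σ s) (τ t)) < A + η := by
  have hlt := lt_of_le_of_lt hA (lt_add_of_pos_right A hη)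
  unfold upperAngleWrt at hlt
  obtain ⟨a, ⟨ε, hε, rfl⟩, h⟩ := exists_lt_of_csInf_lt (by exact ⟨_, 1, one_pos, rfl⟩) hlt
  refine ⟨ε, hε, fun s t hs hs' ht ht' => lt_of_le_of_lt (le_csSup ⟨Real.pi, ?_⟩ ?_) h⟩
  · rintro _ ⟨s, t, -, -, -, -, rfl⟩
    exact Real.arccos_le_pi _
  · exact ⟨s, t, hs, hs', ht, ht', rfl⟩

theorem cos_sub_le_cos {A b η : ℝ} (hA : A ≤ Real.pi) (hb : 0 ≤ b) (h : b < A + η) (hη : 0 < η) :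
    Real.cos A - η ≤ Real.cos b := by
  rcases le_total b A with h1 | h1
  · have := Real.cos_le_cos_of_nonneg_of_le_pi hb hA h1
    linarith
  · have := Real.abs_cos_sub_cos_le A b
    rw [abs_of_nonpos (by linarith : A - b ≤ 0)] at this
    have := le_abs_self (Real.cos A - Real.cos b)
    linarith

theorem compAngle_le_pi (κ a b c : ℝ) : compAngle κ a b c ≤ Real.pi := by
  unfold compAngle euclCompAngle
  split_ifs <;> exact Real.arccos_le_pi _

/-- First-variation form of the angle comparison. -/
theorem IsCATSpace.dist_sq_le {κ : ℝ} (hX : IsCATSpace κ X) {o p x : X}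
    (hop : o ≠ p) (hox : o ≠ x) (hpx : p ≠ x) {σ τ : ℝ → X}
    (hσ : IsGeodesicFromTo (fun x y : X => dist x y) univ σ o p)
    (hτ : IsGeodesicFromTo (fun x y : X => dist x y) univ τ o x) {η : ℝ} (hη : 0 < η) :
    ∃ ε > 0, ∀ s t : ℝ, 0 < s → s < ε → 0 < t → t < ε →
      dist (σ s) (τ t) ^ 2 ≤ s ^ 2 + t ^ 2 -
        2 * s * t * (Real.cos (compAngle κ (dist o p) (dist o x) (dist p x)) - η) := by
  obtain ⟨ε, hε, h⟩ := exists_lt_of_upperAngleWrt_le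
    (hX.2 o trivial p trivial x trivial hop hox hpx σ τ hσ hτ) hη
  refine ⟨min ε (min (dist o p) (dist o x)), by
    have := dist_pos.2 hop; have := dist_pos.2 hox; positivity, fun s t hs hs' ht ht' => ?_⟩
  simp only [lt_min_iff] at hs' ht'
  have h1 := h s t hs hs'.1 ht ht'.1
  have e1 : dist o (σ s) = s := by
    have := hσ.2.2.1.2 0 ⟨le_rfl, dist_nonneg⟩ s ⟨hs.le, hs'.2.1.le⟩
    simpa [hσ.1, abs_of_pos hs] using this
  have e2 : dist o (τ t) = t := by
    have := hτ.2.2.1.2 0 ⟨le_rfl, dist_nonneg⟩ t ⟨ht.le, ht'.2.2.le⟩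
    simpa [hτ.1, abs_of_pos ht] using this
  have t1 := dist_triangle_left (σ s) (τ t) o
  have t2 := dist_triangle o (τ t) (σ s)
  have t3 := dist_triangle o (σ s) (τ t)
  rw [dist_comm (τ t)] at t2
  rw [e1, e2] at t1
  rw [e1, e2] at t2
  rw [e1, e2] at t3
  rw [e1, e2] at h1
  have h2 := cos_sub_le_cos (compAngle_le_pi κ (dist o p) (dist o x) (dist p x))
    (Real.arccos_nonneg _) h1 hη
  have hp : 0 < 2 * s * t := by positivity
  have hD : 0 ≤ dist (σ s) (τ t) := dist_nonneg
  rw [Real.cos_arccos, le_div_iff₀ hp] at h2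
  · linarith
  · rw [le_div_iff₀ hp]; nlinarith
  · rw [div_le_iff₀ hp]; nlinarith

/-- The Bruhat–Tits (CN, or Stewart) inequality, in a form applying to any point `o` of a
geodesic from `p` to `z`. -/
def CN (X : Type*) [MetricSpace X] : Prop :=
  ∀ p o z x : X, dist p o + dist o z = dist p z →
    (dist p o + dist o z) * (dist x o ^ 2 + dist p o * dist o z) ≤
      dist o z * dist p x ^ 2 + dist p o * dist z x ^ 2

theorem IsCATSpace.cn {κ : ℝ} (hκ : κ ≤ 0) (hX : IsCATSpace κ X) : CN X := by
  intro p o z x hpoz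
  by_cases hop : o = p
  · subst hop; simp [dist_comm]
  by_cases hoz : o = z
  · subst hoz; simp [dist_comm]
  by_cases hox : o = x
  · subst hox; simp only [dist_self, dist_comm z o]; nlinarith
  by_cases hpx : p = x
  · subst hpx; simp only [dist_self, dist_comm z p, ← hpoz]; nlinarith
  by_cases hzx : z = x
  · subst hzx; simp only [dist_self, dist_comm z o, ← hpoz]; nlinarith
  obtain ⟨σ, hσ⟩ := hX.1 o trivial p trivial
  obtain ⟨σ', hσ'⟩ := hX.1 o trivial z trivial
  obtain ⟨τ, hτ⟩ := hX.1 o trivial x trivial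
  have ha : 0 < dist o p := dist_pos.2 hop
  have hb : 0 < dist o z := dist_pos.2 hoz
  have hh : 0 < dist o x := dist_pos.2 hox
  set c₁ := Real.cos (compAngle κ (dist o p) (dist o x) (dist p x)) with hc₁
  set c₂ := Real.cos (compAngle κ (dist o z) (dist o x) (dist z x)) with hc₂
  have key : c₁ + c₂ ≤ 0 := by
    refine le_of_forall_pos_le_add fun ε hε => ?_
    obtain ⟨ε₁, hε₁, H₁⟩ := hX.dist_sq_le hop hox hpx hσ hτ (η := ε / 4) (by positivity)
    obtain ⟨ε₂, hε₂, H₂⟩ := hX.dist_sq_le hoz hox hzx hσ' hτ (η := ε / 4) (by positivity)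
    set m := min (min ε₁ ε₂) (min (dist o p) (dist o z)) with hm
    have hm0 : 0 < m := by positivity
    have hm1 : m ≤ ε₁ := (min_le_left _ _).trans (min_le_left _ _)
    have hm2 : m ≤ ε₂ := (min_le_left _ _).trans (min_le_right _ _)
    have hm3 : m ≤ dist o p := (min_le_right _ _).trans (min_le_left _ _)
    have hm4 : m ≤ dist o z := (min_le_right _ _).trans (min_le_right _ _)
    set s := m / 2 with hs
    set l := min 1 (ε / 2) with hl
    have hl0 : 0 < l := by positivity
    have hl1 : l ≤ 1 := min_le_left _ _
    have hl2 : l ≤ ε / 2 := min_le_right _ _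
    have hs0 : 0 < s := by positivity
    have hsm : s < m := by rw [hs]; linarith
    have hls : l * s ≤ s := by nlinarith
    have h1 := H₁ s (l * s) hs0 (by linarith) (by positivity) (by linarith)
    have h2 := H₂ s (l * s) hs0 (by linarith) (by positivity) (by linarith)
    have e1 : dist (σ s) p = dist o p - s := by
      have := hσ.2.2.1.2 s ⟨hs0.le, by linarith⟩ (dist o p) ⟨dist_nonneg, le_rfl⟩
      simp only at this
      rw [hσ.2.1, abs_of_nonpos (by linarith)] at this
      linarith
    have e2 : dist (σ' s) z = dist o z - s := by
      have := hσ'.2.2.1.2 s ⟨hs0.le, by linarith⟩ (dist o z) ⟨dist_nonneg, le_rfl⟩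
      simp only at this
      rw [hσ'.2.1, abs_of_nonpos (by linarith)] at this
      linarith
    have t1 := dist_triangle4 p (σ s) (σ' s) z
    have t2 := dist_triangle_right (σ s) (σ' s) (τ (l * s))
    rw [dist_comm p (σ s), e1, e2, ← hpoz, dist_comm p o] at t1
    have h3 : 2 * s ≤ dist (σ s) (τ (l * s)) + dist (σ' s) (τ (l * s)) := by linarith
    have h4 : 4 * s ^ 2 ≤ 2 * (dist (σ s) (τ (l * s)) ^ 2 + dist (σ' s) (τ (l * s)) ^ 2) := by
      nlinarith [sq_nonneg (dist (σ s) (τ (l * s)) - dist (σ' s) (τ (l * s)))]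
    have h5 : 0 ≤ (l * s ^ 2) * (l - (c₁ + c₂ - ε / 2)) := by nlinarith
    have h6 := nonneg_of_mul_nonneg_right h5 (by positivity)
    linarith
  have k1 := le_cos_compAngle (κ := κ) (c := dist p x) hκ ha hh (dist_triangle_left _ _ _)
    (by have := dist_triangle_right o p x; linarith) (by
      have := dist_triangle o p x; linarith)
  have k2 := le_cos_compAngle (κ := κ) (c := dist z x) hκ hb hh (dist_triangle_left _ _ _)
    (by have := dist_triangle_right o z x; linarith) (by
      have := dist_triangle o z x; linarith)
  rw [← hc₁] at k1
  rw [← hc₂] at k2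
  rw [dist_comm p o, dist_comm x o]
  have k3 := mul_le_mul_of_nonneg_left k1 hb.le
  have k4 := mul_le_mul_of_nonneg_left k2 ha.le
  have k5 : 2 * dist o p * dist o z * dist o x * (c₁ + c₂) ≤ 0 :=
    mul_nonpos_of_nonneg_of_nonpos (by positivity) key
  nlinarith

end
end Cat2Cx

namespace Cat2Cx

/-! ### Geodesic spaces satisfying the CN inequality -/

/-- A geodesic metric space satisfying the CN inequality. -/
class CNSpace (X : Type*) [MetricSpace X] : Prop where
  cn : CN X
  exists_geod : ∀ x y : X, ∃ f : ℝ → X, f 0 = x ∧ f 1 = y ∧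
    ∀ s ∈ Icc (0:ℝ) 1, ∀ t ∈ Icc (0:ℝ) 1, dist (f s) (f t) = |s - t| * dist x y

theorem IsCATSpace.cnSpace {κ : ℝ} (hκ : κ ≤ 0) {X : Type*} [MetricSpace X]
    (hX : IsCATSpace κ X) : CNSpace X where
  cn := hX.cn hκ
  exists_geod x y := by
    obtain ⟨f, hf⟩ := hX.1 x trivial y trivial
    have hm : ∀ s ∈ Icc (0:ℝ) 1, s * dist x y ∈ Icc 0 (dist x y) := fun s hs =>
      ⟨mul_nonneg hs.1 dist_nonneg, mul_le_of_le_one_left dist_nonneg hs.2⟩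
    refine ⟨fun t => f (t * dist x y), by simpa using hf.1, by simpa using hf.2.1, ?_⟩
    intro s hs t ht
    have := hf.2.2.1.2 _ (hm s hs) _ (hm t ht)
    simpa only [← sub_mul, abs_mul, abs_of_nonneg (dist_nonneg (x := x) (y := y))] using this

/-- `o` lies metrically between `x` and `z`. -/
def Btw {X : Type*} [MetricSpace X] (x o z : X) : Prop := dist x o + dist o z = dist x z

section
variable {X : Type*} [MetricSpace X]

theorem Btw.symm {x o z : X} (h : Btw x o z) : Btw z o x := by
  unfold Btw at *
  rw [dist_comm z o, dist_comm o x, dist_comm z x]; linarith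

theorem btw_left (x z : X) : Btw x x z := by simp [Btw]

theorem btw_right (x z : X) : Btw x z z := by simp [Btw]

theorem Btw.trans_left {x y o z : X} (h : Btw x o z) (h' : Btw x y o) : Btw x y z := by
  unfold Btw at *
  have := dist_triangle y o z
  have := dist_triangle x y z
  linarith

theorem Btw.trans_left_right {x y o z : X} (h : Btw x o z) (h' : Btw x y o) : Btw y o z := by
  unfold Btw at *
  have := dist_triangle y o z
  have := dist_triangle x y z
  linarith

theorem Btw.trans_right {x y o z : X} (h : Btw x o z) (h' : Btw o y z) : Btw x y z :=
  (h.symm.trans_left h'.symm).symm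

theorem Btw.trans_right_left {x y o z : X} (h : Btw x o z) (h' : Btw o y z) : Btw x o y :=
  (h.symm.trans_left_right h'.symm).symm

theorem Btw.dist_left_le {x o z : X} (h : Btw x o z) : dist x o ≤ dist x z := by
  unfold Btw at h
  have := dist_nonneg (x := o) (y := z)
  linarith

theorem Btw.dist_right_le {x o z : X} (h : Btw x o z) : dist o z ≤ dist x z := by
  unfold Btw at h
  have := dist_nonneg (x := x) (y := o)
  linarith

theorem ret_param_mem (w : X) {r : ℝ} (hr : 0 ≤ r) (x : X) :
    min 1 (r / dist w x) ∈ Icc (0:ℝ) 1 := ⟨by positivity, min_le_left _ _⟩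

variable [CNSpace X]

theorem Btw.cn {p o z : X} (h : Btw p o z) (x : X) :
    dist p z * (dist x o ^ 2 + dist p o * dist o z) ≤
      dist o z * dist p x ^ 2 + dist p o * dist z x ^ 2 := by
  have := CNSpace.cn p o z x h
  rwa [show dist p o + dist o z = dist p z from h] at this

theorem Btw.eq_of_dist_eq {x o o' z : X} (h : Btw x o z) (h' : Btw x o' z)
    (hd : dist x o = dist x o') : o = o' := by
  have k := h.cn o'
  unfold Btw at h h'
  have e : dist z o' = dist o z := by rw [dist_comm z o']; linarith
  rw [← hd, e, ← h] at k
  rcases (dist_nonneg (x := x) (y := z)).eq_or_lt with h0 | h0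
  · have := dist_nonneg (x := x) (y := o)
    have := dist_nonneg (x := o) (y := z)
    have e1 : dist x o = 0 := by linarith
    rw [← dist_eq_zero.1 e1, ← dist_eq_zero.1 (hd ▸ e1 : dist x o' = 0)]
  · have : dist x z * dist o' o ^ 2 ≤ 0 := by rw [← h]; nlinarith
    have : dist o' o ^ 2 ≤ 0 := nonpos_of_mul_nonpos_right this h0
    exact (dist_eq_zero.1 (by nlinarith [dist_nonneg (x := o') (y := o)] : dist o' o = 0)).symm

/-- Two points of a common geodesic are comparable along it. -/
theorem Btw.btw_of_dist_le {x o o' z : X} (h : Btw x o z) (h' : Btw x o' z)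
    (hd : dist x o ≤ dist x o') : Btw x o o' := by
  obtain ⟨f, f0, f1, hf⟩ := CNSpace.exists_geod x z
  rcases (dist_nonneg (x := x) (y := z)).eq_or_lt with h0 | h0
  · have e1 : dist x o = 0 := le_antisymm (h.dist_left_le.trans h0.symm.le) dist_nonneg
    rw [← dist_eq_zero.1 e1]
    exact btw_left _ _
  have hm : ∀ {y}, Btw x y z → dist x y / dist x z ∈ Icc (0:ℝ) 1 := fun hy =>
    ⟨by positivity, (div_le_one h0).2 hy.dist_left_le⟩
  have key : ∀ {y}, Btw x y z → f (dist x y / dist x z) = y := by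
    intro y hy
    have d0 : dist x (f (dist x y / dist x z)) = dist x y := by
      have := hf 0 ⟨le_rfl, zero_le_one⟩ _ (hm hy)
      rw [f0, zero_sub, abs_neg, abs_of_nonneg (hm hy).1, div_mul_cancel₀ _ h0.ne'] at this
      exact this
    refine Btw.eq_of_dist_eq (x := x) (z := z) ?_ hy d0
    have := hf _ (hm hy) 1 ⟨zero_le_one, le_rfl⟩
    rw [f1, abs_of_nonpos (by linarith [(hm hy).2]), neg_sub, sub_mul, div_mul_cancel₀ _ h0.ne',
      one_mul] at this
    unfold Btw
    linarith
  have e := hf _ (hm h) _ (hm h')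
  rw [key h, key h', abs_of_nonpos (by rw [sub_nonpos]; gcongr), neg_sub, sub_mul,
    div_mul_cancel₀ _ h0.ne', div_mul_cancel₀ _ h0.ne'] at e
  unfold Btw
  linarith

/-- The point at parameter `t` of the geodesic from `x` to `y`, parametrized by `[0,1]`. -/
noncomputable def gp (x y : X) (t : ℝ) : X := (CNSpace.exists_geod x y).choose t

@[simp] theorem gp_zero (x y : X) : gp x y 0 = x := (CNSpace.exists_geod x y).choose_spec.1

@[simp] theorem gp_one (x y : X) : gp x y 1 = y := (CNSpace.exists_geod x y).choose_spec.2.1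

theorem dist_gp_gp (x y : X) {s t : ℝ} (hs : s ∈ Icc (0:ℝ) 1) (ht : t ∈ Icc (0:ℝ) 1) :
    dist (gp x y s) (gp x y t) = |s - t| * dist x y :=
  (CNSpace.exists_geod x y).choose_spec.2.2 s hs t ht

theorem dist_left_gp (x y : X) {t : ℝ} (ht : t ∈ Icc (0:ℝ) 1) :
    dist x (gp x y t) = t * dist x y := by
  have := dist_gp_gp x y ⟨le_rfl, zero_le_one⟩ ht
  simpa [abs_of_nonneg ht.1] using this

theorem dist_gp_right (x y : X) {t : ℝ} (ht : t ∈ Icc (0:ℝ) 1) :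
    dist (gp x y t) y = (1 - t) * dist x y := by
  have := dist_gp_gp x y ht ⟨zero_le_one, le_rfl⟩
  rwa [gp_one, abs_of_nonpos (by linarith [ht.2]), neg_sub] at this

theorem btw_gp (x y : X) {t : ℝ} (ht : t ∈ Icc (0:ℝ) 1) : Btw x (gp x y t) y := by
  unfold Btw
  rw [dist_left_gp x y ht, dist_gp_right x y ht]; ring

theorem Btw.eq_gp {x o z : X} (h : Btw x o z) {t : ℝ} (ht : t ∈ Icc (0:ℝ) 1)
    (hd : dist x o = t * dist x z) : o = gp x z t :=
  h.eq_of_dist_eq (btw_gp x z ht) (by rw [hd, dist_left_gp x z ht])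

theorem Btw.exists_eq_gp {x o z : X} (h : Btw x o z) : ∃ t ∈ Icc (0:ℝ) 1, o = gp x z t := by
  rcases (dist_nonneg (x := x) (y := z)).eq_or_lt with h0 | h0
  · refine ⟨0, ⟨le_rfl, zero_le_one⟩, ?_⟩
    have e1 : dist x o = 0 := le_antisymm (h.dist_left_le.trans h0.symm.le) dist_nonneg
    rw [gp_zero, dist_eq_zero.1 e1]
  · have ht : dist x o / dist x z ∈ Icc (0:ℝ) 1 :=
      ⟨by positivity, (div_le_one h0).2 h.dist_left_le⟩
    exact ⟨_, ht, h.eq_gp ht (div_mul_cancel₀ _ h0.ne').symm⟩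

theorem dist_gp_sq_le (w z x : X) {t : ℝ} (ht : t ∈ Icc (0:ℝ) 1) :
    dist x (gp w z t) ^ 2 ≤
      (1 - t) * dist w x ^ 2 + t * dist z x ^ 2 - t * (1 - t) * dist w z ^ 2 := by
  rcases (dist_nonneg (x := w) (y := z)).eq_or_lt with h0 | h0
  · have e1 : dist w (gp w z t) = 0 := by rw [dist_left_gp w z ht, ← h0, mul_zero]
    rw [← dist_eq_zero.1 e1, ← dist_eq_zero.1 h0.symm, dist_self, dist_comm x w]
    linarith
  · have := (btw_gp w z ht).cn x
    rw [dist_left_gp w z ht, dist_gp_right w z ht] at this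
    refine le_of_mul_le_mul_left ?_ h0
    linarith

theorem dist_gp_gp_le (w z z' : X) {t : ℝ} (ht : t ∈ Icc (0:ℝ) 1) :
    dist (gp w z t) (gp w z' t) ≤ t * dist z z' := by
  have h1 := dist_gp_sq_le w z' (gp w z t) ht
  have h2 := dist_gp_sq_le w z z' ht
  rw [dist_left_gp w z ht] at h1
  have h3 : dist (gp w z t) (gp w z' t) ^ 2 ≤ (t * dist z z') ^ 2 := by
    have := mul_le_mul_of_nonneg_left h2 ht.1
    linarith
  exact (le_abs_self _).trans (abs_le_of_sq_le_sq h3 (mul_nonneg ht.1 dist_nonneg))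

theorem dist_gp_gp_le' (w z z' : X) {t t' : ℝ} (ht : t ∈ Icc (0:ℝ) 1) (ht' : t' ∈ Icc (0:ℝ) 1) :
    dist (gp w z t) (gp w z' t') ≤ t * dist z z' + |t - t'| * dist w z' :=
  (dist_triangle _ (gp w z' t) _).trans
    (add_le_add (dist_gp_gp_le w z z' ht) (dist_gp_gp w z' ht ht').le)

theorem continuousOn_gp (x y : X) : ContinuousOn (gp x y) (Icc 0 1) := by
  have : LipschitzOnWith (Real.toNNReal (dist x y)) (gp x y) (Icc 0 1) := by
    refine LipschitzOnWith.of_dist_le_mul fun s hs t ht => ?_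
    rw [dist_gp_gp x y hs ht, Real.coe_toNNReal _ dist_nonneg, mul_comm, Real.dist_eq]
  exact this.continuousOn

/-- The geodesic contraction to a point is jointly continuous. -/
theorem continuousOn_gp_right (w : X) :
    ContinuousOn (fun q : X × ℝ => gp w q.1 q.2) (univ ×ˢ Icc 0 1) := by
  rintro ⟨z, t⟩ ⟨-, ht⟩
  rw [ContinuousWithinAt, tendsto_iff_dist_tendsto_zero]
  have hc : Tendsto (fun q : X × ℝ => dist z q.1 + |t - q.2| * dist w q.1)
      (nhdsWithin (z, t) (univ ×ˢ Icc 0 1)) (nhds 0) := by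
    have : Continuous fun q : X × ℝ => dist z q.1 + |t - q.2| * dist w q.1 := by fun_prop
    have h := this.tendsto (z, t)
    simp only [dist_self, sub_self, abs_zero, zero_mul, add_zero] at h
    exact h.mono_left nhdsWithin_le_nhds
  refine squeeze_zero' (Eventually.of_forall fun _ => dist_nonneg) ?_ hc
  filter_upwards [self_mem_nhdsWithin] with q hq
  rw [dist_comm]
  refine (dist_gp_gp_le' w z q.1 ht hq.2).trans ?_
  gcongr
  exact mul_le_of_le_one_left dist_nonneg ht.2

theorem Btw.mem_closedBall {x o z c : X} {r : ℝ} (h : Btw x o z) (hx : dist c x ≤ r)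
    (hz : dist c z ≤ r) : dist c o ≤ r := by
  obtain ⟨t, ht, rfl⟩ := h.exists_eq_gp
  have k := dist_gp_sq_le x z c ht
  have hr : 0 ≤ r := dist_nonneg.trans hx
  rw [dist_comm x c, dist_comm z c] at k
  have h1 : dist c x ^ 2 ≤ r ^ 2 := by gcongr
  have h2 : dist c z ^ 2 ≤ r ^ 2 := by gcongr
  have h3 : 0 ≤ t * (1 - t) * dist x z ^ 2 :=
    mul_nonneg (mul_nonneg ht.1 (by linarith [ht.2])) (sq_nonneg _)
  have h4 : dist c (gp x z t) ^ 2 ≤ r ^ 2 := by nlinarith [ht.1, ht.2]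
  exact (le_abs_self _).trans (abs_le_of_sq_le_sq h4 hr)

theorem Btw.mem_ball {x o z c : X} {r : ℝ} (h : Btw x o z) (hx : x ∈ ball c r)
    (hz : z ∈ ball c r) : o ∈ ball c r := by
  rw [mem_ball'] at *
  exact lt_of_le_of_lt (h.mem_closedBall (le_max_left _ _) (le_max_right _ _)) (max_lt hx hz)

/-- Local geodesics are geodesics. -/
theorem Btw.concat {u y w x : X} (h : Btw u y w) (h' : Btw y w x) (hne : y ≠ w) : Btw u w x := by
  have hyw : 0 < dist y w := dist_pos.2 hne
  have huw : 0 < dist u w := hyw.trans_le h.dist_right_le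
  set t := dist y w / dist u w with ht
  have ht' : t ∈ Icc (0:ℝ) 1 := ⟨by positivity, (div_le_one huw).2 h.dist_right_le⟩
  have e1 : y = gp w u t := h.symm.eq_gp ht' (by
    rw [ht, dist_comm w y, dist_comm w u, div_mul_cancel₀ _ huw.ne'])
  have k := dist_gp_gp_le w u x ht'
  rw [← e1] at k
  have b := h'.trans_right_left (btw_gp w x ht')
  have b' : dist y w + dist w (gp w x t) = dist y (gp w x t) := b
  rw [dist_left_gp w x ht'] at b'
  have e2 : dist y w = t * dist u w := by rw [ht, div_mul_cancel₀ _ huw.ne']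
  have ht0 : 0 < t := by positivity
  have : t * (dist u w + dist w x) ≤ t * dist u x := by linarith
  have := le_of_mul_le_mul_left this ht0
  exact le_antisymm this (dist_triangle _ _ _)

/-- The radial retraction onto the closed ball of radius `r` about `w`. -/
noncomputable def ret (w : X) (r : ℝ) (x : X) : X := gp w x (min 1 (r / dist w x))

theorem btw_ret (w : X) {r : ℝ} (hr : 0 ≤ r) (x : X) : Btw w (ret w r x) x :=
  btw_gp w x (ret_param_mem w hr x)

theorem dist_ret (w : X) {r : ℝ} (hr : 0 ≤ r) (x : X) :
    dist w (ret w r x) = min (dist w x) r := by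
  rw [ret, dist_left_gp w x (ret_param_mem w hr x)]
  rcases (dist_nonneg (x := w) (y := x)).eq_or_lt with h0 | h0
  · rw [← h0, mul_zero, min_eq_left hr]
  · rw [min_mul_of_nonneg _ _ h0.le, one_mul, div_mul_cancel₀ _ h0.ne']

theorem ret_eq_self {w : X} {r : ℝ} {x : X} (h : dist w x ≤ r) : ret w r x = x := by
  have hr : 0 ≤ r := dist_nonneg.trans h
  exact (btw_ret w hr x).eq_of_dist_eq (btw_right w x) (by rw [dist_ret w hr, min_eq_left h])

theorem dist_ret_ret_le (w : X) {r : ℝ} (hr : 0 ≤ r) (x x' : X) :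
    dist (ret w r x) (ret w r x') ≤ 3 * dist x x' := by
  have hm := ret_param_mem w hr x
  have hm' := ret_param_mem w hr x'
  have h := dist_gp_gp_le' w x x' hm hm'
  have e := dist_ret w hr x
  have e' := dist_ret w hr x'
  rw [ret, dist_left_gp w x hm] at e
  rw [ret, dist_left_gp w x' hm'] at e'
  unfold ret
  generalize min 1 (r / dist w x) = t at *
  generalize min 1 (r / dist w x') = t' at *
  have hdd : |dist w x - dist w x'| ≤ dist x x' := by
    rw [dist_comm w x, dist_comm w x']; exact abs_dist_sub_le x x' w
  have h1 : |t - t'| * dist w x' ≤ 2 * dist x x' := by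
    rw [← abs_of_nonneg (dist_nonneg (x := w) (y := x')), ← abs_mul, sub_mul, e']
    have s1 : t * dist w x' - min (dist w x') r =
        -(t * (dist w x - dist w x')) + (min (dist w x) r - min (dist w x') r) := by
      rw [← e]; ring
    rw [s1]
    refine (abs_add_le _ _).trans ?_
    rw [abs_neg, abs_mul, abs_of_nonneg hm.1]
    have s2 : |min (dist w x) r - min (dist w x') r| ≤ |dist w x - dist w x'| := by
      simpa using abs_min_sub_min_le_max (dist w x) r (dist w x') r
    have s3 : t * |dist w x - dist w x'| ≤ |dist w x - dist w x'| :=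
      mul_le_of_le_one_left (abs_nonneg _) hm.2
    linarith
  have h2 : t * dist x x' ≤ dist x x' := mul_le_of_le_one_left dist_nonneg hm.2
  linarith

theorem continuous_ret (w : X) {r : ℝ} (hr : 0 ≤ r) : Continuous (ret w r) :=
  (LipschitzWith.of_dist_le_mul (K := 3) fun x x' => by
    simpa using dist_ret_ret_le w hr x x').continuous

end
end Cat2Cx

namespace Cat2Cx

/-! ### Projective charts of the model plane -/

/-- The chart `k` of the plane with distance function `d` is projective: geodesics are mapped
to straight segments. -/
structure IsProjectiveChart (d : ℝ × ℝ → ℝ × ℝ → ℝ) (k : ℝ × ℝ → ℂ) : Prop where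
  openEmbedding : Topology.IsOpenEmbedding k
  convex_range : Convex ℝ (range k)
  continuous_dist : Continuous fun q : (ℝ × ℝ) × (ℝ × ℝ) => d q.1 q.2
  dist_nonneg : ∀ u v, 0 ≤ d u v
  dist_self : ∀ u, d u u = 0
  dist_comm : ∀ u v, d u v = d v u
  lipschitz : ∃ C > 0, ∀ u v, ‖k u - k v‖ ≤ C * d u v
  add_iff : ∀ u w v, d u w + d w v = d u v ↔ k w ∈ segment ℝ (k u) (k v)

theorem isProjectiveChart_zero :
    IsProjectiveChart (mDist 0) (Complex.equivRealProdCLM.symm : ℝ × ℝ → ℂ) := by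
  have hd : ∀ u v, mDist 0 u v =
      dist (Complex.equivRealProdCLM.symm u) (Complex.equivRealProdCLM.symm v) := by
    intro u v
    rw [Complex.dist_eq_re_im]
    simp [mDist]
  refine ⟨Complex.equivRealProdCLM.symm.toHomeomorph.isOpenEmbedding, ?_, ?_, ?_, ?_, ?_, ?_, ?_⟩
  · rw [(Complex.equivRealProdCLM.symm.surjective).range_eq]
    exact convex_univ
  · simp only [hd]
    exact (Complex.equivRealProdCLM.symm.continuous.comp continuous_fst).dist
      (Complex.equivRealProdCLM.symm.continuous.comp continuous_snd)
  · intro u v; rw [hd]; exact dist_nonneg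
  · intro u; rw [hd]; exact dist_self _
  · intro u v; rw [hd, hd]; exact dist_comm _ _
  · exact ⟨1, one_pos, fun u v => by rw [hd, one_mul, dist_eq_norm]⟩
  · intro u w v
    rw [hd, hd, hd, mem_segment_iff_wbtw, dist_add_dist_eq_iff]

/-- The Lorentz form of the points of the hyperboloid over `u` and `v`. -/
noncomputable def lorentz (u v : ℝ × ℝ) : ℝ :=
  Real.sqrt (1 + u.1 ^ 2 + u.2 ^ 2) * Real.sqrt (1 + v.1 ^ 2 + v.2 ^ 2) - u.1 * v.1 - u.2 * v.2

/-- The Klein chart of the hyperboloid model. -/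
noncomputable def klein (u : ℝ × ℝ) : ℂ :=
  OpenPartialHomeomorph.univUnitBall (Complex.equivRealProdCLM.symm u)

theorem klein_re (u : ℝ × ℝ) : (klein u).re = u.1 / Real.sqrt (1 + u.1 ^ 2 + u.2 ^ 2) := by
  have : ‖Complex.equivRealProdCLM.symm u‖ ^ 2 = u.1 ^ 2 + u.2 ^ 2 := by
    rw [Complex.sq_norm, Complex.normSq_apply]; simp; ring
  rw [klein, OpenPartialHomeomorph.univUnitBall_apply, this, ← add_assoc,
    Complex.real_smul, Complex.re_ofReal_mul, div_eq_inv_mul]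
  simp

theorem klein_im (u : ℝ × ℝ) : (klein u).im = u.2 / Real.sqrt (1 + u.1 ^ 2 + u.2 ^ 2) := by
  have : ‖Complex.equivRealProdCLM.symm u‖ ^ 2 = u.1 ^ 2 + u.2 ^ 2 := by
    rw [Complex.sq_norm, Complex.normSq_apply]; simp; ring
  rw [klein, OpenPartialHomeomorph.univUnitBall_apply, this, ← add_assoc,
    Complex.real_smul, Complex.im_ofReal_mul, div_eq_inv_mul]
  simp

theorem klein_openEmbedding : Topology.IsOpenEmbedding klein :=
  (OpenPartialHomeomorph.univUnitBall.isOpenEmbedding rfl).comp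
    Complex.equivRealProdCLM.symm.toHomeomorph.isOpenEmbedding

theorem range_klein : range klein = ball 0 1 := by
  have h1 : range klein = range (OpenPartialHomeomorph.univUnitBall : ℂ → ℂ) := by
    change range ((OpenPartialHomeomorph.univUnitBall : ℂ → ℂ) ∘ _) = _
    exact Complex.equivRealProdCLM.symm.surjective.range_comp _
  rw [h1, ← image_univ]
  exact OpenPartialHomeomorph.univUnitBall.image_source_eq_target

theorem lorentz_comm (u v : ℝ × ℝ) : lorentz u v = lorentz v u := by unfold lorentz; ring

theorem lorentz_self (u : ℝ × ℝ) : lorentz u u = 1 := by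
  unfold lorentz
  rw [Real.mul_self_sqrt (by positivity)]; ring

theorem norm_klein_sub_sq_le (u v : ℝ × ℝ) :
    ‖klein u - klein v‖ ^ 2 ≤ lorentz u v ^ 2 - 1 := by
  rw [Complex.sq_norm, Complex.normSq_apply, Complex.sub_re, Complex.sub_im, klein_re, klein_re,
    klein_im, klein_im]
  unfold lorentz
  have hU : Real.sqrt (1 + u.1 ^ 2 + u.2 ^ 2) ^ 2 = 1 + u.1 ^ 2 + u.2 ^ 2 :=
    Real.sq_sqrt (by positivity)
  have hV : Real.sqrt (1 + v.1 ^ 2 + v.2 ^ 2) ^ 2 = 1 + v.1 ^ 2 + v.2 ^ 2 :=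
    Real.sq_sqrt (by positivity)
  have hU0 : 0 < Real.sqrt (1 + u.1 ^ 2 + u.2 ^ 2) := by positivity
  have hV0 : 0 < Real.sqrt (1 + v.1 ^ 2 + v.2 ^ 2) := by positivity
  generalize Real.sqrt (1 + u.1 ^ 2 + u.2 ^ 2) = U at *
  generalize Real.sqrt (1 + v.1 ^ 2 + v.2 ^ 2) = V at *
  obtain ⟨u1, u2⟩ := u
  obtain ⟨v1, v2⟩ := v
  simp only at *
  set m1 := U * v1 - V * u1
  set m2 := U * v2 - V * u2
  have e1 : (U * V - u1 * v1 - u2 * v2) ^ 2 - 1 =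
      m1 ^ 2 + m2 ^ 2 - (u1 * v2 - u2 * v1) ^ 2 := by
    simp only [m1, m2]; linear_combination (V^2 - v1^2-v2^2) * hU + hV
  have e2 : U ^ 2 * (u1 * v2 - u2 * v1) ^ 2 = (u1 * m2 - u2 * m1) ^ 2 := by
    simp only [m1, m2]; ring
  have e3 : (u1 * m2 - u2 * m1) ^ 2 ≤ (u1 ^ 2 + u2 ^ 2) * (m1 ^ 2 + m2 ^ 2) := by
    nlinarith [sq_nonneg (u1 * m1 + u2 * m2)]
  have e4 : (m1 ^ 2 + m2 ^ 2) ≤ U ^ 2 * ((U * V - u1 * v1 - u2 * v2) ^ 2 - 1) := by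
    rw [e1, mul_sub, e2]
    nlinarith
  have e5 : (u1 / U - v1 / V) * (u1 / U - v1 / V) + (u2 / U - v2 / V) * (u2 / U - v2 / V) =
      (m1 ^ 2 + m2 ^ 2) / (U ^ 2 * V ^ 2) := by
    simp only [m1, m2]; field_simp; ring
  rw [e5, div_le_iff₀ (by positivity)]
  have hV1 : 1 ≤ V ^ 2 := by nlinarith [sq_nonneg v1, sq_nonneg v2]
  have e6 : 0 ≤ U ^ 2 * ((U * V - u1 * v1 - u2 * v2) ^ 2 - 1) := by
    refine le_trans ?_ e4; positivity
  nlinarith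

theorem one_le_lorentz (u v : ℝ × ℝ) : 1 ≤ lorentz u v := by
  have h1 := norm_klein_sub_sq_le u v
  have h2 : 0 < lorentz u v := by
    unfold lorentz
    have hU : Real.sqrt (1 + u.1 ^ 2 + u.2 ^ 2) ^ 2 = 1 + u.1 ^ 2 + u.2 ^ 2 :=
      Real.sq_sqrt (by positivity)
    have hV : Real.sqrt (1 + v.1 ^ 2 + v.2 ^ 2) ^ 2 = 1 + v.1 ^ 2 + v.2 ^ 2 :=
      Real.sq_sqrt (by positivity)
    have hU0 : 0 < Real.sqrt (1 + u.1 ^ 2 + u.2 ^ 2) := by positivity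
    have hV0 : 0 < Real.sqrt (1 + v.1 ^ 2 + v.2 ^ 2) := by positivity
    have hlt : (u.1 * v.1 + u.2 * v.2) ^ 2 <
        (Real.sqrt (1 + u.1 ^ 2 + u.2 ^ 2) * Real.sqrt (1 + v.1 ^ 2 + v.2 ^ 2)) ^ 2 := by
      rw [mul_pow, hU, hV]
      nlinarith [sq_nonneg (u.1 * v.2 - u.2 * v.1), sq_nonneg u.1, sq_nonneg u.2,
        sq_nonneg v.1, sq_nonneg v.2]
    have := lt_of_pow_lt_pow_left₀ 2 (by positivity) hlt
    linarith
  nlinarith [sq_nonneg ‖klein u - klein v‖]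

theorem lorentz_gram (u w v : ℝ × ℝ) :
    (lorentz u w ^ 2 - 1) * (lorentz w v ^ 2 - 1) -
        (lorentz u v - lorentz u w * lorentz w v) ^ 2 =
      (Real.sqrt (1 + u.1 ^ 2 + u.2 ^ 2) * Real.sqrt (1 + w.1 ^ 2 + w.2 ^ 2) *
        Real.sqrt (1 + v.1 ^ 2 + v.2 ^ 2) *
        (((klein w).re - (klein u).re) * ((klein v).im - (klein u).im) -
          ((klein w).im - (klein u).im) * ((klein v).re - (klein u).re))) ^ 2 := by
  rw [klein_re, klein_re, klein_re, klein_im, klein_im, klein_im]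
  unfold lorentz
  have hU : Real.sqrt (1 + u.1 ^ 2 + u.2 ^ 2) ^ 2 = 1 + u.1 ^ 2 + u.2 ^ 2 :=
    Real.sq_sqrt (by positivity)
  have hV : Real.sqrt (1 + v.1 ^ 2 + v.2 ^ 2) ^ 2 = 1 + v.1 ^ 2 + v.2 ^ 2 :=
    Real.sq_sqrt (by positivity)
  have hW : Real.sqrt (1 + w.1 ^ 2 + w.2 ^ 2) ^ 2 = 1 + w.1 ^ 2 + w.2 ^ 2 :=
    Real.sq_sqrt (by positivity)
  have hU0 : 0 < Real.sqrt (1 + u.1 ^ 2 + u.2 ^ 2) := by positivity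
  have hV0 : 0 < Real.sqrt (1 + v.1 ^ 2 + v.2 ^ 2) := by positivity
  have hW0 : 0 < Real.sqrt (1 + w.1 ^ 2 + w.2 ^ 2) := by positivity
  generalize Real.sqrt (1 + u.1 ^ 2 + u.2 ^ 2) = U at *
  generalize Real.sqrt (1 + v.1 ^ 2 + v.2 ^ 2) = V at *
  generalize Real.sqrt (1 + w.1 ^ 2 + w.2 ^ 2) = W at *
  obtain ⟨u1, u2⟩ := u
  obtain ⟨v1, v2⟩ := v
  obtain ⟨w1, w2⟩ := w
  simp only at *
  have e : U * W * V * ((w1 / W - u1 / U) * (v2 / V - u2 / U) -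
      (w2 / W - u2 / U) * (v1 / V - u1 / U)) =
      U * (w1 * v2 - w2 * v1) - W * (u1 * v2 - u2 * v1) + V * (u1 * w2 - u2 * w1) := by
    field_simp; ring
  rw [e]
  have hqu : U ^ 2 - u1 ^ 2 - u2 ^ 2 = 1 := by linarith
  have hqv : V ^ 2 - v1 ^ 2 - v2 ^ 2 = 1 := by linarith
  have hqw : W ^ 2 - w1 ^ 2 - w2 ^ 2 = 1 := by linarith
  have gram : (U ^ 2 - u1 ^ 2 - u2 ^ 2) * (V ^ 2 - v1 ^ 2 - v2 ^ 2) * (W ^ 2 - w1 ^ 2 - w2 ^ 2)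
      + 2 * (U * W - u1 * w1 - u2 * w2) * (W * V - w1 * v1 - w2 * v2) * (U * V - u1 * v1 - u2 * v2)
      - (U ^ 2 - u1 ^ 2 - u2 ^ 2) * (W * V - w1 * v1 - w2 * v2) ^ 2
      - (V ^ 2 - v1 ^ 2 - v2 ^ 2) * (U * W - u1 * w1 - u2 * w2) ^ 2
      - (W ^ 2 - w1 ^ 2 - w2 ^ 2) * (U * V - u1 * v1 - u2 * v2) ^ 2
      = (U * (w1 * v2 - w2 * v1) - W * (u1 * v2 - u2 * v1) + V * (u1 * w2 - u2 * w1)) ^ 2 := by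
    ring
  rw [hqu, hqv, hqw] at gram
  rw [← gram]
  ring

theorem lorentz_mul_le_of_mem_segment {u w v : ℝ × ℝ}
    (h : klein w ∈ segment ℝ (klein u) (klein v)) :
    lorentz u w * lorentz w v ≤ lorentz u v := by
  have hc := one_le_lorentz u v
  obtain ⟨s, t, hs, ht, hst, h⟩ := h
  have h1 := congrArg Complex.re h
  have h2 := congrArg Complex.im h
  simp only [Complex.add_re, Complex.add_im, Complex.real_smul, Complex.re_ofReal_mul,
    Complex.im_ofReal_mul, klein_re, klein_im] at h1 h2
  unfold lorentz at *
  have hU : Real.sqrt (1 + u.1 ^ 2 + u.2 ^ 2) ^ 2 = 1 + u.1 ^ 2 + u.2 ^ 2 :=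
    Real.sq_sqrt (by positivity)
  have hV : Real.sqrt (1 + v.1 ^ 2 + v.2 ^ 2) ^ 2 = 1 + v.1 ^ 2 + v.2 ^ 2 :=
    Real.sq_sqrt (by positivity)
  have hW : Real.sqrt (1 + w.1 ^ 2 + w.2 ^ 2) ^ 2 = 1 + w.1 ^ 2 + w.2 ^ 2 :=
    Real.sq_sqrt (by positivity)
  have hU0 : 0 < Real.sqrt (1 + u.1 ^ 2 + u.2 ^ 2) := by positivity
  have hV0 : 0 < Real.sqrt (1 + v.1 ^ 2 + v.2 ^ 2) := by positivity
  have hW0 : 0 < Real.sqrt (1 + w.1 ^ 2 + w.2 ^ 2) := by positivity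
  generalize Real.sqrt (1 + u.1 ^ 2 + u.2 ^ 2) = U at *
  generalize Real.sqrt (1 + v.1 ^ 2 + v.2 ^ 2) = V at *
  generalize Real.sqrt (1 + w.1 ^ 2 + w.2 ^ 2) = W at *
  obtain ⟨u1, u2⟩ := u
  obtain ⟨v1, v2⟩ := v
  obtain ⟨w1, w2⟩ := w
  simp only at *
  obtain ⟨l, hl⟩ : ∃ l, l = s * W / U := ⟨_, rfl⟩
  obtain ⟨m, hm⟩ : ∃ m, m = t * W / V := ⟨_, rfl⟩
  have hl0 : 0 ≤ l := by rw [hl]; positivity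
  have hm0 : 0 ≤ m := by rw [hm]; positivity
  have e1 : w1 = l * u1 + m * v1 := by
    rw [hl, hm]; field_simp at h1 ⊢; linarith
  have e2 : w2 = l * u2 + m * v2 := by
    rw [hl, hm]; field_simp at h2 ⊢; linarith
  have e3 : W = l * U + m * V := by
    rw [hl, hm]; field_simp; linarith
  clear h1 h2 hl hm h
  set c := U * V - u1 * v1 - u2 * v2 with hcdef
  have ea : U * W - u1 * w1 - u2 * w2 = l + m * c := by
    rw [e1, e2, e3, hcdef]; linear_combination l * hU
  have eb : W * V - w1 * v1 - w2 * v2 = l * c + m := by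
    rw [e1, e2, e3, hcdef]; linear_combination m * hV
  have e4 : l ^ 2 + m ^ 2 + 2 * l * m * c = 1 := by
    rw [e1, e2, e3] at hW
    rw [hcdef]; linear_combination hW - l ^ 2 * hU - m ^ 2 * hV
  rw [ea, eb]
  have : c - (l + m * c) * (l * c + m) = l * m * (c ^ 2 - 1) := by
    linear_combination -c * e4
  have : 0 ≤ l * m * (c ^ 2 - 1) := mul_nonneg (mul_nonneg hl0 hm0) (by nlinarith)
  linarith

theorem collinear_of_cross_eq_zero {a b c : ℂ}
    (h : (b.re - a.re) * (c.im - a.im) - (b.im - a.im) * (c.re - a.re) = 0) :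
    Collinear ℝ {a, b, c} := by
  rw [collinear_iff_of_mem (p₀ := a) (by simp)]
  by_cases hac : c = a
  · refine ⟨b - a, fun p hp => ?_⟩
    rcases hp with rfl | rfl | rfl
    · exact ⟨0, by simp⟩
    · exact ⟨1, by simp⟩
    · exact ⟨0, by simp [hac]⟩
  · refine ⟨c - a, fun p hp => ?_⟩
    rcases hp with rfl | rfl | rfl
    · exact ⟨0, by simp⟩
    · have hn : 0 < (c.re - a.re) ^ 2 + (c.im - a.im) ^ 2 := by
        by_contra hle
        apply hac
        apply Complex.ext <;> nlinarith [sq_nonneg (c.re - a.re), sq_nonneg (c.im - a.im)]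
      refine ⟨((p.re - a.re) * (c.re - a.re) + (p.im - a.im) * (c.im - a.im)) /
        ((c.re - a.re) ^ 2 + (c.im - a.im) ^ 2), ?_⟩
      apply Complex.ext
      · simp only [vadd_eq_add, Complex.add_re, Complex.real_smul, Complex.re_ofReal_mul,
          Complex.sub_re]
        field_simp
        linear_combination (c.im - a.im) * h
      · simp only [vadd_eq_add, Complex.add_im, Complex.real_smul, Complex.im_ofReal_mul,
          Complex.sub_im]
        field_simp
        linear_combination (-(c.re - a.re)) * h
    · exact ⟨1, by simp⟩

theorem arcosh_eq (x : ℝ) : arcosh x = Real.arcosh x := rfl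

theorem arcosh_lorentz_add_of_mem_segment {u w v : ℝ × ℝ}
    (h : klein w ∈ segment ℝ (klein u) (klein v)) :
    arcosh (lorentz u w) + arcosh (lorentz w v) = arcosh (lorentz u v) := by
  have ha := one_le_lorentz u w
  have hb := one_le_lorentz w v
  have hc := one_le_lorentz u v
  have hle := lorentz_mul_le_of_mem_segment h
  have hg := lorentz_gram u w v
  obtain ⟨s, t, hs, ht, hst, h⟩ := h
  have h1 := congrArg Complex.re h
  have h2 := congrArg Complex.im h
  simp only [Complex.add_re, Complex.add_im, Complex.real_smul, Complex.re_ofReal_mul,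
    Complex.im_ofReal_mul] at h1 h2
  have h0 : ((klein w).re - (klein u).re) * ((klein v).im - (klein u).im) -
      ((klein w).im - (klein u).im) * ((klein v).re - (klein u).re) = 0 := by
    rw [← h1, ← h2, show s = 1 - t by linarith]; ring
  rw [h0, mul_zero, zero_pow two_ne_zero] at hg
  simp only [arcosh_eq]
  have k : Real.cosh (Real.arcosh (lorentz u w) + Real.arcosh (lorentz w v)) =
      Real.cosh (Real.arcosh (lorentz u v)) := by
    rw [Real.cosh_add, Real.cosh_arcosh ha, Real.cosh_arcosh hb, Real.cosh_arcosh hc,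
      Real.sinh_arcosh ha, Real.sinh_arcosh hb, ← Real.sqrt_mul (by nlinarith)]
    rw [show (lorentz u w ^ 2 - 1) * (lorentz w v ^ 2 - 1) =
      (lorentz u v - lorentz u w * lorentz w v) ^ 2 by linarith,
      Real.sqrt_sq (by linarith)]
    ring
  exact Real.cosh_injOn (add_nonneg (Real.arcosh_nonneg ha) (Real.arcosh_nonneg hb))
    (Real.arcosh_nonneg hc) k

theorem klein_eq_of_arcosh_lorentz_eq_zero {u v : ℝ × ℝ} (h : arcosh (lorentz u v) = 0) :
    klein u = klein v := by
  rw [arcosh_eq, Real.arcosh_eq_zero_iff (one_le_lorentz u v)] at h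
  have := norm_klein_sub_sq_le u v
  rw [h] at this
  have : ‖klein u - klein v‖ = 0 := by nlinarith [norm_nonneg (klein u - klein v)]
  exact sub_eq_zero.1 (norm_eq_zero.1 this)

theorem mem_segment_of_arcosh_lorentz_add {u w v : ℝ × ℝ}
    (h : arcosh (lorentz u w) + arcosh (lorentz w v) = arcosh (lorentz u v)) :
    klein w ∈ segment ℝ (klein u) (klein v) := by
  have ha := one_le_lorentz u w
  have hb := one_le_lorentz w v
  have hc := one_le_lorentz u v
  have hg := lorentz_gram u w v
  have k := congrArg Real.cosh h
  simp only [arcosh_eq] at k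
  rw [Real.cosh_add, Real.cosh_arcosh ha, Real.cosh_arcosh hb, Real.cosh_arcosh hc,
    Real.sinh_arcosh ha, Real.sinh_arcosh hb, ← Real.sqrt_mul (by nlinarith)] at k
  have k2 : (lorentz u w ^ 2 - 1) * (lorentz w v ^ 2 - 1) =
      (lorentz u v - lorentz u w * lorentz w v) ^ 2 := by
    rw [← k, add_sub_cancel_left, Real.sq_sqrt]
    exact mul_nonneg (by nlinarith) (by nlinarith)
  rw [k2, sub_self, eq_comm, sq_eq_zero_iff] at hg
  have hpos : Real.sqrt (1 + u.1 ^ 2 + u.2 ^ 2) * Real.sqrt (1 + w.1 ^ 2 + w.2 ^ 2) *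
        Real.sqrt (1 + v.1 ^ 2 + v.2 ^ 2) ≠ 0 := by positivity
  have hcol := collinear_of_cross_eq_zero ((mul_eq_zero.1 hg).resolve_left hpos)
  rcases hcol.wbtw_or_wbtw_or_wbtw with h1 | h1 | h1
  · exact mem_segment_iff_wbtw.2 h1
  · have := arcosh_lorentz_add_of_mem_segment (mem_segment_iff_wbtw.2 h1)
    rw [lorentz_comm w v, lorentz_comm v u, lorentz_comm w u] at this
    rw [lorentz_comm w v] at h
    have h0 : arcosh (lorentz v w) = 0 := by linarith
    rw [← klein_eq_of_arcosh_lorentz_eq_zero h0]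
    exact right_mem_segment ℝ _ _
  · have := arcosh_lorentz_add_of_mem_segment (mem_segment_iff_wbtw.2 h1)
    rw [lorentz_comm v u, lorentz_comm v w] at this
    have h0 : arcosh (lorentz u w) = 0 := by linarith
    rw [← klein_eq_of_arcosh_lorentz_eq_zero h0]
    exact left_mem_segment ℝ _ _

theorem sinh_le_two_mul {s : ℝ} (h0 : 0 ≤ s) (h1 : s ≤ 1) : Real.sinh s ≤ 2 * s := by
  have e1 := Real.abs_exp_sub_one_le (x := s) (by rwa [abs_of_nonneg h0])
  have e2 := Real.abs_exp_sub_one_le (x := -s) (by rwa [abs_neg, abs_of_nonneg h0])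
  rw [abs_of_nonneg h0] at e1
  rw [abs_neg, abs_of_nonneg h0] at e2
  rw [Real.sinh_eq]
  linarith [(abs_le.1 e1).2, (abs_le.1 e2).1]

theorem norm_klein_sub_le (u v : ℝ × ℝ) : ‖klein u - klein v‖ ≤ 2 * arcosh (lorentz u v) := by
  have hc := one_le_lorentz u v
  rcases le_total (arcosh (lorentz u v)) 1 with h | h
  · refine le_trans ?_ (sinh_le_two_mul (Real.arcosh_nonneg hc) h)
    rw [arcosh_eq, Real.sinh_arcosh hc]
    exact Real.le_sqrt_of_sq_le (norm_klein_sub_sq_le u v)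
  · have hu : klein u ∈ ball (0:ℂ) 1 := range_klein ▸ mem_range_self u
    have hv : klein v ∈ ball (0:ℂ) 1 := range_klein ▸ mem_range_self v
    rw [mem_ball_zero_iff] at hu hv
    have := norm_sub_le (klein u) (klein v)
    linarith

theorem isProjectiveChart_neg {κ : ℝ} (hκ : κ < 0) : IsProjectiveChart (mDist κ) klein := by
  have hk : 0 < 1 / Real.sqrt (-κ) := by
    have : 0 < -κ := by linarith
    positivity
  have hd : ∀ u v, mDist κ u v = 1 / Real.sqrt (-κ) * arcosh (lorentz u v) := by
    intro u v
    rw [mDist, if_neg hκ.ne]; rfl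
  generalize 1 / Real.sqrt (-κ) = c at *
  refine ⟨klein_openEmbedding, ?_, ?_, ?_, ?_, ?_, ?_, ?_⟩
  · rw [range_klein]; exact convex_ball _ _
  · simp only [hd]
    refine continuous_const.mul ?_
    have hl : Continuous fun q : (ℝ × ℝ) × (ℝ × ℝ) => lorentz q.1 q.2 := by
      unfold lorentz; fun_prop
    exact Real.continuousOn_arcosh.comp_continuous hl fun q => one_le_lorentz _ _
  · intro u v; rw [hd]; exact mul_nonneg hk.le (Real.arcosh_nonneg (one_le_lorentz u v))
  · intro u; rw [hd, lorentz_self, arcosh_eq, Real.arcosh_zero, mul_zero]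
  · intro u v; rw [hd, hd, lorentz_comm]
  · refine ⟨2 / c, by positivity, fun u v => ?_⟩
    rw [hd, ← mul_assoc, div_mul_cancel₀ _ hk.ne']
    exact norm_klein_sub_le u v
  · intro u w v
    rw [hd, hd, hd, ← mul_add, mul_right_inj' hk.ne']
    exact ⟨mem_segment_of_arcosh_lorentz_add, arcosh_lorentz_add_of_mem_segment⟩

theorem exists_isProjectiveChart {κ : ℝ} (hκ : κ ≤ 0) : ∃ k, IsProjectiveChart (mDist κ) k := by
  rcases hκ.lt_or_eq with h | rfl
  · exact ⟨_, isProjectiveChart_neg h⟩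
  · exact ⟨_, isProjectiveChart_zero⟩

end Cat2Cx

namespace Cat2Cx

namespace IsProjectiveChart
variable {d : ℝ × ℝ → ℝ × ℝ → ℝ} {k : ℝ × ℝ → ℂ}

theorem eq_of_dist_eq_zero (hk : IsProjectiveChart d k) {u v : ℝ × ℝ} (h : d u v = 0) : u = v := by
  obtain ⟨C, -, hC⟩ := hk.lipschitz
  have := hC u v
  rw [h, mul_zero] at this
  exact hk.openEmbedding.injective (sub_eq_zero.1 (norm_le_zero_iff.1 this))

theorem tendsto_dist (hk : IsProjectiveChart d k) (u : ℝ × ℝ) :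
    Tendsto (fun v => d v u) (nhds u) (nhds 0) := by
  have : Continuous fun v => d v u :=
    hk.continuous_dist.comp (continuous_id.prodMk continuous_const)
  simpa only [hk.dist_self] using this.tendsto u

theorem exists_geodesic_through (hk : IsProjectiveChart d k) {x y w : ℝ × ℝ}
    (hw : k w ∈ segment ℝ (k x) (k y)) : w ∈ geodSeg d univ x y := by
  have hadd : ∀ v, k v ∈ segment ℝ (k x) (k y) → d x v + d v y = d x y :=
    fun v hv => (hk.add_iff x v y).2 hv
  have hex : ∀ t ∈ Icc 0 (d x y), ∃ v, k v ∈ segment ℝ (k x) (k y) ∧ d x v = t := by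
    intro t ht
    let kinv := hk.openEmbedding.toOpenPartialHomeomorph k |>.symm
    have hsub : segment ℝ (k x) (k y) ⊆ range k :=
      hk.convex_range.segment_subset (mem_range_self x) (mem_range_self y)
    have hl : ∀ v, kinv (k v) = v := fun v =>
      (hk.openEmbedding.toOpenPartialHomeomorph k).left_inv (mem_univ v)
    have hc : ContinuousOn (fun z => d x (kinv z)) (segment ℝ (k x) (k y)) := by
      have h1 : ContinuousOn kinv (segment ℝ (k x) (k y)) := by
        refine (hk.openEmbedding.toOpenPartialHomeomorph k).continuousOn_symm.mono ?_
        rw [← OpenPartialHomeomorph.image_source_eq_target]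
        simpa using hsub
      exact hk.continuous_dist.comp_continuousOn (continuousOn_const.prodMk h1)
    have hpre : IsPreconnected (segment ℝ (k x) (k y)) := (convex_segment _ _).isPreconnected
    have := hpre.intermediate_value (left_mem_segment ℝ _ _) (right_mem_segment ℝ _ _) hc
    simp only [hl, hk.dist_self] at this
    obtain ⟨z, hz, hzt⟩ := this ht
    obtain ⟨v, rfl⟩ := hsub hz
    exact ⟨v, hz, by simpa only [hl] using hzt⟩
  have hcomp : ∀ v v', k v ∈ segment ℝ (k x) (k y) → k v' ∈ segment ℝ (k x) (k y) →
      d v v' = |d x v - d x v'| := by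
    have key : ∀ v v', k v ∈ segment ℝ (k x) (k v') → d v v' = |d x v - d x v'| := by
      intro v v' h
      have h1 := (hk.add_iff x v v').2 h
      have h2 := hk.dist_nonneg v v'
      rw [abs_of_nonpos (by linarith)]; linarith
    intro v v' hv hv'
    rw [mem_segment_iff_wbtw] at hv hv'
    have hor : Wbtw ℝ (k x) (k v) (k v') ∨ Wbtw ℝ (k x) (k v') (k v) := by
      obtain ⟨s, hs, es⟩ := hv
      obtain ⟨t, ht, et⟩ := hv'
      rw [AffineMap.lineMap_apply, vsub_eq_sub] at es et
      have := wbtw_or_wbtw_smul_vadd_of_nonneg (k x) (k y - k x) hs.1 ht.1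
      rwa [es, et] at this
    rcases hor with h | h
    · exact key v v' (mem_segment_iff_wbtw.2 h)
    · rw [hk.dist_comm, abs_sub_comm]
      exact key v' v (mem_segment_iff_wbtw.2 h)
  classical
  choose! φ hφ using hex
  have hdw : d x w ∈ Icc 0 (d x y) :=
    ⟨hk.dist_nonneg _ _, by have := hadd w hw; have := hk.dist_nonneg w y; linarith⟩
  have huniq : ∀ v, k v ∈ segment ℝ (k x) (k y) → φ (d x v) = v := by
    intro v hv
    have hdv : d x v ∈ Icc 0 (d x y) :=
      ⟨hk.dist_nonneg _ _, by have := hadd v hv; have := hk.dist_nonneg v y; linarith⟩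
    refine hk.eq_of_dist_eq_zero ?_
    rw [hcomp _ _ (hφ _ hdv).1 hv, (hφ _ hdv).2, sub_self, abs_zero]
  refine mem_iUnion₂.2 ⟨φ, ⟨?_, ?_, ⟨hk.dist_nonneg _ _, ?_⟩, fun _ _ => mem_univ _⟩, d x w, hdw,
    huniq w hw⟩
  · have := huniq x (left_mem_segment ℝ _ _)
    rwa [hk.dist_self] at this
  · exact huniq y (right_mem_segment ℝ _ _)
  · intro s hs t ht
    rw [hcomp _ _ (hφ s hs).1 (hφ t ht).1, (hφ s hs).2, (hφ t ht).2]

theorem convexWrt_iff (hk : IsProjectiveChart d k) (C : Set (ℝ × ℝ)) :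
    ConvexWrt d C ↔ Convex ℝ (k '' C) := by
  constructor
  · intro hC
    rw [convex_iff_segment_subset]
    rintro _ ⟨x, hx, rfl⟩ _ ⟨y, hy, rfl⟩ z hz
    obtain ⟨w, rfl⟩ := hk.convex_range.segment_subset (mem_range_self x) (mem_range_self y) hz
    exact ⟨w, hC x hx y hy (hk.exists_geodesic_through hz), rfl⟩
  · intro hC x hx y hy w hw
    obtain ⟨f, ⟨f0, f1, ⟨h0, hf⟩, -⟩, t, ht, rfl⟩ := mem_iUnion₂.1 hw
    have e1 := hf 0 ⟨le_rfl, h0⟩ t ht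
    have e2 := hf t ht _ ⟨h0, le_rfl⟩
    rw [f0, zero_sub, abs_neg, abs_of_nonneg ht.1] at e1
    rw [f1, abs_of_nonpos (by linarith [ht.2])] at e2
    have := (hk.add_iff x (f t) y).1 (by linarith)
    obtain ⟨v, hv, hv'⟩ := hC.segment_subset (mem_image_of_mem k hx) (mem_image_of_mem k hy) this
    rwa [← hk.openEmbedding.injective hv']

theorem image_convexHullWrt (hk : IsProjectiveChart d k) (A : Set (ℝ × ℝ)) :
    k '' convexHullWrt d A = convexHull ℝ (k '' A) := by
  apply Subset.antisymm
  · rintro _ ⟨w, hw, rfl⟩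
    have hsub : convexHull ℝ (k '' A) ⊆ range k :=
      convexHull_min (image_subset_range _ _) hk.convex_range
    refine hw (k ⁻¹' convexHull ℝ (k '' A)) ⟨?_, ?_⟩
    · rw [hk.convexWrt_iff, image_preimage_eq_of_subset hsub]
      exact convex_convexHull _ _
    · intro a ha
      exact subset_convexHull _ _ (mem_image_of_mem k ha)
  · refine convexHull_min (image_mono fun a ha C hC => hC.2 ha) ?_
    rw [← hk.convexWrt_iff]
    intro x hx y hy w hw C hC
    exact hC.1 x (hx C hC) y (hy C hC) hw

end IsProjectiveChart

/-! ### Projective charts of faces -/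

/-- A chart of the closed face `closure F` onto a compact convex set of the plane, mapping
geodesics to straight segments. -/
structure FaceChart {X : Type*} [MetricSpace X] (F : Set X) where
  toFun : X → ℂ
  inv : ℂ → X
  K : Set ℂ
  map_mem : ∀ x ∈ closure F, toFun x ∈ K
  inv_mem : ∀ z ∈ K, inv z ∈ closure F
  left_inv : ∀ x ∈ closure F, inv (toFun x) = x
  right_inv : ∀ z ∈ K, toFun (inv z) = z
  isCompact : IsCompact K
  convex : Convex ℝ K
  mem_interior_iff : ∀ x ∈ closure F, toFun x ∈ interior K ↔ x ∈ F
  nonempty : F.Nonempty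
  lipschitz : ∃ C, LipschitzOnWith C toFun (closure F)
  continuousOn_inv : ContinuousOn inv K
  mem_segment_iff : ∀ x ∈ closure F, ∀ y ∈ closure F, ∀ z ∈ closure F,
    toFun z ∈ segment ℝ (toFun x) (toFun y) ↔ Btw x z y

theorem PolyComplex2.exists_faceChart {κ : ℝ} (hκ : κ ≤ 0) {X : Type*} [MetricSpace X]
    (PC : PolyComplex2 κ X) {F : Set X} (hF : F ∈ PC.faces) : Nonempty (FaceChart F) := by
  obtain ⟨k, hk⟩ := exists_isProjectiveChart hκ
  obtain ⟨f, P, ⟨A, hPA, hPne⟩, hinj, him, himF, hdist⟩ := PC.face_chart F hF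
  have hK : k '' P = convexHull ℝ (k '' (A : Set (ℝ × ℝ))) := by
    rw [hPA, hk.image_convexHullWrt]
  have hFne : F.Nonempty := by
    rw [← himF] at hPne
    exact hPne.of_image
  have hfK : ∀ x ∈ closure F, k (f x) ∈ k '' P := fun x hx =>
    mem_image_of_mem k (him ▸ mem_image_of_mem f hx)
  obtain ⟨ki, hkic, hel⟩ : ∃ ki : ℂ → ℝ × ℝ, ContinuousOn ki (k '' P) ∧ ∀ v, ki (k v) = v := by
    refine ⟨(hk.openEmbedding.toOpenPartialHomeomorph k).symm, ?_, fun v =>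
      (hk.openEmbedding.toOpenPartialHomeomorph k).left_inv (mem_univ v)⟩
    refine (hk.openEmbedding.toOpenPartialHomeomorph k).continuousOn_symm.mono ?_
    rw [← OpenPartialHomeomorph.image_source_eq_target]
    exact image_mono (subset_univ _)
  obtain ⟨fi, hfi⟩ : ∃ fi : ℝ × ℝ → X, ∀ u ∈ P, fi u ∈ closure F ∧ f (fi u) = u := by
    have : ∀ u ∈ P, ∃ x, x ∈ closure F ∧ f x = u := fun u hu => by rwa [← him] at hu
    have hX : Nonempty X := ⟨hFne.some⟩
    choose! fi hfi using this
    exact ⟨fi, hfi⟩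
  have hfiK : ∀ z ∈ k '' P, fi (ki z) ∈ closure F := by
    rintro _ ⟨u, hu, rfl⟩
    rw [hel]; exact (hfi u hu).1
  have hleft : ∀ x ∈ closure F, fi (ki (k (f x))) = x := by
    intro x hx
    rw [hel]
    have hu : f x ∈ P := him ▸ mem_image_of_mem f hx
    exact hinj (hfi _ hu).1 hx (hfi _ hu).2
  have hright : ∀ z ∈ k '' P, k (f (fi (ki z))) = z := by
    rintro _ ⟨u, hu, rfl⟩
    rw [hel, (hfi u hu).2]
  have hinterior : ∀ x ∈ closure F, k (f x) ∈ interior (k '' P) ↔ x ∈ F := by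
    intro x hx
    have h1 : f x ∈ interior P ↔ x ∈ F := by
      rw [← himF]
      constructor
      · rintro ⟨y, hy, hxy⟩
        rwa [← hinj (subset_closure hy) hx hxy]
      · exact fun h => mem_image_of_mem f h
    rw [← h1]
    have h2 := hk.openEmbedding.isOpenMap.preimage_interior_eq_interior_preimage
      hk.openEmbedding.continuous (k '' P)
    rw [preimage_image_eq _ hk.openEmbedding.injective] at h2
    rw [← h2]; exact Iff.rfl
  have hlip : ∃ C, LipschitzOnWith C (fun x => k (f x)) (closure F) := by
    obtain ⟨C, hC0, hC⟩ := hk.lipschitz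
    refine ⟨Real.toNNReal C, LipschitzOnWith.of_dist_le_mul fun x hx y hy => ?_⟩
    rw [Real.coe_toNNReal _ hC0.le, dist_eq_norm, ← hdist x hx y hy]
    exact hC _ _
  have hcont : ContinuousOn (fun z => fi (ki z)) (k '' P) := by
    have h2 : ContinuousOn fi P := by
      intro u hu
      rw [ContinuousWithinAt, tendsto_iff_dist_tendsto_zero]
      refine ((hk.tendsto_dist u).mono_left nhdsWithin_le_nhds).congr' ?_
      filter_upwards [self_mem_nhdsWithin] with v hv
      rw [← hdist _ (hfi v hv).1 _ (hfi u hu).1, (hfi v hv).2, (hfi u hu).2]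
    refine h2.comp hkic ?_
    rintro _ ⟨u, hu, rfl⟩
    rwa [hel]
  have hseg : ∀ x ∈ closure F, ∀ y ∈ closure F, ∀ z ∈ closure F,
      k (f z) ∈ segment ℝ (k (f x)) (k (f y)) ↔ Btw x z y := by
    intro x hx y hy z hz
    rw [← hk.add_iff, hdist x hx z hz, hdist z hz y hy, hdist x hx y hy, Btw]
  have hcpt : IsCompact (k '' P) := by
    rw [hK]; exact (A.finite_toSet.image k).isCompact_convexHull ℝ
  have hconv : Convex ℝ (k '' P) := by
    rw [hK]; exact convex_convexHull _ _
  exact ⟨⟨fun x => k (f x), fun z => fi (ki z), k '' P, hfK, hfiK, hleft, hright, hcpt, hconv,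
    hinterior, hFne, hlip, hcont, hseg⟩⟩

namespace FaceChart
variable {X : Type*} [MetricSpace X] {F : Set X}

theorem injOn (c : FaceChart F) : InjOn c.toFun (closure F) := fun x hx y hy h => by
  rw [← c.left_inv x hx, h, c.left_inv y hy]

theorem continuousOn (c : FaceChart F) : ContinuousOn c.toFun (closure F) :=
  c.lipschitz.choose_spec.continuousOn

theorem map_mem_interior (c : FaceChart F) {x : X} (hx : x ∈ F) : c.toFun x ∈ interior c.K :=
  (c.mem_interior_iff x (subset_closure hx)).2 hx

theorem inv_mem_face (c : FaceChart F) {z : ℂ} (hz : z ∈ interior c.K) : c.inv z ∈ F := by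
  have h := interior_subset hz
  rw [← c.mem_interior_iff _ (c.inv_mem z h), c.right_inv z h]
  exact hz

variable [CNSpace X]

theorem mem_closure_of_btw (c : FaceChart F) {x y z : X} (hx : x ∈ closure F) (hy : y ∈ closure F)
    (h : Btw x z y) : z ∈ closure F := by
  have hsub : segment ℝ (c.toFun x) (c.toFun y) ⊆ c.K :=
    c.convex.segment_subset (c.map_mem x hx) (c.map_mem y hy)
  have hc : ContinuousOn (fun ζ => dist x (c.inv ζ)) (segment ℝ (c.toFun x) (c.toFun y)) :=
    (continuous_const.dist continuous_id).comp_continuousOn (c.continuousOn_inv.mono hsub)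
  have hpre : IsPreconnected (segment ℝ (c.toFun x) (c.toFun y)) :=
    (convex_segment _ _).isPreconnected
  have := hpre.intermediate_value (left_mem_segment ℝ _ _) (right_mem_segment ℝ _ _) hc
  simp only [c.left_inv x hx, c.left_inv y hy, dist_self] at this
  obtain ⟨ζ, hζ, hζd⟩ := this ⟨dist_nonneg, h.dist_left_le⟩
  have hm := c.inv_mem ζ (hsub hζ)
  have hb : Btw x (c.inv ζ) y := by
    rw [← c.mem_segment_iff x hx y hy _ hm, c.right_inv ζ (hsub hζ)]
    exact hζ
  rwa [h.eq_of_dist_eq hb hζd.symm]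

theorem mem_segment_of_btw (c : FaceChart F) {x y z : X} (hx : x ∈ closure F) (hy : y ∈ closure F)
    (h : Btw x z y) : c.toFun z ∈ segment ℝ (c.toFun x) (c.toFun y) :=
  (c.mem_segment_iff x hx y hy z (c.mem_closure_of_btw hx hy h)).2 h

theorem mem_face_of_btw (c : FaceChart F) {x y z : X} (hx : x ∈ F) (hy : y ∈ closure F)
    (h : Btw x z y) (hne : z ≠ y) : z ∈ F := by
  have hz := c.mem_closure_of_btw (subset_closure hx) hy h
  obtain ⟨a, b, ha, hb, hab, e⟩ := c.mem_segment_of_btw (subset_closure hx) hy h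
  rw [← c.mem_interior_iff z hz, ← e]
  rcases ha.eq_or_lt with rfl | ha'
  · exfalso
    apply hne
    have hb1 : b = 1 := by linarith
    rw [hb1, zero_smul, zero_add, one_smul] at e
    exact (c.injOn hy hz e).symm
  · exact c.convex.combo_interior_self_mem_interior (c.map_mem_interior hx) (c.map_mem y hy)
      ha' hb hab

end FaceChart
end Cat2Cx

namespace Cat2Cx

/-! ### Loops and winding numbers -/

/-- A loop parametrized by the unit interval, extended by constants to the real line. -/
structure IsLoop {T : Type*} [TopologicalSpace T] (γ : ℝ → T) : Prop where
  continuous : Continuous γ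
  eq_of_nonpos : ∀ t ≤ 0, γ t = γ 0
  eq_of_one_le : ∀ t, 1 ≤ t → γ t = γ 0

theorem IsLoop.comp {T U : Type*} [TopologicalSpace T] [TopologicalSpace U] {γ : ℝ → T}
    (hγ : IsLoop γ) {f : T → U} (hf : Continuous f) : IsLoop fun t => f (γ t) :=
  ⟨hf.comp hγ.continuous, fun t ht => by rw [hγ.eq_of_nonpos t ht],
    fun t ht => by rw [hγ.eq_of_one_le t ht]⟩

theorem IsLoop.range_eq {T : Type*} [TopologicalSpace T] {γ : ℝ → T} (hγ : IsLoop γ) :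
    range γ = γ '' Icc 0 1 := by
  refine Subset.antisymm ?_ (image_subset_range _ _)
  rintro _ ⟨t, rfl⟩
  rcases le_total t 0 with h | h
  · exact ⟨0, ⟨le_rfl, zero_le_one⟩, (hγ.eq_of_nonpos t h).symm⟩
  · rcases le_total 1 t with h' | h'
    · exact ⟨0, ⟨le_rfl, zero_le_one⟩, (hγ.eq_of_one_le t h').symm⟩
    · exact ⟨t, ⟨h, h'⟩, rfl⟩

theorem IsLoop.isCompact_range {T : Type*} [TopologicalSpace T] {γ : ℝ → T} (hγ : IsLoop γ) :
    IsCompact (range γ) := by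
  rw [hγ.range_eq]
  exact isCompact_Icc.image hγ.continuous

theorem sub_eq_sub_of_exp_eq {T : Type*} [TopologicalSpace T] {S : Set T} (hS : IsPreconnected S)
    {l l' : T → ℂ} (hl : ContinuousOn l S) (hl' : ContinuousOn l' S)
    (h : ∀ t ∈ S, Complex.exp (l t) = Complex.exp (l' t)) {a b : T} (ha : a ∈ S) (hb : b ∈ S) :
    l b - l a = l' b - l' a := by
  have := Complex.isCoveringMap_exp.eqOn_of_comp_eqOn hS hl
    (hl'.add (continuousOn_const (c := l a - l' a))) (fun t ht => Subtype.ext ?_) ha (by simp)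
  · have h2 := this hb
    rw [h2, Pi.add_apply]
    ring
  · simp only [Function.comp_apply, Pi.add_apply, Complex.exp_add, Complex.exp_sub, h t ht, h a ha]
    rw [div_self (Complex.exp_ne_zero _), mul_one]

theorem exists_continuous_log {T : Type*} [TopologicalSpace T] [SimplyConnectedSpace T]
    [LocallyPathConnectedSpace T] {c : T → ℂ} (hc : Continuous c) (h0 : ∀ t, c t ≠ 0) :
    ∃ l : T → ℂ, Continuous l ∧ ∀ t, Complex.exp (l t) = c t := by
  have : Nonempty T := inferInstance
  obtain ⟨F, ⟨-, hF⟩, -⟩ := Complex.isCoveringMapOn_exp.existsUnique_continuousMap_lifts ⟨c, hc⟩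
    (a₀ := Classical.arbitrary T) (e₀ := Complex.log (c (Classical.arbitrary T)))
    (Complex.exp_log (h0 _)) (fun t => h0 t)
  exact ⟨F, F.continuous, fun t => congrFun hF t⟩

open Classical in
/-- The total variation of the logarithm along the curve `c : [0,1] → ℂ \ {0}`. -/
noncomputable def wind (c : ℝ → ℂ) : ℂ :=
  if h : ∃ l : ℝ → ℂ, ContinuousOn l (Icc 0 1) ∧ ∀ t ∈ Icc (0 : ℝ) 1, Complex.exp (l t) = c t
  then h.choose 1 - h.choose 0 else 0

theorem wind_eq {c l : ℝ → ℂ} (hl : ContinuousOn l (Icc 0 1))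
    (h : ∀ t ∈ Icc (0 : ℝ) 1, Complex.exp (l t) = c t) : wind c = l 1 - l 0 := by
  have hex : ∃ l : ℝ → ℂ, ContinuousOn l (Icc 0 1) ∧
    ∀ t ∈ Icc (0 : ℝ) 1, Complex.exp (l t) = c t := ⟨l, hl, h⟩
  rw [wind, dif_pos hex]
  exact sub_eq_sub_of_exp_eq isPreconnected_Icc hex.choose_spec.1 hl
    (fun t ht => (hex.choose_spec.2 t ht).trans (h t ht).symm) ⟨le_rfl, zero_le_one⟩
    ⟨zero_le_one, le_rfl⟩

theorem wind_mul {c c' : ℝ → ℂ} (hc : Continuous c) (h0 : ∀ t, c t ≠ 0) (hc' : Continuous c')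
    (h0' : ∀ t, c' t ≠ 0) : wind (fun t => c t * c' t) = wind c + wind c' := by
  obtain ⟨l, hl, hl'⟩ := exists_continuous_log hc h0
  obtain ⟨m, hm, hm'⟩ := exists_continuous_log hc' h0'
  rw [wind_eq hl.continuousOn fun t _ => hl' t, wind_eq hm.continuousOn fun t _ => hm' t,
    wind_eq (l := fun t => l t + m t) (hl.add hm).continuousOn
      fun t _ => by rw [Complex.exp_add, hl', hm']]
  ring

theorem wind_const {a : ℂ} (ha : a ≠ 0) : wind (fun _ => a) = 0 := by
  rw [wind_eq (l := fun _ => Complex.log a) continuousOn_const fun t _ => Complex.exp_log ha,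
    sub_self]

theorem wind_prod {ι : Type*} (s : Finset ι) {c : ι → ℝ → ℂ} (hc : ∀ i ∈ s, Continuous (c i))
    (h0 : ∀ i ∈ s, ∀ t, c i t ≠ 0) :
    wind (fun t => ∏ i ∈ s, c i t) = ∑ i ∈ s, wind (c i) := by
  classical
  induction s using Finset.induction_on with
  | empty => simpa using wind_const one_ne_zero
  | insert a s ha ih =>
    simp only [Finset.prod_insert ha, Finset.sum_insert ha]
    rw [wind_mul (hc a (Finset.mem_insert_self _ _)) (h0 a (Finset.mem_insert_self _ _)), ih]
    · exact fun i hi => hc i (Finset.mem_insert_of_mem hi)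
    · exact fun i hi => h0 i (Finset.mem_insert_of_mem hi)
    · exact continuous_finsetProd _ fun i hi => hc i (Finset.mem_insert_of_mem hi)
    · exact fun t => Finset.prod_ne_zero_iff.2 fun i hi => h0 i (Finset.mem_insert_of_mem hi) t

theorem wind_conj {c : ℝ → ℂ} (hc : Continuous c) (h0 : ∀ t, c t ≠ 0) :
    wind (fun t => (starRingEnd ℂ) (c t)) = (starRingEnd ℂ) (wind c) := by
  obtain ⟨l, hl, hl'⟩ := exists_continuous_log hc h0
  rw [wind_eq hl.continuousOn fun t _ => hl' t,
    wind_eq (l := fun t => (starRingEnd ℂ) (l t)) (Complex.continuous_conj.comp hl).continuousOn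
      fun t _ => by rw [Complex.exp_conj, hl'], map_sub]

theorem conj_wind {c : ℝ → ℂ} (hc : IsLoop c) (h0 : ∀ t, c t ≠ 0) :
    (starRingEnd ℂ) (wind c) = -wind c := by
  obtain ⟨l, hl, hl'⟩ := exists_continuous_log hc.continuous h0
  rw [wind_eq hl.continuousOn fun t _ => hl' t]
  have : Complex.exp (l 1 - l 0) = 1 := by
    rw [Complex.exp_sub, hl', hl', hc.eq_of_one_le 1 le_rfl, div_self (h0 0)]
  obtain ⟨n, hn⟩ := Complex.exp_eq_one_iff.1 this
  rw [hn]
  simp [Complex.conj_ofNat]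

theorem wind_eq_zero_of_slitPlane {c : ℝ → ℂ} (hc : IsLoop c) (h : ∀ t, c t ∈ Complex.slitPlane) :
    wind c = 0 := by
  rw [wind_eq (l := fun t => Complex.log (c t))
    (hc.continuous.clog h).continuousOn
    fun t _ => Complex.exp_log (Complex.slitPlane_ne_zero (h t)), hc.eq_of_one_le 1 le_rfl, sub_self]

theorem wind_congr {c c' : ℝ → ℂ} (h : ∀ t ∈ Icc (0 : ℝ) 1, c t = c' t) : wind c = wind c' := by
  have : (∃ l : ℝ → ℂ, ContinuousOn l (Icc 0 1) ∧ ∀ t ∈ Icc (0 : ℝ) 1, Complex.exp (l t) = c t) →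
      wind c = wind c' := by
    rintro ⟨l, hl, hl'⟩
    rw [wind_eq hl hl', wind_eq hl fun t ht => (hl' t ht).trans (h t ht)]
  by_cases hex : ∃ l : ℝ → ℂ, ContinuousOn l (Icc 0 1) ∧
      ∀ t ∈ Icc (0 : ℝ) 1, Complex.exp (l t) = c t
  · exact this hex
  · rw [wind, dif_neg hex, wind, dif_neg]
    rintro ⟨l, hl, hl'⟩
    exact hex ⟨l, hl, fun t ht => (hl' t ht).trans (h t ht).symm⟩

theorem wind_homotopy {H : ℝ × ℝ → ℂ} (hH : Continuous H) (h0 : ∀ q, H q ≠ 0)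
    (hloop : ∀ s, H (s, 0) = H (s, 1)) (s s' : ℝ) :
    wind (fun t => H (s, t)) = wind (fun t => H (s', t)) := by
  obtain ⟨l, hl, hl'⟩ := exists_continuous_log hH h0
  have e : ∀ s, wind (fun t => H (s, t)) = l (s, 1) - l (s, 0) := fun s =>
    wind_eq (l := fun t => l (s, t)) (hl.comp (by fun_prop)).continuousOn fun t _ => hl' _
  have := sub_eq_sub_of_exp_eq (l := fun s => l (s, 1)) (l' := fun s => l (s, 0))
    isPreconnected_univ (hl.comp (by fun_prop)).continuousOn (hl.comp (by fun_prop)).continuousOn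
    (fun s _ => by rw [hl', hl', hloop]) (mem_univ s) (mem_univ s')
  rw [e, e]
  linear_combination -this

/-- A nowhere vanishing function on a uniquely geodesic space of nonpositive curvature has
winding number zero along every loop. -/
theorem wind_comp_eq_zero_of_cone {X : Type*} [MetricSpace X] [CNSpace X] {h : X → ℂ}
    (hh : Continuous h) {γ : ℝ → X} (hγ : IsLoop γ)
    (h0 : ∀ t, ∀ s ∈ Icc (0 : ℝ) 1, h (gp (γ 0) (γ t) s) ≠ 0) : wind (fun t => h (γ t)) = 0 := by
  have hcl : Continuous fun s : ℝ => max 0 (min 1 s) := by fun_prop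
  have hmem : ∀ s : ℝ, max 0 (min 1 s) ∈ Icc (0 : ℝ) 1 := fun s =>
    ⟨le_max_left _ _, max_le zero_le_one (min_le_left _ _)⟩
  have key := wind_homotopy (H := fun q : ℝ × ℝ => h (gp (γ 0) (γ q.2) (max 0 (min 1 q.1))))
    ?_ (fun q => h0 _ _ (hmem _)) (fun s => by simp only [hγ.eq_of_one_le 1 le_rfl]) 1 0
  · simp only [min_self, max_eq_right zero_le_one, gp_one, min_eq_right zero_le_one,
      max_self, gp_zero] at key
    rw [key, wind_const (by simpa using h0 0 0 ⟨le_rfl, zero_le_one⟩)]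
  · refine hh.comp ?_
    refine (continuousOn_gp_right (γ 0)).comp_continuous
      (f := fun q : ℝ × ℝ => (γ q.2, max 0 (min 1 q.1)))
      ((hγ.continuous.comp continuous_snd).prodMk (hcl.comp continuous_fst)) ?_
    exact fun q => ⟨mem_univ _, hmem _⟩

theorem wind_comp_eq_zero {X : Type*} [MetricSpace X] [CNSpace X] {h : X → ℂ} (hh : Continuous h)
    (h0 : ∀ x, h x ≠ 0) {γ : ℝ → X} (hγ : IsLoop γ) : wind (fun t => h (γ t)) = 0 :=
  wind_comp_eq_zero_of_cone hh hγ fun _ _ _ => h0 _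

theorem wind_eq_of_div_mem_slitPlane {c c' : ℝ → ℂ} (hc : IsLoop c) (h0 : ∀ t, c t ≠ 0)
    (hc' : IsLoop c') (h : ∀ t, c' t / c t ∈ Complex.slitPlane) : wind c' = wind c := by
  have hq : IsLoop fun t => c' t / c t :=
    ⟨hc'.continuous.div hc.continuous h0, fun t ht => by
      rw [hc'.eq_of_nonpos t ht, hc.eq_of_nonpos t ht], fun t ht => by
      rw [hc'.eq_of_one_le t ht, hc.eq_of_one_le t ht]⟩
  have h1 := wind_mul hq.continuous (fun t => Complex.slitPlane_ne_zero (h t)) hc.continuous h0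
  rw [wind_eq_zero_of_slitPlane hq h, zero_add] at h1
  rw [← h1]
  exact wind_congr fun t _ => (div_mul_cancel₀ _ (h0 t)).symm

/-- If a closed curve crosses `0` exactly once, from left to right, then its winding numbers
around nearby points above and below differ. -/
theorem exists_wind_ne_of_crossing {z : ℝ → ℂ} (hz : IsLoop z) {t₀ η : ℝ} (ht₀ : t₀ ∈ Ioo (0 : ℝ) 1)
    (hη : 0 < η) (hz0 : ∀ t, z t = 0 ↔ t = t₀) (hl : ∀ t ∈ Ioo (t₀ - η) t₀, (z t).re < 0)
    (hr : ∀ t ∈ Ioo t₀ (t₀ + η), 0 < (z t).re) :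
    ∃ ε₀ > (0 : ℝ), ∀ ε : ℝ, 0 < ε → ε < ε₀ →
      (∀ t, z t - Complex.I * ε ≠ 0) ∧ (∀ t, z t + Complex.I * ε ≠ 0) ∧
      wind (fun t => z t - Complex.I * ε) ≠ wind (fun t => z t + Complex.I * ε) := by
  wlog hsmall : η ≤ t₀ ∧ η ≤ 1 - t₀ generalizing η
  · refine this (η := min η (min t₀ (1 - t₀))) (lt_min hη (lt_min ht₀.1 (by linarith [ht₀.2])))
      (fun t ht => hl t ⟨?_, ht.2⟩) (fun t ht => hr t ⟨ht.1, ?_⟩) ⟨?_, ?_⟩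
    · linarith [ht.1, min_le_left η (min t₀ (1 - t₀))]
    · linarith [ht.2, min_le_left η (min t₀ (1 - t₀))]
    · exact (min_le_right _ _).trans (min_le_left _ _)
    · exact (min_le_right _ _).trans (min_le_right _ _)
  have hW : IsCompact (Icc (0 : ℝ) 1 \ Ioo (t₀ - η) (t₀ + η)) := isCompact_Icc.diff isOpen_Ioo
  have h0W : (0 : ℝ) ∈ Icc (0 : ℝ) 1 \ Ioo (t₀ - η) (t₀ + η) :=
    ⟨⟨le_rfl, zero_le_one⟩, fun h => by linarith [h.1, hsmall.1]⟩
  obtain ⟨s, hs, hmin⟩ := hW.exists_isMinOn ⟨0, h0W⟩ (f := fun t => ‖z t‖)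
    hz.continuous.norm.continuousOn
  have hpos : 0 < ‖z s‖ := by
    rw [norm_pos_iff, Ne, hz0]
    rintro rfl
    exact hs.2 ⟨by linarith, by linarith⟩
  refine ⟨‖z s‖, hpos, fun ε hε hεs => ?_⟩
  have hout : ∀ t, t ∉ Ioo (t₀ - η) (t₀ + η) → ε < ‖z t‖ := by
    intro t ht
    by_cases h01 : t ∈ Icc (0 : ℝ) 1
    · exact hεs.trans_le (hmin ⟨h01, ht⟩)
    · have : z t = z 0 := by
        rcases le_or_gt t 0 with h | h
        · exact hz.eq_of_nonpos t h
        · exact hz.eq_of_one_le t (by by_contra h'; exact h01 ⟨h.le, by linarith⟩)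
      rw [this]
      exact hεs.trans_le (hmin h0W)
  have hcase : ∀ t, ε < ‖z t‖ ∨ t = t₀ ∨ (t < t₀ ∧ (z t).re < 0) ∨ (t₀ < t ∧ 0 < (z t).re) := by
    intro t
    by_cases h : t ∈ Ioo (t₀ - η) (t₀ + η)
    · rcases lt_trichotomy t t₀ with h1 | h1 | h1
      · exact Or.inr (Or.inr (Or.inl ⟨h1, hl t ⟨h.1, h1⟩⟩))
      · exact Or.inr (Or.inl h1)
      · exact Or.inr (Or.inr (Or.inr ⟨h1, hr t ⟨h1, h.2⟩⟩))
    · exact Or.inl (hout t h)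
  have hnorm : ∀ a : ℂ, a = Complex.I * ε ∨ a = -(Complex.I * ε) → a.re = 0 ∧ ‖a‖ = ε ∧ a ≠ 0 := by
    rintro a (rfl | rfl) <;> simp [hε.ne', abs_of_pos hε]
  have hne : ∀ a : ℂ, a = Complex.I * ε ∨ a = -(Complex.I * ε) → ∀ t, z t ≠ a := by
    intro a ha t h
    obtain ⟨h1, h2, h3⟩ := hnorm a ha
    rcases hcase t with h' | h' | h' | h'
    · rw [h, h2] at h'; exact lt_irrefl _ h'
    · rw [(hz0 t).2 h'] at h; exact h3 h.symm
    · rw [h, h1] at h'; exact lt_irrefl _ h'.2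
    · rw [h, h1] at h'; exact lt_irrefl _ h'.2
  have hm : ∀ t, z t - Complex.I * ε ≠ 0 := fun t => sub_ne_zero.2 (hne _ (Or.inl rfl) t)
  have hp : ∀ t, z t + Complex.I * ε ≠ 0 := fun t h =>
    hne _ (Or.inr rfl) t (eq_neg_of_add_eq_zero_left h)
  refine ⟨hm, hp, ?_⟩
  have hzp : IsLoop fun t => z t + Complex.I * ε := hz.comp (f := fun w => w + Complex.I * ε)
    (by fun_prop)
  set Q : ℝ → ℂ := fun t => (z t - Complex.I * ε) * (starRingEnd ℂ) (z t + Complex.I * ε) with hQ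
  have hQre : ∀ t, (Q t).re = ‖z t‖ ^ 2 - ε ^ 2 := by
    intro t
    rw [← Complex.normSq_eq_norm_sq, Complex.normSq_apply]
    simp [hQ]
    ring
  have hQim : ∀ t, (Q t).im = -2 * ε * (z t).re := by
    intro t
    simp [hQ]
    ring
  have hQc : Continuous Q := by
    have := hz.continuous
    have := Complex.continuous_conj
    fun_prop
  have hQ0 : ∀ t, Q t ≠ 0 := fun t =>
    mul_ne_zero (hm t) ((map_ne_zero (starRingEnd ℂ)).2 (hp t))
  have hwQ : wind Q = wind (fun t => z t - Complex.I * ε) - wind (fun t => z t + Complex.I * ε) := by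
    rw [hQ, wind_mul (by have := hz.continuous; fun_prop) hm
      (c' := fun t => (starRingEnd ℂ) (z t + Complex.I * ε))
      (Complex.continuous_conj.comp hzp.continuous)
      (fun t => (map_ne_zero (starRingEnd ℂ)).2 (hp t)), wind_conj hzp.continuous hp,
      conj_wind hzp hp]
    ring
  have hQt₀ : Q t₀ = ((-ε ^ 2 : ℝ) : ℂ) := by
    have h0 : z t₀ = 0 := (hz0 t₀).2 rfl
    apply Complex.ext
    · rw [hQre, h0, Complex.ofReal_re]; simp
    · rw [hQim, h0, Complex.ofReal_im]; simp
  have hpos' : ∀ t, ε < ‖z t‖ → 0 < (Q t).re := fun t h => by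
    rw [hQre]; nlinarith
  obtain ⟨l, hlc, hle⟩ := exists_continuous_log hQc hQ0
  have key : ∀ (P : ℝ → ℂ) (I : Set ℝ), Continuous P → t₀ ∈ I →
      P t₀ = ((-ε ^ 2 : ℝ) : ℂ) → (∀ t ∈ I, t ≠ t₀ → 0 < (P t).re ∨ 0 < (P t).im) →
      (∃ r > 0, ∀ t ∈ I, |t - t₀| < r → 0 ≤ (P t).im) →
      ContinuousOn (fun t => Complex.log (P t)) I := by
    rintro P I hP ht₀I hPt₀ hPI ⟨r, hr0, hPr⟩ t ht
    by_cases h : t = t₀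
    · subst h
      have h1 : ContinuousWithinAt Complex.log {w | 0 ≤ w.im} (P t) :=
        Complex.continuousWithinAt_log_of_re_neg_of_im_zero (by rw [hPt₀, Complex.ofReal_re]; nlinarith)
          (by rw [hPt₀, Complex.ofReal_im])
      have h2 : ContinuousWithinAt P (I ∩ ball t r) t := hP.continuousWithinAt
      have h3 : ContinuousWithinAt (fun t => Complex.log (P t)) (I ∩ ball t r) t :=
        h1.comp h2 fun s hs => hPr s hs.1 hs.2
      exact (continuousWithinAt_inter (ball_mem_nhds t hr0)).1 h3
    · refine (hP.continuousAt.clog ?_).continuousWithinAt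
      rcases hPI t ht h with h | h
      · exact Or.inl h
      · exact Or.inr h.ne'
  have hside1 : ContinuousOn (fun t => Complex.log (Q t)) (Icc 0 t₀) := by
    refine key Q _ hQc ⟨ht₀.1.le, le_rfl⟩ hQt₀ ?_ ⟨η, hη, ?_⟩
    · intro t ht hne
      rcases hcase t with h | h | h | h
      · exact Or.inl (hpos' t h)
      · exact absurd h hne
      · right; rw [hQim]; nlinarith [h.2]
      · linarith [h.1, ht.2]
    · intro t ht hd
      rw [hQim]
      rcases eq_or_lt_of_le ht.2 with h | h
      · rw [(hz0 t).2 h]; simp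
      · have := hl t ⟨by linarith [(abs_lt.1 hd).1], h⟩
        nlinarith
  have hside2 : ContinuousOn (fun t => Complex.log ((starRingEnd ℂ) (Q t))) (Icc t₀ 1) := by
    refine key (fun t => (starRingEnd ℂ) (Q t)) _ (Complex.continuous_conj.comp hQc)
      ⟨le_rfl, ht₀.2.le⟩ (by rw [hQt₀, Complex.conj_ofReal]) ?_ ⟨η, hη, ?_⟩
    · intro t ht hne
      rw [Complex.conj_re, Complex.conj_im, hQim]
      rcases hcase t with h | h | h | h
      · exact Or.inl (hpos' t h)
      · exact absurd h hne
      · linarith [h.1, ht.1]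
      · right; nlinarith [h.2]
    · intro t ht hd
      rw [Complex.conj_im, hQim]
      rcases eq_or_lt_of_le ht.1 with h | h
      · rw [(hz0 t).2 h.symm]; simp
      · have := hr t ⟨h, by linarith [(abs_lt.1 hd).2]⟩
        nlinarith
  have e1 := sub_eq_sub_of_exp_eq isPreconnected_Icc hlc.continuousOn hside1
    (fun t _ => by rw [hle, Complex.exp_log (hQ0 t)]) (left_mem_Icc.2 ht₀.1.le)
    (right_mem_Icc.2 ht₀.1.le)
  have e2 := sub_eq_sub_of_exp_eq isPreconnected_Icc hlc.continuousOn
    (Complex.continuous_conj.comp_continuousOn hside2)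
    (fun t _ => by
      rw [hle, Function.comp_apply, Complex.exp_conj,
        Complex.exp_log ((map_ne_zero (starRingEnd ℂ)).2 (hQ0 t)), Complex.conj_conj])
    (left_mem_Icc.2 ht₀.2.le) (right_mem_Icc.2 ht₀.2.le)
  have hQ1 : Q 1 = Q 0 := by simp only [hQ, hz.eq_of_one_le 1 le_rfl]
  have hQ0re : 0 < (Q 0).re := hpos' 0 (hout 0 h0W.2)
  have hconj0 : (starRingEnd ℂ) (Complex.log ((starRingEnd ℂ) (Q 0))) = Complex.log (Q 0) := by
    rw [Complex.log_conj _ (fun h => ?_), Complex.conj_conj]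
    have := Complex.abs_arg_lt_pi_div_two_iff.2 (Or.inl hQ0re)
    rw [h, abs_of_pos Real.pi_pos] at this
    linarith [Real.pi_pos]
  have hlogt₀ : Complex.log (Q t₀) = (Real.log (ε ^ 2) : ℂ) + Real.pi * Complex.I := by
    rw [hQt₀, Complex.log, Complex.arg_ofReal_of_neg (by nlinarith), Complex.norm_real]
    simp
  simp only [Function.comp_apply, hQ1, hconj0] at e2
  rw [hQt₀, Complex.conj_ofReal, ← hQt₀, hlogt₀] at e2
  rw [hlogt₀] at e1
  have htot : wind Q = 2 * Real.pi * Complex.I := by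
    rw [wind_eq hlc.continuousOn fun t _ => hle t]
    simp only [map_add, map_mul, Complex.conj_ofReal, Complex.conj_I] at e2
    linear_combination e1 + e2
  intro hcontra
  rw [hwQ, hcontra, sub_self] at htot
  exact Complex.two_pi_I_ne_zero htot.symm

end Cat2Cx

namespace Cat2Cx

/-! ### Winding numbers and first homology -/

section Homology
variable {B : Type*} [TopologicalSpace B] {g : B → ℂ}

theorem wind_extend_congr (hg : Continuous g) (h0 : ∀ b, g b ≠ 0) {x : B} {p q : Path x x}
    (h : p.Homotopic q) : wind (fun t => g (p.extend t)) = wind (fun t => g (q.extend t)) := by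
  obtain ⟨H⟩ := h
  have key := wind_homotopy (H := fun r : ℝ × ℝ => g (H (projIcc 0 1 zero_le_one r.1,
    projIcc 0 1 zero_le_one r.2))) (hg.comp (H.continuous.comp (by fun_prop))) (fun _ => h0 _)
    (fun s => by simp) 0 1
  simp only [projIcc_left, projIcc_right] at key
  have e0 : ∀ t, H ((⟨0, left_mem_Icc.2 zero_le_one⟩ : unitInterval), t) = p t :=
    fun t => H.apply_zero t
  have e1 : ∀ t, H ((⟨1, right_mem_Icc.2 zero_le_one⟩ : unitInterval), t) = q t :=
    fun t => H.apply_one t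
  simp only [e0, e1] at key
  exact key

theorem wind_extend_trans (hg : Continuous g) (h0 : ∀ b, g b ≠ 0) {x y z : B} (p : Path x y)
    (q : Path y z) : wind (fun t => g ((p.trans q).extend t)) =
      wind (fun t => g (p.extend t)) + wind (fun t => g (q.extend t)) := by
  obtain ⟨l, hl, hl'⟩ := exists_continuous_log (c := fun t => g ((p.trans q).extend t))
    (hg.comp (p.trans q).continuous_extend)
    fun t => h0 _
  have e1 : wind (fun t => g (p.extend t)) = l (1 / 2) - l 0 := by
    rw [wind_eq (l := fun t => l (t / 2)) (by fun_prop), zero_div]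
    intro t ht
    rw [hl', Path.extend_trans_of_le_half]
    · congr 2; ring
    · linarith [ht.2]
  have e2 : wind (fun t => g (q.extend t)) = l 1 - l (1 / 2) := by
    rw [wind_eq (l := fun t => l ((t + 1) / 2)) (by fun_prop)]
    · norm_num
    intro t ht
    rw [hl', Path.extend_trans_of_half_le]
    · congr 2; ring
    · linarith [ht.1]
  rw [e1, e2, wind_eq hl.continuousOn fun t _ => hl' t]
  ring

/-- The winding number of a nowhere vanishing function, as a homomorphism on the fundamental
group. -/
noncomputable def windHom (hg : Continuous g) (h0 : ∀ b, g b ≠ 0) (x : B) :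
    FundamentalGroup B x →* Multiplicative ℂ where
  toFun := Quotient.lift (fun p : Path x x => Multiplicative.ofAdd (wind fun t => g (p.extend t)))
    fun _ _ h => congrArg _ (wind_extend_congr hg h0 h)
  map_one' := by
    rw [FundamentalGroup.one_def]
    change Multiplicative.ofAdd (wind fun t => g ((Path.refl x).extend t)) = 1
    simp only [Path.refl_extend, ContinuousMap.const_apply]
    rw [wind_const (h0 x)]
    rfl
  map_mul' := by
    rintro ⟨p⟩ ⟨q⟩
    change Multiplicative.ofAdd (wind fun t => g ((q.trans p).extend t)) =
      Multiplicative.ofAdd (wind fun t => g (p.extend t)) *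
      Multiplicative.ofAdd (wind fun t => g (q.extend t))
    rw [wind_extend_trans hg h0, add_comm, ofAdd_add]

theorem wind_extend_eq_zero (hB : H1Trivial B) (hg : Continuous g) (h0 : ∀ b, g b ≠ 0) {x : B}
    (p : Path x x) : wind (fun t => g (p.extend t)) = 0 := by
  have h := congrArg (Abelianization.lift (windHom hg h0 x)) (hB x p)
  rw [loopClassH1, map_one] at h
  exact h

end Homology

theorem wind_eq_zero_of_h1Trivial {X : Type*} [TopologicalSpace X] {E : Set X} (hE : H1Trivial E)
    {h : X → ℂ} (hh : Continuous h) (h0 : ∀ x ∈ E, h x ≠ 0) {γ : ℝ → X} (hγ : IsLoop γ)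
    (hγE : ∀ t, γ t ∈ E) : wind (fun t => h (γ t)) = 0 := by
  let p : Path (⟨γ 0, hγE 0⟩ : E) ⟨γ 0, hγE 0⟩ :=
    { toFun := fun t => ⟨γ t, hγE t⟩
      continuous_toFun := by
        have := hγ.continuous
        fun_prop
      source' := rfl
      target' := Subtype.ext (hγ.eq_of_one_le 1 le_rfl) }
  have key := wind_extend_eq_zero hE (g := fun b : E => h b) (hh.comp continuous_subtype_val)
    (fun b => h0 b b.2) p
  rw [← key]
  refine wind_congr fun t ht => ?_
  rw [Path.extend_apply _ ht]
  rfl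

end Cat2Cx

namespace Cat2Cx
open Topology

/-! ### Points enclosed by a loop -/

section Compare
variable {X : Type*} [MetricSpace X] [CNSpace X]

/-- The winding number of a loop with respect to a function with a single zero depends only on the
behaviour of the function near its zero. -/
theorem wind_comp_eq_of_eventually {h h' : X → ℂ} {y : X} (hh : Continuous h)
    (h0 : ∀ x, h x = 0 ↔ x = y) (hh' : Continuous h') (h0' : ∀ x, h' x = 0 ↔ x = y)
    (hq : ∀ᶠ x in 𝓝 y, x ≠ y → h' x / h x ∈ Complex.slitPlane) {γ : ℝ → X} (hγ : IsLoop γ)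
    (hy : y ∉ range γ) : wind (fun t => h' (γ t)) = wind (fun t => h (γ t)) := by
  obtain ⟨ρ, hρ, hρq⟩ := Metric.eventually_nhds_iff.1 hq
  obtain ⟨ρ', hρ', hρq'⟩ := Metric.eventually_nhds_iff.1
    (hγ.isCompact_range.isClosed.isOpen_compl.mem_nhds hy : ∀ᶠ x in 𝓝 y, x ∈ (range γ)ᶜ)
  set r := min ρ ρ' / 3 with hr
  have hr0 : 0 < r := by positivity
  have h3ρ : 3 * r ≤ ρ := by rw [hr]; linarith [min_le_left ρ ρ']
  have h3ρ' : 3 * r ≤ ρ' := by rw [hr]; linarith [min_le_right ρ ρ']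
  have hout : ∀ t, 3 * r ≤ dist (γ t) y := fun t => by
    by_contra hlt
    exact hρq' (by linarith : dist (γ t) y < ρ') (mem_range_self t)
  set χ : X → ℝ := fun x => max 0 (min 1 ((dist x y - r) / r)) with hχ
  have hχc : Continuous χ := by fun_prop
  classical
  set Q : X → ℂ := fun x => if dist x y < 3 * r then
    Complex.exp (χ x * Complex.log (h' x / h x)) else h' x / h x with hQ
  have hne : ∀ x, x ≠ y → h' x / h x ≠ 0 := fun x hx =>
    div_ne_zero (fun e => hx ((h0' x).1 e)) (fun e => hx ((h0 x).1 e))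
  have hQfar : ∀ x, 2 * r ≤ dist x y → Q x = h' x / h x := by
    intro x hx
    have hxy : x ≠ y := by rintro rfl; rw [dist_self] at hx; linarith
    by_cases hd : dist x y < 3 * r
    · have : χ x = 1 := by
        have : 1 ≤ (dist x y - r) / r := by rw [le_div_iff₀ hr0]; linarith
        simp [hχ, min_eq_left this]
      simp only [hQ, if_pos hd, this, Complex.ofReal_one, one_mul]
      exact Complex.exp_log (hne x hxy)
    · simp only [hQ, if_neg hd]
  have hQ0 : ∀ x, Q x ≠ 0 := by
    intro x
    by_cases hd : dist x y < 3 * r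
    · simp only [hQ, if_pos hd]; exact Complex.exp_ne_zero _
    · rw [hQfar x (by linarith)]
      refine hne x ?_
      rintro rfl
      exact hd (by rw [dist_self]; linarith)
  have hQc : Continuous Q := by
    rw [continuous_iff_continuousAt]
    intro x
    have hd : Continuous fun x => dist x y := by fun_prop
    rcases lt_or_ge (2 * r) (dist x y) with hx | hx
    · have hxy : x ≠ y := by rintro rfl; rw [dist_self] at hx; linarith
      have : ContinuousAt (fun x => h' x / h x) x :=
        hh'.continuousAt.div hh.continuousAt fun e => hxy ((h0 x).1 e)
      refine this.congr ?_
      filter_upwards [(isOpen_lt continuous_const hd).mem_nhds hx] with z hz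
      exact (hQfar z (le_of_lt hz)).symm
    · by_cases hxy : x = y
      · subst hxy
        refine (continuousAt_const (y := (1 : ℂ))).congr ?_
        filter_upwards [ball_mem_nhds x hr0] with z hz
        have hz' : dist z x < r := hz
        have : χ z = 0 := by
          have : (dist z x - r) / r ≤ 0 := div_nonpos_of_nonpos_of_nonneg (by linarith) hr0.le
          simp only [hχ]
          rw [min_eq_right (this.trans zero_le_one), max_eq_left this]
        simp [hQ, if_pos (by linarith : dist z x < 3 * r), this]
      · have hxr : dist x y < 3 * r := by linarith
        have : ContinuousAt (fun x => Complex.exp (χ x * Complex.log (h' x / h x))) x := by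
          refine Complex.continuous_exp.continuousAt.comp ?_
          refine (Complex.continuous_ofReal.comp hχc).continuousAt.mul ?_
          exact (hh'.continuousAt.div hh.continuousAt fun e => hxy ((h0 x).1 e)).clog
            (hρq (lt_of_lt_of_le hxr h3ρ) hxy)
        refine this.congr ?_
        filter_upwards [(isOpen_lt hd continuous_const).mem_nhds hxr] with z hz
        simp only [hQ]
        rw [if_pos hz]
  have hγne : ∀ t, γ t ≠ y := fun t e => hy ⟨t, e⟩
  have h1 := wind_mul (hQc.comp hγ.continuous) (fun t => hQ0 _) (hh.comp hγ.continuous)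
    (fun t e => hγne t ((h0 _).1 e))
  have h2 := wind_comp_eq_zero hQc hQ0 hγ
  simp only [Function.comp_def] at h1
  rw [h2, zero_add] at h1
  rw [← h1]
  refine wind_congr fun t _ => ?_
  rw [hQfar _ (by linarith [hout t]), div_mul_cancel₀ _ fun e => hγne t ((h0 _).1 e)]

end Compare

namespace FaceChart
variable {X : Type*} [MetricSpace X] {F : Set X}

theorem eventually_exists_map_eq (c : FaceChart F) {w : X} (hw : w ∈ F) {ρ : ℝ} (hρ : 0 < ρ) :
    ∀ᶠ a : ℂ in 𝓝 0, ∃ y ∈ F, dist w y < ρ ∧ c.toFun y - c.toFun w = a := by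
  have hinterior := c.map_mem_interior hw
  have hci : ContinuousAt c.inv (c.toFun w) :=
    c.continuousOn_inv.continuousAt (mem_interior_iff_mem_nhds.1 hinterior)
  have h1 : Tendsto (fun a : ℂ => c.toFun w + a) (𝓝 0) (𝓝 (c.toFun w)) := by
    have : Continuous fun a : ℂ => c.toFun w + a := by fun_prop
    simpa using this.tendsto 0
  have h2 : Tendsto (fun a : ℂ => c.inv (c.toFun w + a)) (𝓝 0) (𝓝 w) := by
    have := hci.tendsto.comp h1
    rwa [c.left_inv w (subset_closure hw)] at this
  filter_upwards [h2.eventually (ball_mem_nhds w hρ), h1.eventually (isOpen_interior.mem_nhds hinterior)]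
    with a ha hai
  exact ⟨c.inv (c.toFun w + a), c.inv_mem_face hai, by rw [dist_comm]; exact ha,
    by rw [c.right_inv _ (interior_subset hai)]; ring⟩

variable [CNSpace X]

/-- The displacement from `w` in the chart, after retraction to a ball around `w`. -/
noncomputable def disp (c : FaceChart F) (w : X) (r : ℝ) (x : X) : ℂ :=
  c.toFun (ret w r x) - c.toFun w

theorem continuous_disp (c : FaceChart F) {w : X} {r : ℝ} (hr : 0 ≤ r)
    (hF : closedBall w r ⊆ F) : Continuous (c.disp w r) := by
  refine Continuous.sub ?_ continuous_const
  refine (c.continuousOn.mono subset_closure).comp_continuous (continuous_ret w hr) fun x => hF ?_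
  rw [mem_closedBall, dist_comm, dist_ret w hr]
  exact min_le_right _ _

theorem disp_eq (c : FaceChart F) {w : X} {r : ℝ} {x : X} (hx : dist w x ≤ r) :
    c.disp w r x = c.toFun x - c.toFun w := by
  rw [disp, ret_eq_self hx]

theorem disp_eq_iff (c : FaceChart F) {w : X} {r : ℝ} (hr : 0 ≤ r) (hF : closedBall w r ⊆ F)
    {y : X} (hy : dist w y < r) (x : X) :
    c.disp w r x = c.toFun y - c.toFun w ↔ x = y := by
  constructor
  · intro h
    have h1 : ret w r x ∈ closedBall w r := by
      rw [mem_closedBall, dist_comm, dist_ret w hr]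
      exact min_le_right _ _
    have h2 : ret w r x = y := c.injOn (subset_closure (hF h1))
      (subset_closure (hF (by rw [mem_closedBall, dist_comm]; exact hy.le))) (sub_left_inj.1 h)
    have h3 := dist_ret w hr x
    rw [h2] at h3
    rcases min_choice (dist w x) r with h | h
    · rw [← h2, ret_eq_self]
      rw [← h]; exact min_le_right _ _
    · rw [h] at h3; linarith
  · rintro rfl
    exact c.disp_eq hy.le

end FaceChart

section Encl
variable {κ : ℝ} {X : Type*} [MetricSpace X] {PC : PolyComplex2 κ X}

/-- A choice of charts of all faces. -/
abbrev Charts (PC : PolyComplex2 κ X) := ∀ F : PC.faces, FaceChart (F : Set X)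

/-- The points in the open faces around which the loop `γ` has nonzero winding number. -/
def encl (ch : Charts PC) (γ : ℝ → X) : Set X :=
  {y | y ∉ range γ ∧ ∃ F : PC.faces, y ∈ (F : Set X) ∧ ∃ h : X → ℂ, Continuous h ∧
    (∀ x, h x = 0 ↔ x = y) ∧ (∀ᶠ x in 𝓝 y, h x = (ch F).toFun x - (ch F).toFun y) ∧
    wind (fun t => h (γ t)) ≠ 0}

theorem PolyComplex2.face_eq_of_mem (PC : PolyComplex2 κ X) {F F' : PC.faces} {x : X}
    (h : x ∈ (F : Set X)) (h' : x ∈ (F' : Set X)) : F = F' := by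
  by_contra hne
  have := PC.cells_disjoint F (Or.inl F.2) F' (Or.inl F'.2) fun e => hne (Subtype.ext e)
  exact (this ▸ (⟨h, h'⟩ : x ∈ (F : Set X) ∩ F') : x ∈ (∅ : Set X))

variable {ch : Charts PC} {γ : ℝ → X}

theorem encl_subset {E : Set X} (hE : H1Trivial E) (hγ : IsLoop γ) (hγE : ∀ t, γ t ∈ E) :
    encl ch γ ⊆ E := by
  rintro y ⟨-, F, -, h, hh, h0, -, hw⟩
  by_contra hyE
  exact hw (wind_eq_zero_of_h1Trivial hE hh (fun x hx e => hyE ((h0 x).1 e ▸ hx)) hγ hγE)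

variable [CNSpace X]

theorem mem_encl_iff (hγ : IsLoop γ) {F : PC.faces} {y : X} (hyF : y ∈ (F : Set X))
    (hy : y ∉ range γ) {h : X → ℂ} (hh : Continuous h) (h0 : ∀ x, h x = 0 ↔ x = y)
    (hq : ∀ᶠ x in 𝓝 y, x ≠ y → h x / ((ch F).toFun x - (ch F).toFun y) ∈ Complex.slitPlane) :
    y ∈ encl ch γ ↔ wind (fun t => h (γ t)) ≠ 0 := by
  have key : ∀ g : X → ℂ, Continuous g → (∀ x, g x = 0 ↔ x = y) →
      (∀ᶠ x in 𝓝 y, g x = (ch F).toFun x - (ch F).toFun y) →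
      wind (fun t => h (γ t)) = wind (fun t => g (γ t)) := by
    intro g hg g0 hgF
    refine wind_comp_eq_of_eventually hg g0 hh h0 ?_ hγ hy
    filter_upwards [hq, hgF] with x hx hx' hne
    rw [hx']
    exact hx hne
  constructor
  · rintro ⟨-, F', hyF', g, hg, g0, hgF, hw⟩
    obtain rfl := PC.face_eq_of_mem hyF hyF'
    rwa [key g hg g0 hgF]
  · intro hw
    obtain ⟨r, hr, hrF⟩ := nhds_basis_closedBall.mem_iff.1 ((PC.faces_open F F.2).mem_nhds hyF)
    have hd : ∀ᶠ x in 𝓝 y, (ch F).disp y r x = (ch F).toFun x - (ch F).toFun y := by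
      filter_upwards [closedBall_mem_nhds y hr] with x hx
      exact (ch F).disp_eq (by rw [dist_comm]; exact hx)
    have hd0 : ∀ x, (ch F).disp y r x = 0 ↔ x = y := fun x => by
      rw [← (ch F).disp_eq_iff hr.le hrF (y := y) (by rwa [dist_self]) x, sub_self]
    exact ⟨hy, F, hyF, (ch F).disp y r, (ch F).continuous_disp hr.le hrF, hd0, hd,
      by rwa [← key _ ((ch F).continuous_disp hr.le hrF) hd0 hd]⟩

theorem mem_encl_iff_disp (hγ : IsLoop γ) {F : PC.faces} {w y : X} {r : ℝ} (hr : 0 ≤ r)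
    (hF : closedBall w r ⊆ (F : Set X)) (hy : dist w y < r) (hyγ : y ∉ range γ) :
    y ∈ encl ch γ ↔ wind (fun t => (ch F).disp w r (γ t) -
      ((ch F).toFun y - (ch F).toFun w)) ≠ 0 := by
  have hyF : y ∈ (F : Set X) := hF (by rw [mem_closedBall, dist_comm]; exact hy.le)
  refine mem_encl_iff hγ hyF hyγ (h := fun x => (ch F).disp w r x -
    ((ch F).toFun y - (ch F).toFun w)) (((ch F).continuous_disp hr hF).sub continuous_const)
    (fun x => by rw [sub_eq_zero, (ch F).disp_eq_iff hr hF hy]) ?_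
  have : ∀ᶠ x in 𝓝 y, dist w x < r :=
    (isOpen_lt (by fun_prop) continuous_const).mem_nhds hy
  filter_upwards [this, (PC.faces_open F F.2).mem_nhds hyF] with x hx hxF hne
  have : (ch F).toFun x - (ch F).toFun y ≠ 0 := fun e =>
    hne ((ch F).injOn (subset_closure hxF) (subset_closure hyF) (sub_eq_zero.1 e))
  rw [(ch F).disp_eq hx.le, sub_sub_sub_cancel_right, div_self this]
  exact Complex.one_mem_slitPlane

theorem eventually_mem_encl_iff (hγ : IsLoop γ) {F : PC.faces} {w : X} (hwF : w ∈ (F : Set X))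
    (hw : w ∉ range γ) : ∀ᶠ y in 𝓝 w, (y ∈ encl ch γ ↔ w ∈ encl ch γ) := by
  obtain ⟨r, hr, hrF⟩ := nhds_basis_closedBall.mem_iff.1 ((PC.faces_open F F.2).mem_nhds hwF)
  have hHc := (ch F).continuous_disp hr.le hrF
  have hloop : IsLoop fun t => (ch F).disp w r (γ t) := hγ.comp hHc
  have hne : ∀ t, (ch F).disp w r (γ t) ≠ 0 := fun t e => hw ⟨t, by
    rwa [← (ch F).disp_eq_iff hr.le hrF (y := w) (by rwa [dist_self]), sub_self]⟩
  obtain ⟨_, ⟨s, rfl⟩, hmin⟩ := hloop.isCompact_range.exists_isMinOn (range_nonempty _)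
    (f := fun z => ‖z‖) continuous_norm.continuousOn
  have hpos : 0 < ‖(ch F).disp w r (γ s)‖ := norm_pos_iff.2 (hne s)
  have hψ : ContinuousAt (fun y => (ch F).toFun y - (ch F).toFun w) w :=
    (((ch F).continuousOn.mono subset_closure).continuousAt
      ((PC.faces_open F F.2).mem_nhds hwF)).sub continuousAt_const
  have hsm : ∀ᶠ y in 𝓝 w, ‖(ch F).toFun y - (ch F).toFun w‖ < ‖(ch F).disp w r (γ s)‖ := by
    refine hψ.norm.eventually_lt continuousAt_const ?_
    simpa using hpos
  have hd : ∀ᶠ y in 𝓝 w, dist w y < r := by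
    filter_upwards [ball_mem_nhds w hr] with y hy
    rwa [dist_comm]
  have hγn : ∀ᶠ y in 𝓝 w, y ∉ range γ := hγ.isCompact_range.isClosed.isOpen_compl.mem_nhds hw
  filter_upwards [hsm, hd, hγn] with y hy hyd hyγ
  rw [mem_encl_iff_disp hγ hr.le hrF hyd hyγ,
    mem_encl_iff_disp hγ hr.le hrF (by rwa [dist_self]) hw]
  simp only [sub_self, sub_zero]
  rw [wind_eq_of_div_mem_slitPlane hloop hne (hloop.comp (f := fun z => z -
    ((ch F).toFun y - (ch F).toFun w)) (by fun_prop))]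
  intro t
  left
  set a := (ch F).toFun y - (ch F).toFun w
  have hlt : ‖a / (ch F).disp w r (γ t)‖ < 1 := by
    rw [norm_div, div_lt_one (norm_pos_iff.2 (hne t))]
    exact hy.trans_le (hmin (mem_range_self t))
  rw [sub_div, div_self (hne t), Complex.sub_re, Complex.one_re]
  linarith [(Complex.abs_re_le_norm (a / (ch F).disp w r (γ t))).trans_lt hlt,
    le_abs_self (a / (ch F).disp w r (γ t)).re]

theorem isOpen_encl (hγ : IsLoop γ) : IsOpen (encl ch γ) := by
  rw [isOpen_iff_mem_nhds]
  intro y hy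
  obtain ⟨hyγ, F, hyF, -⟩ := id hy
  filter_upwards [eventually_mem_encl_iff (ch := ch) hγ hyF hyγ] with x hx
  exact hx.2 hy

theorem subset_encl_of_isPreconnected (hγ : IsLoop γ) {F : PC.faces} {T : Set X}
    (hT : IsPreconnected T) (hTF : T ⊆ F) (hTγ : Disjoint T (range γ))
    (hne : (T ∩ encl ch γ).Nonempty) : T ⊆ encl ch γ := by
  have hopen : IsOpen {y | y ∈ (F : Set X) ∧ y ∉ range γ ∧ y ∉ encl ch γ} := by
    rw [isOpen_iff_mem_nhds]
    rintro y ⟨hyF, hyγ, hy⟩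
    filter_upwards [eventually_mem_encl_iff (ch := ch) hγ hyF hyγ,
      (PC.faces_open F F.2).mem_nhds hyF,
      hγ.isCompact_range.isClosed.isOpen_compl.mem_nhds hyγ] with x hx hxF hxγ
    exact ⟨hxF, hxγ, fun h => hy (hx.1 h)⟩
  refine hT.subset_left_of_subset_union (isOpen_encl hγ) hopen ?_ ?_ hne
  · exact disjoint_left.2 fun x hx hx' => hx'.2.2 hx
  · intro x hx
    by_cases h : x ∈ encl ch γ
    · exact Or.inl h
    · exact Or.inr ⟨hTF hx, disjoint_left.1 hTγ hx, h⟩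

/-- A point of an open face which the loop crosses exactly once is a limit of enclosed points. -/
theorem mem_closure_encl_of_crossing (hγ : IsLoop γ) {F : PC.faces} {t₀ : ℝ}
    (ht₀ : t₀ ∈ Ioo (0 : ℝ) 1) (hF : γ t₀ ∈ (F : Set X)) (honce : ∀ t, γ t = γ t₀ ↔ t = t₀)
    {a : ℂ} (ha : a ≠ 0) {η : ℝ} (hη : 0 < η)
    (hl : ∀ t ∈ Ioo (t₀ - η) t₀, (a * ((ch F).toFun (γ t) - (ch F).toFun (γ t₀))).re < 0)
    (hr : ∀ t ∈ Ioo t₀ (t₀ + η), 0 < (a * ((ch F).toFun (γ t) - (ch F).toFun (γ t₀))).re) :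
    γ t₀ ∈ closure (encl ch γ) := by
  rw [Metric.mem_closure_iff]
  intro ρ hρ
  set w := γ t₀ with hw
  obtain ⟨r, hr0, hrF⟩ := nhds_basis_closedBall.mem_iff.1 ((PC.faces_open F F.2).mem_nhds hF)
  have hHc := (ch F).continuous_disp hr0.le hrF
  have hz : IsLoop fun t => a * (ch F).disp w r (γ t) :=
    hγ.comp (f := fun x => a * (ch F).disp w r x) (by fun_prop)
  have hz0 : ∀ t, a * (ch F).disp w r (γ t) = 0 ↔ t = t₀ := fun t => by
    rw [mul_eq_zero, or_iff_right ha, ← honce t,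
      ← (ch F).disp_eq_iff hr0.le hrF (y := w) (by rwa [dist_self]), sub_self]
  obtain ⟨η', hη', hclose⟩ := Metric.continuousAt_iff.1 (hγ.continuous.continuousAt (x := t₀)) r hr0
  have hdisp : ∀ t, |t - t₀| < η' → (ch F).disp w r (γ t) = (ch F).toFun (γ t) - (ch F).toFun w :=
    fun t ht => (ch F).disp_eq (by rw [dist_comm]; exact (hclose ht).le)
  obtain ⟨ε₀, hε₀, hε⟩ := exists_wind_ne_of_crossing hz ht₀ (lt_min hη hη') hz0
    (fun t ht => by
      rw [hdisp t (by rw [abs_lt]; constructor <;> linarith [ht.1, ht.2, min_le_right η η'])]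
      exact hl t ⟨by linarith [ht.1, min_le_left η η'], ht.2⟩)
    (fun t ht => by
      rw [hdisp t (by rw [abs_lt]; constructor <;> linarith [ht.1, ht.2, min_le_right η η'])]
      exact hr t ⟨ht.1, by linarith [ht.2, min_le_left η η']⟩)
  obtain ⟨δ, hδ, hδy⟩ := Metric.eventually_nhds_iff.1
    ((ch F).eventually_exists_map_eq hF (lt_min hρ hr0))
  set ε := min ε₀ (δ * ‖a‖) / 2 with hεdef
  have hapos := norm_pos_iff.2 ha
  have hmin : 0 < min ε₀ (δ * ‖a‖) := by positivity
  have hεpos : 0 < ε := by positivity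
  obtain ⟨hm, hp, hne⟩ := hε ε hεpos (by rw [hεdef]; linarith [min_le_left ε₀ (δ * ‖a‖)])
  have hsmall : ∀ s : ℂ, ‖s‖ = 1 → dist (s * ε / a) 0 < δ := by
    intro s hs
    rw [dist_zero_right, norm_div, norm_mul, hs, one_mul, Complex.norm_real, Real.norm_eq_abs,
      abs_of_pos hεpos, div_lt_iff₀ hapos, hεdef]
    linarith [min_le_right ε₀ (δ * ‖a‖)]
  have main : ∀ s : ℂ, ‖s‖ = 1 → (∀ t, a * (ch F).disp w r (γ t) - s * ε ≠ 0) →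
      wind (fun t => a * (ch F).disp w r (γ t) - s * ε) ≠ 0 →
      ∃ y ∈ encl ch γ, dist w y < ρ := by
    intro s hs hne0 hws
    obtain ⟨y, hyF, hyd, hya⟩ := hδy (hsmall s hs)
    have hyr : dist w y < r := hyd.trans_le (min_le_right _ _)
    refine ⟨y, ?_, hyd.trans_le (min_le_left _ _)⟩
    have heq : ∀ t, a * (ch F).disp w r (γ t) - s * ε =
        a * ((ch F).disp w r (γ t) - ((ch F).toFun y - (ch F).toFun w)) := fun t => by
      rw [hya]; field_simp
    have hne' : ∀ t, (ch F).disp w r (γ t) - ((ch F).toFun y - (ch F).toFun w) ≠ 0 := fun t e =>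
      hne0 t (by rw [heq, e, mul_zero])
    have hyγ : y ∉ range γ := by
      rintro ⟨t, ht⟩
      exact hne' t (by rw [sub_eq_zero, (ch F).disp_eq_iff hr0.le hrF hyr, ht])
    rw [mem_encl_iff_disp hγ hr0.le hrF hyr hyγ]
    simp only [heq] at hws
    rwa [wind_mul (c' := fun t => (ch F).disp w r (γ t) - ((ch F).toFun y - (ch F).toFun w))
      continuous_const (fun _ => ha)
      ((hHc.comp hγ.continuous).sub continuous_const) hne', wind_const ha, zero_add] at hws
  by_cases h0 : wind (fun t => a * (ch F).disp w r (γ t) - Complex.I * ε) = 0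
  · have h1 : ∀ t, a * (ch F).disp w r (γ t) + Complex.I * ε =
        a * (ch F).disp w r (γ t) - -Complex.I * ε := fun t => by ring
    simp only [h1] at hp hne
    exact main (-Complex.I) (by simp) hp (fun e => hne (h0.trans e.symm))
  · exact main Complex.I (by simp) hm h0

end Encl
end Cat2Cx

namespace Cat2Cx
open Topology

/-! ### The local structure at a point of an open edge -/

/-- The cross product of two plane vectors. -/
def cross (z v : ℂ) : ℝ := z.re * v.im - z.im * v.re

theorem cross_eq_zero_of_mem_segment {x y z : ℂ}
    (h : x ∈ segment ℝ y z ∨ y ∈ segment ℝ x z ∨ z ∈ segment ℝ x y) :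
    cross (y - x) (z - x) = 0 := by
  rcases h with h | h | h <;> obtain ⟨a, b, -, -, hab, rfl⟩ := h <;>
    obtain rfl : a = 1 - b := by linarith
  all_goals
    simp only [cross, Complex.sub_re, Complex.sub_im, Complex.add_re, Complex.add_im,
      Complex.real_smul, Complex.mul_re, Complex.mul_im, Complex.ofReal_re, Complex.ofReal_im]
    ring

/-- A convex planar set in the upper half plane whose boundary points near `0` are collinear with
`0` contains a half disc. -/
theorem exists_halfDisc_subset {K : Set ℂ} (hKc : IsClosed K) (hK : Convex ℝ K) (h0 : (0 : ℂ) ∈ K)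
    (hne : (interior K).Nonempty) (hpos : ∀ z ∈ interior K, 0 < z.im) {ε : ℝ} (hε : 0 < ε)
    (hcol : ∀ f ∈ K, ∀ g ∈ K, f ∉ interior K → g ∉ interior K → ‖f‖ < ε → ‖g‖ < ε →
      cross f g = 0) :
    ∃ δ > 0, ∀ z : ℂ, ‖z‖ < δ → 0 ≤ z.im → z ∈ K := by
  obtain ⟨o, ho⟩ := hne
  obtain ⟨q, hq, hqε⟩ : ∃ q ∈ interior K, ‖q‖ < ε := by
    have hcont : Tendsto (fun t : ℝ => (t : ℂ) * o) (𝓝[>] 0) (𝓝 0) := by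
      have : Continuous fun t : ℝ => (t : ℂ) * o := by fun_prop
      have := (this.tendsto 0).mono_left (nhdsWithin_le_nhds (s := Ioi (0 : ℝ)))
      simpa using this
    have h1 : ∀ᶠ t : ℝ in 𝓝[>] 0, ‖(t : ℂ) * o‖ < ε := by
      have := hcont.norm
      rw [norm_zero] at this
      exact this.eventually_lt_const hε
    have h2 : ∀ᶠ t : ℝ in 𝓝[>] 0, t ∈ Ioo (0 : ℝ) 1 := Ioo_mem_nhdsGT one_pos
    obtain ⟨t, ht, ht1⟩ := (h1.and h2).exists
    refine ⟨_, ?_, ht⟩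
    have := hK.combo_interior_self_mem_interior ho h0 ht1.1 (by linarith [ht1.2] : 0 ≤ 1 - t)
      (by ring)
    simpa using this
  have hqpos := hpos q hq
  set s := ε / 2 with hs
  have hs0 : 0 < s := by positivity
  have exit : ∀ v : ℝ, |v| = s → ∃ t : ℝ, 0 < t ∧ t ≤ 1 ∧ ((1 - t : ℝ) * q + (t * v : ℝ) : ℂ) ∈ K ∧
      ((1 - t : ℝ) * q + (t * v : ℝ) : ℂ) ∉ interior K := by
    intro v hv
    set f : ℝ → ℂ := fun t => (1 - t : ℝ) * q + (t * v : ℝ) with hf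
    have hfc : Continuous f := by fun_prop
    have hf0 : f 0 = q := by simp [hf]
    have hf1 : f 1 ∉ interior K := fun h => by
      have := hpos _ h
      simp [hf] at this
    have hA : IsCompact (Icc (0 : ℝ) 1 ∩ f ⁻¹' (interior K)ᶜ) :=
      isCompact_Icc.inter_right (isOpen_interior.isClosed_compl.preimage hfc)
    obtain ⟨t, ⟨ht01, ht⟩, hmin⟩ := hA.exists_isLeast ⟨1, ⟨by simp, hf1⟩⟩
    have ht0 : 0 < t := lt_of_le_of_ne ht01.1 (by rintro rfl; exact ht (by rwa [hf0]))
    refine ⟨t, ht0, ht01.2, ?_, ht⟩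
    have : Tendsto f (𝓝[<] t) (𝓝 (f t)) := hfc.continuousAt.mono_left nhdsWithin_le_nhds
    refine hKc.mem_of_tendsto this ?_
    filter_upwards [Ioo_mem_nhdsLT ht0] with u hu
    by_contra hcon
    exact absurd (hmin ⟨⟨hu.1.le, hu.2.le.trans ht01.2⟩, fun h => hcon (interior_subset h)⟩)
      (not_le.2 hu.2)
  have small : ∀ v t : ℝ, |v| = s → 0 < t → t ≤ 1 → ‖((1 - t : ℝ) * q + (t * v : ℝ) : ℂ)‖ < ε := by
    intro v t hv ht0 ht1
    calc _ ≤ ‖((1 - t : ℝ) : ℂ) * q‖ + ‖((t * v : ℝ) : ℂ)‖ := norm_add_le _ _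
      _ = (1 - t) * ‖q‖ + t * s := by
        rw [norm_mul, Complex.norm_real, Complex.norm_real, Real.norm_eq_abs, Real.norm_eq_abs,
          abs_of_nonneg (by linarith : 0 ≤ 1 - t), abs_mul, hv, abs_of_pos ht0]
      _ < ε := by nlinarith
  obtain ⟨t, ht0, ht1, hfK, hfi⟩ := exit (-s) (by rw [abs_neg, abs_of_pos hs0])
  obtain ⟨t', ht0', ht1', hgK, hgi⟩ := exit s (abs_of_pos hs0)
  have hc := hcol _ hfK _ hgK hfi hgi (small _ _ (by rw [abs_neg, abs_of_pos hs0]) ht0 ht1)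
    (small _ _ (abs_of_pos hs0) ht0' ht1')
  have hc' : s * q.im * (t * (1 - t') + (1 - t) * t') = 0 := by
    simp only [cross, Complex.add_re, Complex.add_im, Complex.mul_re, Complex.mul_im,
      Complex.ofReal_re, Complex.ofReal_im] at hc
    linear_combination -hc
  have hz : t * (1 - t') + (1 - t) * t' = 0 :=
    (mul_eq_zero.1 hc').resolve_left (by positivity)
  have e1 : t = 1 := by
    have h1 := mul_nonneg ht0.le (sub_nonneg.2 ht1')
    have h2 := mul_nonneg (sub_nonneg.2 ht1) ht0'.le
    have : (1 - t) * t' = 0 := by linarith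
    rcases mul_eq_zero.1 this with h | h <;> linarith
  have e2 : t' = 1 := by
    rw [e1] at hz; linarith
  have hsm : ((-s : ℝ) : ℂ) ∈ K := by simpa [e1] using hfK
  have hsp : ((s : ℝ) : ℂ) ∈ K := by simpa [e2] using hgK
  have hD : 0 < q.im + |q.re| + s := by positivity
  refine ⟨s * q.im / (q.im + |q.re| + s), by positivity, fun z hz hz0 => ?_⟩
  rw [lt_div_iff₀ hD] at hz
  have hre := Complex.abs_re_le_norm z
  have him := Complex.abs_im_le_norm z
  rw [abs_of_nonneg hz0] at him
  set μ := z.im / q.im with hμ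
  have hμ0 : 0 ≤ μ := by positivity
  have hμq : μ * q.im = z.im := by rw [hμ]; field_simp
  set v := z.re - μ * q.re with hv
  have hvb : |v| ≤ (1 - μ) * s := by
    have h1 : |v| ≤ |z.re| + μ * |q.re| := by
      rw [hv]
      calc _ ≤ |z.re| + |μ * q.re| := abs_sub _ _
        _ = _ := by rw [abs_mul, abs_of_nonneg hμ0]
    have h2 : q.im * (|z.re| + μ * |q.re| + μ * s) ≤ q.im * s := by
      have : q.im * (|z.re| + μ * |q.re| + μ * s) = q.im * |z.re| + z.im * |q.re| + z.im * s := by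
        rw [← hμq]; ring
      rw [this]
      nlinarith [abs_nonneg q.re]
    have h3 := le_of_mul_le_mul_left h2 hqpos
    linarith
  have hμ1 : μ ≤ 1 := by
    by_contra hlt
    have := (abs_nonneg v).trans hvb
    nlinarith
  rw [abs_le] at hvb
  set α := ((1 - μ) * s + v) / (2 * s) with hα
  set β := ((1 - μ) * s - v) / (2 * s) with hβ
  have hα0 : 0 ≤ α := div_nonneg (by linarith [hvb.1]) (by positivity)
  have hβ0 : 0 ≤ β := div_nonneg (by linarith [hvb.2]) (by positivity)
  have hαβ : α * s - β * s = v := by rw [hα, hβ]; field_simp; ring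
  have hsum : α + β + μ = 1 := by rw [hα, hβ]; field_simp; ring
  have hzz : z = α • ((s : ℝ) : ℂ) + β • ((-s : ℝ) : ℂ) + μ • q := by
    apply Complex.ext
    · simp
      linarith
    · simp [hμq]
  have := hK.sum_mem (t := Finset.univ) (ι := Fin 3)
    (w := ![α, β, μ]) (z := ![((s : ℝ) : ℂ), ((-s : ℝ) : ℂ), q])
    (by intro i _; fin_cases i <;> assumption)
    (by rw [Fin.sum_univ_three]; exact hsum)
    (by intro i _; fin_cases i; exacts [hsp, hsm, interior_subset hq])
  rw [Fin.sum_univ_three] at this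
  rw [hzz]
  exact this

namespace FaceChart
variable {X : Type*} [MetricSpace X] {F : Set X}

/-- The chart obtained by translating a point to the origin and multiplying by a nonzero
number. -/
noncomputable def normalize (c : FaceChart F) (z₀ : ℂ) {a : ℂ} (ha : a ≠ 0) : FaceChart F := by
  let T : ℂ ≃ₜ ℂ := (Homeomorph.subRight z₀).trans (Homeomorph.mulLeft₀ a ha)
  have hT : ∀ z, T z = a * (z - z₀) := fun z => rfl
  have hTs : ∀ z, T.symm z = z / a + z₀ := fun z => by
    rw [T.symm_apply_eq, hT]; field_simp; ring
  have hseg : ∀ x y z, T z ∈ segment ℝ (T x) (T y) ↔ z ∈ segment ℝ x y := by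
    intro x y z
    constructor
    · rintro ⟨s, t, hs, ht, hst, h⟩
      refine ⟨s, t, hs, ht, hst, T.injective ?_⟩
      rw [← h, hT, hT, hT]
      obtain rfl : s = 1 - t := by linarith
      simp only [Complex.real_smul]
      push_cast
      ring
    · rintro ⟨s, t, hs, ht, hst, h⟩
      refine ⟨s, t, hs, ht, hst, ?_⟩
      rw [← h, hT, hT, hT]
      obtain rfl : s = 1 - t := by linarith
      simp only [Complex.real_smul]
      push_cast
      ring
  exact
  { toFun := fun x => a * (c.toFun x - z₀)
    inv := fun z => c.inv (z / a + z₀)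
    K := T '' c.K
    map_mem := fun x hx => mem_image_of_mem T (c.map_mem x hx)
    inv_mem := by
      rintro _ ⟨z, hz, rfl⟩
      rw [← hTs, T.symm_apply_apply]
      exact c.inv_mem z hz
    left_inv := fun x hx => by
      rw [mul_div_cancel_left₀ _ ha, sub_add_cancel, c.left_inv x hx]
    right_inv := by
      rintro _ ⟨z, hz, rfl⟩
      rw [← hTs, T.symm_apply_apply, c.right_inv z hz, hT]
    isCompact := c.isCompact.image T.continuous
    convex := by
      rw [convex_iff_segment_subset]
      rintro _ ⟨x, hx, rfl⟩ _ ⟨y, hy, rfl⟩ u hu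
      obtain ⟨z, rfl⟩ := T.surjective u
      exact mem_image_of_mem T (c.convex.segment_subset hx hy ((hseg x y z).1 hu))
    mem_interior_iff := fun x hx => by
      rw [← T.image_interior, ← c.mem_interior_iff x hx]
      exact T.injective.mem_set_image (a := c.toFun x)
    nonempty := c.nonempty
    lipschitz := by
      obtain ⟨C, hC⟩ := c.lipschitz
      refine ⟨‖a‖₊ * C, fun x hx y hy => ?_⟩
      have := hC hx hy
      rw [edist_nndist, edist_nndist] at this ⊢
      rw [nndist_eq_nnnorm] at this ⊢
      rw [← mul_sub, sub_sub_sub_cancel_right, nnnorm_mul]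
      norm_cast at this ⊢
      rw [mul_assoc]
      gcongr
    continuousOn_inv := by
      refine c.continuousOn_inv.comp (by fun_prop) ?_
      rintro _ ⟨z, hz, rfl⟩
      change T z / a + z₀ ∈ c.K
      rw [← hTs, T.symm_apply_apply]
      exact hz
    mem_segment_iff := fun x hx y hy z hz => by
      rw [← c.mem_segment_iff x hx y hy z hz]
      exact hseg _ _ _ }

theorem cross_eq_zero (c : FaceChart F) {x y z : X} (hx : x ∈ closure F) (hy : y ∈ closure F)
    (hz : z ∈ closure F) (h : Btw y x z ∨ Btw x y z ∨ Btw x z y) :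
    cross (c.toFun y - c.toFun x) (c.toFun z - c.toFun x) = 0 := by
  apply cross_eq_zero_of_mem_segment
  rwa [c.mem_segment_iff y hy z hz x hx, c.mem_segment_iff x hx z hz y hy,
    c.mem_segment_iff x hx y hy z hz]

theorem interior_nonempty (c : FaceChart F) : (interior c.K).Nonempty :=
  let ⟨_, hx⟩ := c.nonempty
  ⟨_, c.map_mem_interior hx⟩

end FaceChart
end Cat2Cx

namespace Cat2Cx
open Topology

/-- A continuous function restricting to an arclength coordinate of the edge near `w`. -/
structure IsEdgeCoord {X : Type*} [MetricSpace X] (e : Set X) (w : X) (r : ℝ)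
    (b : X → ℝ) : Prop where
  continuous : Continuous b
  map_base : b w = 0
  dist_eq : ∀ x ∈ e, ∀ y ∈ e, dist w x < r → dist w y < r → dist x y = |b x - b y|
  exists_eq : ∀ s, |s| < r → ∃ x ∈ e, b x = s ∧ dist w x = |s|

namespace PolyComplex2
variable {κ : ℝ} {X : Type*} [MetricSpace X] (PC : PolyComplex2 κ X)

theorem btw_of_mem_edge {e : Set X} (he : e ∈ PC.edges) {x y z : X} (hx : x ∈ e) (hy : y ∈ e)
    (hz : z ∈ e) : Btw y x z ∨ Btw x y z ∨ Btw x z y := by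
  obtain ⟨f, L, -, hf, rfl⟩ := PC.edge_geodesic e he
  obtain ⟨a, ha, rfl⟩ := hx
  obtain ⟨b, hb, rfl⟩ := hy
  obtain ⟨d, hd, rfl⟩ := hz
  have key : ∀ s ∈ Ioo 0 L, ∀ t ∈ Ioo 0 L, dist (f s) (f t) = |s - t| := fun s hs t ht =>
    hf.2 s (Ioo_subset_Icc_self hs) t (Ioo_subset_Icc_self ht)
  simp only [Btw]
  rw [key b hb a ha, key a ha d hd, key b hb d hd, key a ha b hb, key d hd b hb]
  grind

theorem disjoint_edge_face {e F : Set X} (he : e ∈ PC.edges) (hF : F ∈ PC.faces)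
    (c : FaceChart F) : e ∩ F = ∅ := by
  refine PC.cells_disjoint e (Or.inr he) F (Or.inl hF) ?_
  rintro rfl
  obtain ⟨z, hz⟩ := c.interior_nonempty
  have h0 : Tendsto (fun t : ℝ => z + t) (𝓝[>] 0) (𝓝 z) := by
    have : Continuous fun t : ℝ => z + t := by fun_prop
    have := (this.tendsto 0).mono_left (nhdsWithin_le_nhds (s := Ioi (0 : ℝ)))
    simpa using this
  have h1 : Tendsto (fun t : ℝ => z + t * Complex.I) (𝓝[>] 0) (𝓝 z) := by
    have : Continuous fun t : ℝ => z + t * Complex.I := by fun_prop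
    have := (this.tendsto 0).mono_left (nhdsWithin_le_nhds (s := Ioi (0 : ℝ)))
    simpa using this
  obtain ⟨t, ⟨ht0, ht1⟩, ht⟩ := ((h0.eventually (isOpen_interior.mem_nhds hz)).and
    (h1.eventually (isOpen_interior.mem_nhds hz))).and self_mem_nhdsWithin |>.exists
  have ht : 0 < t := ht
  have mem : ∀ v ∈ interior c.K, c.inv v ∈ closure e := fun v hv => c.inv_mem v (interior_subset hv)
  have := c.cross_eq_zero (mem _ hz) (mem _ ht0) (mem _ ht1)
    (PC.btw_of_mem_edge he (c.inv_mem_face hz) (c.inv_mem_face ht0) (c.inv_mem_face ht1))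
  rw [c.right_inv _ (interior_subset hz), c.right_inv _ (interior_subset ht0),
    c.right_inv _ (interior_subset ht1)] at this
  simp [cross] at this
  exact ht.ne' this

theorem exists_isEdgeCoord {e : Set X} (he : e ∈ PC.edges) {w : X} (hw : w ∈ e) :
    ∃ b : X → ℝ, ∃ r > 0, IsEdgeCoord e w r b := by
  obtain ⟨f, L, hL, hf, rfl⟩ := PC.edge_geodesic e he
  obtain ⟨s₀, hs₀, rfl⟩ := hw
  set ρ := min s₀ (L - s₀) / 2 with hρdef
  have hmin : 0 < min s₀ (L - s₀) := lt_min hs₀.1 (by linarith [hs₀.2])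
  have hρ : 0 < ρ := by positivity
  have h1 : ρ < s₀ := by linarith [min_le_left s₀ (L - s₀)]
  have h2 : ρ < L - s₀ := by linarith [min_le_right s₀ (L - s₀)]
  have key : ∀ s ∈ Ioo 0 L, ∀ t ∈ Ioo 0 L, dist (f s) (f t) = |s - t| := fun s hs t ht =>
    hf.2 s (Ioo_subset_Icc_self hs) t (Ioo_subset_Icc_self ht)
  set b : X → ℝ := fun x => (dist x (f (s₀ - ρ)) - dist x (f (s₀ + ρ))) / 2 with hb
  have hbf : ∀ s, |s - s₀| < ρ → b (f s) = s - s₀ := by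
    intro s hs
    rw [abs_lt] at hs
    have hs' : s ∈ Ioo 0 L := ⟨by linarith, by linarith⟩
    simp only [hb]
    rw [key s hs' _ ⟨by linarith, by linarith⟩, key s hs' _ ⟨by linarith, by linarith⟩,
      abs_of_nonneg (by linarith), abs_of_nonpos (by linarith)]
    ring
  have hs₀' : b (f s₀) = 0 := by rw [hbf s₀ (by simpa using hρ), sub_self]
  refine ⟨b, ρ, hρ, by fun_prop, hs₀', ?_, ?_⟩
  · rintro _ ⟨s, hs, rfl⟩ _ ⟨t, ht, rfl⟩ hds hdt
    rw [key _ hs₀ _ hs, abs_sub_comm] at hds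
    rw [key _ hs₀ _ ht, abs_sub_comm] at hdt
    rw [key _ hs _ ht, hbf s hds, hbf t hdt, sub_sub_sub_cancel_right]
  · intro s hs
    have hs' := abs_lt.1 hs
    have hmem : s₀ + s ∈ Ioo 0 L := ⟨by linarith, by linarith⟩
    refine ⟨f (s₀ + s), ⟨_, hmem, rfl⟩, ?_, ?_⟩
    · rw [hbf _ (by simpa using hs)]; ring
    · rw [key _ hs₀ _ hmem, abs_sub_comm, add_sub_cancel_left]

/-- Near a point of an open edge there are only that edge and finitely many faces having the point
in their closure. -/
theorem exists_ball_subset_of_mem_edge {e : Set X} (he : e ∈ PC.edges) {w : X} (hw : w ∈ e) :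
    {F : PC.faces | w ∈ closure (F : Set X)}.Finite ∧ ∃ r > 0, ∀ x, dist w x < r →
      x ∈ e ∨ ∃ F : PC.faces, x ∈ (F : Set X) ∧ w ∈ closure (F : Set X) := by
  obtain ⟨ε, hε, hfin, hvfin⟩ := PC.locally_finite w
  have hwv : w ∉ PC.vertices := fun h => by
    have := PC.cells_vertex_disjoint e (Or.inr he)
    exact (this ▸ (⟨hw, h⟩ : w ∈ e ∩ PC.vertices) : w ∈ (∅ : Set X))
  constructor
  · refine Finite.of_finite_image (f := Subtype.val) (hfin.subset ?_) Subtype.val_injective.injOn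
    rintro _ ⟨F, hF, rfl⟩
    obtain ⟨x, hx, hxF⟩ := Metric.mem_closure_iff.1 (show w ∈ closure (F : Set X) from hF) ε hε
    exact ⟨Or.inl F.2, x, hx, by rwa [mem_ball, dist_comm]⟩
  · have hv : ∀ᶠ x in 𝓝 w, x ∉ PC.vertices ∩ ball w ε :=
      hvfin.isClosed.isOpen_compl.mem_nhds fun h => hwv h.1
    have hc : ∀ᶠ x in 𝓝 w, ∀ c ∈ {c | (c ∈ PC.faces ∨ c ∈ PC.edges) ∧ (c ∩ ball w ε).Nonempty},
        w ∉ closure c → x ∉ closure c := by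
      rw [eventually_all_finite hfin]
      intro c _
      by_cases h : w ∈ closure c
      · exact Eventually.of_forall fun x hx => absurd h hx
      · filter_upwards [isClosed_closure.isOpen_compl.mem_nhds h] with x hx _
        exact hx
    obtain ⟨r, hr, hrx⟩ := Metric.eventually_nhds_iff.1 ((hv.and hc).and (ball_mem_nhds w hε))
    refine ⟨r, hr, fun x hx => ?_⟩
    obtain ⟨⟨hxv, hxc⟩, hxε⟩ := hrx (by rwa [dist_comm])
    rcases (by rw [PC.cover]; trivial : x ∈ ⋃₀ PC.faces ∪ ⋃₀ PC.edges ∪ PC.vertices) with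
      (⟨F, hF, hxF⟩ | ⟨e', he', hxe'⟩) | hx'
    · refine Or.inr ⟨⟨F, hF⟩, hxF, ?_⟩
      by_contra hcon
      exact hxc F ⟨Or.inl hF, x, hxF, hxε⟩ hcon (subset_closure hxF)
    · left
      by_cases hee : e' = e
      · rwa [← hee]
      exfalso
      refine hxc e' ⟨Or.inr he', x, hxe', hxε⟩ (fun hcl => ?_) (subset_closure hxe')
      by_cases hwe' : w ∈ e'
      · have := PC.cells_disjoint e' (Or.inr he') e (Or.inr he) hee
        exact (this ▸ (⟨hwe', hw⟩ : w ∈ e' ∩ e) : w ∈ (∅ : Set X))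
      · exact hwv (PC.edge_closure e' he' ⟨hcl, hwe'⟩)
    · exact absurd ⟨hx', hxε⟩ hxv

end PolyComplex2

variable {κ : ℝ} {X : Type*} [MetricSpace X] {PC : PolyComplex2 κ X}

/-- A half disc chart of a face along an edge. -/
structure EdgePage (ch : Charts PC) (e : Set X) (b : X → ℝ) (w : X) (r : ℝ) (F : PC.faces) where
  c : FaceChart (F : Set X)
  a : ℂ
  a_ne : a ≠ 0
  rel : ∀ x, c.toFun x = a * ((ch F).toFun x - (ch F).toFun w)
  δ : ℝ
  δ_pos : 0 < δ
  mem_K : ∀ z : ℂ, ‖z‖ < δ → 0 ≤ z.im → z ∈ c.K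
  im_pos : ∀ x ∈ (F : Set X), 0 < (c.toFun x).im
  norm_lt : ∀ x ∈ closure (F : Set X), dist w x < r → ‖c.toFun x‖ < δ
  inv_mem_edge : ∀ u : ℝ, |u| < δ → c.inv u ∈ e
  edge_subset : ∀ x ∈ e, dist w x < r → x ∈ closure (F : Set X)
  mono : StrictMonoOn (fun u : ℝ => b (c.inv u)) (Ioo (-δ) δ) ∨
    StrictAntiOn (fun u : ℝ => b (c.inv u)) (Ioo (-δ) δ)

/-- A page remains a page for a smaller radius. -/
def EdgePage.shrink {ch : Charts PC} {e : Set X} {b : X → ℝ} {w : X} {r r' : ℝ} {F : PC.faces}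
    (P : EdgePage ch e b w r F) (h : r' ≤ r) : EdgePage ch e b w r' F :=
  { P with
    norm_lt := fun x hx hd => P.norm_lt x hx (hd.trans_le h)
    edge_subset := fun x hx hd => P.edge_subset x hx (hd.trans_le h) }

theorem exists_edgePage (ch : Charts PC) {e : Set X} (he : e ∈ PC.edges) {w : X} (hw : w ∈ e)
    {b : X → ℝ} {r₀ : ℝ} (hr₀ : 0 < r₀) (hb : IsEdgeCoord e w r₀ b)
    (hcover : ∀ x, dist w x < r₀ → x ∈ e ∨ ∃ F : PC.faces, x ∈ (F : Set X) ∧ w ∈ closure (F : Set X))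
    (F : PC.faces) (hwF : w ∈ closure (F : Set X)) :
    ∃ r > 0, Nonempty (EdgePage ch e b w r F) := by
  have hdisj : ∀ x ∈ e, x ∉ (F : Set X) := fun x hx hxF =>
    (PC.disjoint_edge_face he F.2 (ch F) ▸ (⟨hx, hxF⟩ : x ∈ e ∩ F) : x ∈ (∅ : Set X))
  have hedge : ∀ x ∈ closure (F : Set X), x ∉ (F : Set X) → dist w x < r₀ → x ∈ e := by
    intro x hx hxF hd
    rcases hcover x hd with h | ⟨F', hxF', -⟩
    · exact h
    · obtain ⟨y, hy, hyF⟩ := mem_closure_iff.1 hx _ (PC.faces_open F' F'.2) hxF'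
      rw [PC.face_eq_of_mem hy hyF] at hxF'
      exact absurd hxF' hxF
  obtain ⟨g, hg⟩ := geometric_hahn_banach_open_point (ch F).convex.interior isOpen_interior
    (x := (ch F).toFun w) (by rw [(ch F).mem_interior_iff w hwF]; exact hdisj w hw)
  have hgz : ∀ z : ℂ, g z = z.re * g 1 + z.im * g Complex.I := by
    intro z
    conv_lhs => rw [← Complex.re_add_im z, map_add, ← mul_one (z.re : ℂ), ← Complex.real_smul,
      ← Complex.real_smul, map_smul, map_smul, smul_eq_mul, smul_eq_mul]
  set a : ℂ := ⟨-g Complex.I, -g 1⟩ with ha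
  have hag : ∀ z : ℂ, (a * z).im = - g z := fun z => by
    rw [hgz]; simp [ha]; ring
  have ha0 : a ≠ 0 := by
    intro h
    obtain ⟨z, hz⟩ := (ch F).interior_nonempty
    have := hg z hz
    have h1 := hag z
    have h2 := hag ((ch F).toFun w)
    rw [h, zero_mul, Complex.zero_im] at h1 h2
    linarith
  set c := (ch F).normalize ((ch F).toFun w) ha0 with hc
  have hrel : ∀ x, c.toFun x = a * ((ch F).toFun x - (ch F).toFun w) := fun x => rfl
  have hcw : c.toFun w = 0 := by rw [hrel, sub_self, mul_zero]
  have hpos : ∀ x ∈ (F : Set X), 0 < (c.toFun x).im := by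
    intro x hx
    rw [hrel, hag, map_sub]
    linarith [hg _ ((ch F).map_mem_interior hx)]
  have h0K : (0 : ℂ) ∈ c.K := hcw ▸ c.map_mem w hwF
  have hinv0 : c.inv 0 = w := by rw [← hcw, c.left_inv w hwF]
  obtain ⟨ε, hε, hεw⟩ := Metric.continuousOn_iff.1 c.continuousOn_inv 0 h0K r₀ hr₀
  have hεw' : ∀ z ∈ c.K, ‖z‖ < ε → dist w (c.inv z) < r₀ := fun z hz hzε => by
    have := hεw z hz (by rwa [dist_zero_right])
    rwa [hinv0, dist_comm] at this
  have hbd : ∀ z ∈ c.K, z ∉ interior c.K → ‖z‖ < ε → c.inv z ∈ e := by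
    intro z hz hzi hzε
    refine hedge _ (c.inv_mem z hz) ?_ (hεw' z hz hzε)
    rwa [← c.mem_interior_iff _ (c.inv_mem z hz), c.right_inv z hz]
  obtain ⟨δ₀, hδ₀, hhalf⟩ := exists_halfDisc_subset c.isCompact.isClosed c.convex h0K
    c.interior_nonempty (fun z hz => by
      have := hpos _ (c.inv_mem_face hz)
      rwa [c.right_inv z (interior_subset hz)] at this) hε (by
      intro f hf g hg hfi hgi hfε hgε
      have := c.cross_eq_zero hwF (c.inv_mem f hf) (c.inv_mem g hg)
        (PC.btw_of_mem_edge he hw (hbd f hf hfi hfε) (hbd g hg hgi hgε))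
      rwa [c.right_inv f hf, c.right_inv g hg, hcw, sub_zero, sub_zero] at this)
  set δ := min δ₀ ε / 2 with hδdef
  have hmin : 0 < min δ₀ ε := lt_min hδ₀ hε
  have hδ : 0 < δ := by positivity
  have hδ1 : δ < δ₀ := by linarith [min_le_left δ₀ ε]
  have hδ2 : δ < ε := by linarith [min_le_right δ₀ ε]
  have hrealK : ∀ u : ℝ, |u| ≤ δ → (u : ℂ) ∈ c.K := fun u hu =>
    hhalf u (by rw [Complex.norm_real]; exact lt_of_le_of_lt hu hδ1) (by simp)
  have hreal : ∀ u : ℝ, |u| ≤ δ → c.inv u ∈ e ∧ dist w (c.inv u) < r₀ := by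
    intro u hu
    have hn : ‖(u : ℂ)‖ < ε := by rw [Complex.norm_real]; exact lt_of_le_of_lt hu hδ2
    refine ⟨hbd u (hrealK u hu) (fun hi => ?_) hn, hεw' u (hrealK u hu) hn⟩
    have := hpos _ (c.inv_mem_face hi)
    rw [c.right_inv _ (hrealK u hu), Complex.ofReal_im] at this
    exact lt_irrefl _ this
  set β : ℝ → ℝ := fun u => b (c.inv u) with hβ
  have hIcc : ∀ u ∈ Icc (-δ) δ, |u| ≤ δ := fun u hu => abs_le.2 hu
  have hβc : ContinuousOn β (Icc (-δ) δ) := by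
    refine hb.continuous.comp_continuousOn (c.continuousOn_inv.comp ?_ ?_)
    · exact Complex.continuous_ofReal.continuousOn
    · exact fun u hu => hrealK u (hIcc u hu)
  have hβi : InjOn β (Icc (-δ) δ) := by
    intro u hu v hv huv
    have h1 := hreal u (hIcc u hu)
    have h2 := hreal v (hIcc v hv)
    have h3 := hb.dist_eq _ h1.1 _ h2.1 h1.2 h2.2
    have h4 : b (c.inv u) = b (c.inv v) := huv
    rw [h4, sub_self, abs_zero, dist_eq_zero] at h3
    have h5 := congrArg c.toFun h3
    rw [c.right_inv _ (hrealK u (hIcc u hu)), c.right_inv _ (hrealK v (hIcc v hv))] at h5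
    exact_mod_cast h5
  have hmono := hβc.strictMonoOn_of_injOn_Icc' (by linarith) hβi
  have hβ0 : β 0 = 0 := by simp only [hβ, Complex.ofReal_zero, hinv0, hb.map_base]
  have h0mem : (0 : ℝ) ∈ Icc (-δ) δ := ⟨by linarith, hδ.le⟩
  have hlmem : -δ ∈ Icc (-δ) δ := ⟨le_rfl, by linarith⟩
  have hrmem : δ ∈ Icc (-δ) δ := ⟨by linarith, le_rfl⟩
  obtain ⟨r₁, hr₁, hr₁β⟩ : ∃ r₁ > 0, Ioo (-r₁) r₁ ⊆ β '' Icc (-δ) δ := by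
    rcases hmono with h | h
    · have hl := h hlmem h0mem (by linarith : -δ < 0)
      have hr := h h0mem hrmem hδ
      rw [hβ0] at hl hr
      refine ⟨min (-β (-δ)) (β δ), lt_min (by linarith) hr, ?_⟩
      refine Subset.trans ?_ (intermediate_value_Icc (by linarith) hβc)
      intro s hs
      exact ⟨by linarith [hs.1, min_le_left (-β (-δ)) (β δ)],
        by linarith [hs.2, min_le_right (-β (-δ)) (β δ)]⟩
    · have hl := h hlmem h0mem (by linarith : -δ < 0)
      have hr := h h0mem hrmem hδ
      rw [hβ0] at hl hr
      refine ⟨min (-β δ) (β (-δ)), lt_min (by linarith) hl, ?_⟩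
      refine Subset.trans ?_ (intermediate_value_Icc' (by linarith) hβc)
      intro s hs
      exact ⟨by linarith [hs.1, min_le_left (-β δ) (β (-δ))],
        by linarith [hs.2, min_le_right (-β δ) (β (-δ))]⟩
  obtain ⟨r₂, hr₂, hr₂w⟩ := Metric.continuousOn_iff.1 c.continuousOn w hwF δ hδ
  refine ⟨min r₀ (min r₁ r₂), lt_min hr₀ (lt_min hr₁ hr₂), ⟨?_⟩⟩
  exact
  { c := c
    a := a
    a_ne := ha0
    rel := hrel
    δ := δ
    δ_pos := hδ
    mem_K := fun z hz hz0 => hhalf z (hz.trans hδ1) hz0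
    im_pos := hpos
    norm_lt := fun x hx hd => by
      have := hr₂w x hx (by
        rw [dist_comm]; exact hd.trans_le ((min_le_right _ _).trans (min_le_right _ _)))
      rwa [hcw, dist_zero_right] at this
    inv_mem_edge := fun u hu => (hreal u hu.le).1
    edge_subset := fun x hx hd => by
      have hd0 : dist w x < r₀ := hd.trans_le (min_le_left _ _)
      have h1 := hb.dist_eq w hw x hx (by rwa [dist_self]) hd0
      rw [hb.map_base, zero_sub, abs_neg] at h1
      have h2 : |b x| < r₁ := h1 ▸ hd.trans_le ((min_le_right _ _).trans (min_le_left _ _))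
      obtain ⟨u, hu, hux⟩ := hr₁β (abs_lt.1 h2)
      have h3 := hreal u (hIcc u hu)
      have h4 := hb.dist_eq _ h3.1 x hx h3.2 hd0
      rw [show b (c.inv u) = b x from hux, sub_self, abs_zero, dist_eq_zero] at h4
      rw [← h4]
      exact c.inv_mem _ (hrealK u (hIcc u hu))
    mono := hmono.imp (fun h => h.mono Ioo_subset_Icc_self) fun h => h.mono Ioo_subset_Icc_self }

/-- A neighbourhood of a point of an open edge, with its coordinate and its pages. -/
structure EdgeNbhd (ch : Charts PC) (e : Set X) (w : X) where
  b : X → ℝ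
  r : ℝ
  r_pos : 0 < r
  mem : w ∈ e
  coord : IsEdgeCoord e w r b
  finite : {F : PC.faces | w ∈ closure (F : Set X)}.Finite
  cover : ∀ x, dist w x < r → x ∈ e ∨ ∃ F : PC.faces, x ∈ (F : Set X) ∧ w ∈ closure (F : Set X)
  notMem : ∀ F : PC.faces, ∀ x ∈ e, x ∉ (F : Set X)
  page : ∀ F : PC.faces, w ∈ closure (F : Set X) → EdgePage ch e b w r F

theorem IsEdgeCoord.mono {e : Set X} {w : X} {r r' : ℝ} {b : X → ℝ} (h : IsEdgeCoord e w r b)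
    (hr : r' ≤ r) : IsEdgeCoord e w r' b :=
  ⟨h.continuous, h.map_base, fun x hx y hy hdx hdy =>
    h.dist_eq x hx y hy (hdx.trans_le hr) (hdy.trans_le hr), fun s hs => h.exists_eq s (hs.trans_le hr)⟩

theorem exists_edgeNbhd (ch : Charts PC) {e : Set X} (he : e ∈ PC.edges) {w : X} (hw : w ∈ e)
    {ρ : ℝ} (hρ : 0 < ρ) : ∃ N : EdgeNbhd ch e w, N.r ≤ ρ := by
  obtain ⟨b, r₀, hr₀, hb⟩ := PC.exists_isEdgeCoord he hw
  obtain ⟨hfin, r₁, hr₁, hcover⟩ := PC.exists_ball_subset_of_mem_edge he hw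
  have hr : 0 < min r₀ r₁ := lt_min hr₀ hr₁
  have hcov := fun x (hx : dist w x < min r₀ r₁) => hcover x (hx.trans_le (min_le_right _ _))
  have hpage := exists_edgePage ch he hw hr (hb.mono (min_le_left _ _)) hcov
  choose! rF hrF hP using hpage
  obtain ⟨r₂, hr₂, hr₂F⟩ : ∃ r₂ > 0, ∀ F : PC.faces, w ∈ closure (F : Set X) → r₂ ≤ rF F := by
    have : ∀ᶠ s : ℝ in 𝓝[>] 0, ∀ F ∈ {F : PC.faces | w ∈ closure (F : Set X)}, s ≤ rF F := by
      rw [eventually_all_finite hfin]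
      intro F hF
      filter_upwards [Ioo_mem_nhdsGT (hrF F hF)] with s hs
      exact hs.2.le
    obtain ⟨s, hs, hs0⟩ := (this.and self_mem_nhdsWithin).exists
    exact ⟨s, hs0, hs⟩
  have h1 : min (min (min r₀ r₁) r₂) ρ ≤ min r₀ r₁ := (min_le_left _ _).trans (min_le_left _ _)
  have h2 : min (min (min r₀ r₁) r₂) ρ ≤ r₂ := (min_le_left _ _).trans (min_le_right _ _)
  refine ⟨{ b := b, r := min (min (min r₀ r₁) r₂) ρ, r_pos := lt_min (lt_min hr hr₂) hρ, mem := hw,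
            coord := hb.mono (h1.trans (min_le_left _ _)), finite := hfin,
            cover := fun x hx => hcov x (hx.trans_le h1), notMem := ?_,
            page := fun F hF => (hP F hF).some.shrink (h2.trans (hr₂F F hF)) }, min_le_right _ _⟩
  intro F x hx hxF
  exact (PC.disjoint_edge_face he F.2 (ch F) ▸ (⟨hx, hxF⟩ : x ∈ e ∩ F) : x ∈ (∅ : Set X))

end Cat2Cx

namespace Cat2Cx
open Topology

section
variable {X : Type*} [MetricSpace X] [CNSpace X]

theorem eq_of_ret_eq {w : X} {r : ℝ} (hr : 0 ≤ r) {x y : X} (h : ret w r x = y)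
    (hy : dist w y < r) : x = y := by
  have h3 := dist_ret w hr x
  rw [h] at h3
  rcases min_choice (dist w x) r with h' | h'
  · rw [← h, ret_eq_self]
    rw [← h']; exact min_le_right _ _
  · rw [h'] at h3; linarith

theorem FaceChart.isPreconnected_inter_ball {F : Set X} (c : FaceChart F) (w : X) (r : ℝ) :
    IsPreconnected (F ∩ ball w r) := by
  refine isPreconnected_of_forall_pair fun x hx y hy => ⟨gp x y '' Icc 0 1, ?_, ⟨0, by simp, by simp⟩,
    ⟨1, by simp, by simp⟩, isPreconnected_Icc.image _ (continuousOn_gp x y)⟩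
  rintro _ ⟨t, ht, rfl⟩
  refine ⟨?_, (btw_gp x y ht).mem_ball hx.2 hy.2⟩
  by_cases hne : gp x y t = y
  · rw [hne]; exact hy.1
  · exact c.mem_face_of_btw hx.1 (subset_closure hy.1) (btw_gp x y ht) hne

end

variable {κ : ℝ} {X : Type*} [MetricSpace X] {PC : PolyComplex2 κ X} {ch : Charts PC}
  {e : Set X} {w : X}

namespace EdgePage
variable {b : X → ℝ} {r : ℝ} {F : PC.faces} (P : EdgePage ch e b w r F)

theorem map_base : P.c.toFun w = 0 := by rw [P.rel, sub_self, mul_zero]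

theorem im_nonneg {x : X} (hx : x ∈ closure (F : Set X)) : 0 ≤ (P.c.toFun x).im := by
  have h := (P.c.continuousOn x hx).mono subset_closure
  have := mem_closure_iff_nhdsWithin_neBot.1 hx
  refine ge_of_tendsto (Complex.continuous_im.continuousAt.tendsto.comp h) ?_
  filter_upwards [self_mem_nhdsWithin] with y hy
  exact (P.im_pos y hy).le

theorem mem_interior_K {z : ℂ} (hz : ‖z‖ < P.δ) (h0 : 0 < z.im) : z ∈ interior P.c.K := by
  rw [mem_interior]
  refine ⟨{z | ‖z‖ < P.δ} ∩ {z | 0 < z.im}, fun z hz => P.mem_K z hz.1 (le_of_lt hz.2), ?_, hz, h0⟩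
  exact (isOpen_lt continuous_norm continuous_const).inter
    (isOpen_lt continuous_const Complex.continuous_im)

theorem inv_mem_face {z : ℂ} (hz : ‖z‖ < P.δ) (h0 : 0 < z.im) : P.c.inv z ∈ (F : Set X) :=
  P.c.inv_mem_face (P.mem_interior_K hz h0)

theorem mem_face_of_im_pos {x : X} (hx : x ∈ closure (F : Set X)) (hd : dist w x < r)
    (h0 : 0 < (P.c.toFun x).im) : x ∈ (F : Set X) := by
  rw [← P.c.mem_interior_iff x hx]
  exact P.mem_interior_K (P.norm_lt x hx hd) h0

theorem zero_mem_K : (0 : ℂ) ∈ P.c.K := P.mem_K 0 (by rw [norm_zero]; exact P.δ_pos) le_rfl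

theorem inv_zero (hw : w ∈ closure (F : Set X)) : P.c.inv 0 = w := by
  rw [← P.map_base, P.c.left_inv w hw]

theorem ofReal_mem_K {u : ℝ} (hu : |u| < P.δ) : (u : ℂ) ∈ P.c.K :=
  P.mem_K u (by rwa [Complex.norm_real]) (by simp)

theorem exists_forall_dist_inv_lt (hw : w ∈ closure (F : Set X)) {ρ : ℝ} (hρ : 0 < ρ) :
    ∃ ε > 0, ε ≤ P.δ ∧ ∀ z : ℂ, ‖z‖ < ε → 0 ≤ z.im → dist w (P.c.inv z) < ρ := by
  obtain ⟨ε, hε, h⟩ := Metric.continuousOn_iff.1 P.c.continuousOn_inv 0 P.zero_mem_K ρ hρ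
  refine ⟨min ε P.δ, lt_min hε P.δ_pos, min_le_right _ _, fun z hz h0 => ?_⟩
  have := h z (P.mem_K z (hz.trans_le (min_le_right _ _)) h0)
    (by rw [dist_zero_right]; exact hz.trans_le (min_le_left _ _))
  rwa [P.inv_zero hw, dist_comm] at this

/-- The coordinate on a page which restricts to the given coordinate on the edge. -/
noncomputable def coord (x : X) : ℂ := ⟨b (P.c.inv ((P.c.toFun x).re : ℂ)), (P.c.toFun x).im⟩

theorem abs_re_lt {x : X} (hx : x ∈ closure (F : Set X)) (hd : dist w x < r) :
    |(P.c.toFun x).re| < P.δ :=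
  (Complex.abs_re_le_norm _).trans_lt (P.norm_lt x hx hd)

theorem continuousOn_coord (hb : Continuous b) :
    ContinuousOn P.coord (closure (F : Set X) ∩ ball w r) := by
  have h1 : ContinuousOn P.c.toFun (closure (F : Set X) ∩ ball w r) :=
    P.c.continuousOn.mono inter_subset_left
  have h2 : ContinuousOn (fun x => b (P.c.inv ((P.c.toFun x).re : ℂ)))
      (closure (F : Set X) ∩ ball w r) := by
    refine hb.comp_continuousOn (P.c.continuousOn_inv.comp ?_ ?_)
    · exact (Complex.continuous_ofReal.comp Complex.continuous_re).comp_continuousOn h1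
    · exact fun x hx => P.ofReal_mem_K (P.abs_re_lt hx.1 (mem_ball'.1 hx.2))
  have h3 := (Complex.continuous_ofReal.comp_continuousOn h2).add
    ((Complex.continuous_ofReal.comp_continuousOn
      (Complex.continuous_im.comp_continuousOn h1)).mul (continuousOn_const (c := Complex.I)))
  refine h3.congr fun x _ => ?_
  exact (Complex.mk_eq_add_mul_I _ _)

theorem map_inv_eq_zero_iff (hb : b w = 0) (hw : w ∈ closure (F : Set X)) {u : ℝ} (hu : |u| < P.δ) :
    b (P.c.inv u) = 0 ↔ u = 0 := by
  have h0 : b (P.c.inv ((0 : ℝ) : ℂ)) = 0 := by rw [Complex.ofReal_zero, P.inv_zero hw, hb]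
  constructor
  · intro h
    have hinj : InjOn (fun u : ℝ => b (P.c.inv u)) (Ioo (-P.δ) P.δ) :=
      P.mono.elim (fun h => h.injOn) fun h => h.injOn
    exact hinj (abs_lt.1 hu) ⟨by linarith [P.δ_pos], P.δ_pos⟩ (h.trans h0.symm)
  · rintro rfl
    exact h0

end EdgePage

namespace EdgeNbhd
variable (N : EdgeNbhd ch e w)

theorem im_eq_zero {F : PC.faces} (hF : w ∈ closure (F : Set X)) {x : X} (hx : x ∈ e)
    (hd : dist w x < N.r) : ((N.page F hF).c.toFun x).im = 0 := by
  have hxF := (N.page F hF).edge_subset x hx hd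
  by_contra hne
  exact N.notMem F x hx ((N.page F hF).mem_face_of_im_pos hxF hd
    (lt_of_le_of_ne ((N.page F hF).im_nonneg hxF) (Ne.symm hne)))

theorem mem_edge_of_notMem_face {F : PC.faces} {x : X}
    (hx : x ∈ closure (F : Set X)) (hxF : x ∉ (F : Set X)) (hd : dist w x < N.r) : x ∈ e := by
  rcases N.cover x hd with h | ⟨F', hxF', -⟩
  · exact h
  · obtain ⟨y, hy, hyF⟩ := mem_closure_iff.1 hx _ (PC.faces_open F' F'.2) hxF'
    rw [PC.face_eq_of_mem hy hyF] at hxF'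
    exact absurd hxF' hxF

theorem coord_edge {F : PC.faces} (hF : w ∈ closure (F : Set X)) {x : X} (hx : x ∈ e)
    (hd : dist w x < N.r) : (N.page F hF).coord x = N.b x := by
  have h := N.im_eq_zero hF hx hd
  have h1 : (((N.page F hF).c.toFun x).re : ℂ) = (N.page F hF).c.toFun x :=
    Complex.ext (by simp) (by simp [h])
  rw [EdgePage.coord, h, h1, (N.page F hF).c.left_inv x ((N.page F hF).edge_subset x hx hd)]
  rfl

open Classical in
/-- The map of the neighbourhood to the plane which sends the pages in `A` to the lower half plane
and all other pages to the upper half plane. -/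
noncomputable def fold (A : Set PC.faces) (x : X) : ℂ :=
  if h : ∃ F : PC.faces, x ∈ (F : Set X) ∧ w ∈ closure (F : Set X) then
    if h.choose ∈ A then (starRingEnd ℂ) ((N.page h.choose h.choose_spec.2).coord x)
    else (N.page h.choose h.choose_spec.2).coord x
  else N.b x

open Classical in
theorem fold_face (A : Set PC.faces) {F : PC.faces} (hF : w ∈ closure (F : Set X)) {x : X}
    (hx : x ∈ (F : Set X)) : N.fold A x =
      if F ∈ A then (starRingEnd ℂ) ((N.page F hF).coord x) else (N.page F hF).coord x := by
  have key : ∀ (F' : PC.faces) (h' : x ∈ (F' : Set X) ∧ w ∈ closure (F' : Set X)),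
      (if F' ∈ A then (starRingEnd ℂ) ((N.page F' h'.2).coord x) else (N.page F' h'.2).coord x) =
      if F ∈ A then (starRingEnd ℂ) ((N.page F hF).coord x) else (N.page F hF).coord x := by
    rintro F' ⟨h1, h2⟩
    obtain rfl := PC.face_eq_of_mem h1 hx
    rfl
  have hex : ∃ F : PC.faces, x ∈ (F : Set X) ∧ w ∈ closure (F : Set X) := ⟨F, hx, hF⟩
  rw [fold, dif_pos hex]
  exact key _ hex.choose_spec

theorem fold_edge (A : Set PC.faces) {x : X} (hx : x ∈ e) : N.fold A x = N.b x := by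
  rw [fold, dif_neg]
  rintro ⟨F, h, -⟩
  exact N.notMem F x hx h

open Classical in
theorem fold_closure (A : Set PC.faces) {F : PC.faces} (hF : w ∈ closure (F : Set X)) {x : X}
    (hx : x ∈ closure (F : Set X)) (hd : dist w x < N.r) : N.fold A x =
      if F ∈ A then (starRingEnd ℂ) ((N.page F hF).coord x) else (N.page F hF).coord x := by
  by_cases hxF : x ∈ (F : Set X)
  · exact N.fold_face A hF hxF
  · have hxe := N.mem_edge_of_notMem_face hx hxF hd
    rw [N.fold_edge A hxe, N.coord_edge hF hxe hd, Complex.conj_ofReal, ite_self]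

theorem continuousOn_fold (A : Set PC.faces) : ContinuousOn (N.fold A) (ball w N.r) := by
  classical
  intro x hx
  have hsub : ball w N.r ⊆ (e ∩ ball w N.r) ∪
      ⋃ F ∈ {F : PC.faces | w ∈ closure (F : Set X)}, closure (F : Set X) ∩ ball w N.r := by
    intro y hy
    rcases N.cover y (mem_ball'.1 hy) with h | ⟨F, hyF, hF⟩
    · exact Or.inl ⟨h, hy⟩
    · exact Or.inr (mem_biUnion (x := F) hF ⟨subset_closure hyF, hy⟩)
  refine ContinuousWithinAt.mono ?_ hsub
  refine ContinuousWithinAt.union ?_ ?_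
  · by_cases hxe : x ∈ e
    · have : ContinuousWithinAt (fun y => (N.b y : ℂ)) (e ∩ ball w N.r) x :=
        (Complex.continuous_ofReal.comp N.coord.continuous).continuousWithinAt
      exact this.congr (fun y hy => N.fold_edge A hy.1) (N.fold_edge A hxe)
    · refine continuousWithinAt_of_notMem_closure fun hcl => ?_
      obtain ⟨F, hxF, -⟩ := (N.cover x (mem_ball'.1 hx)).resolve_left hxe
      obtain ⟨y, hyF, hy⟩ := mem_closure_iff.1 hcl _ (PC.faces_open F F.2) hxF
      exact N.notMem F y hy.1 hyF
  · rw [ContinuousWithinAt, nhdsWithin_biUnion N.finite, tendsto_iSup]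
    intro F
    rw [tendsto_iSup]
    intro hF
    change ContinuousWithinAt (N.fold A) (closure (F : Set X) ∩ ball w N.r) x
    by_cases hxF : x ∈ closure (F : Set X)
    · have hc := (N.page F hF).continuousOn_coord N.coord.continuous x ⟨hxF, hx⟩
      have : ContinuousWithinAt (fun y => if F ∈ A then (starRingEnd ℂ) ((N.page F hF).coord y)
          else (N.page F hF).coord y) (closure (F : Set X) ∩ ball w N.r) x := by
        by_cases hFA : F ∈ A
        · simp only [if_pos hFA]
          exact Complex.continuous_conj.continuousAt.comp_continuousWithinAt hc
        · simpa only [if_neg hFA] using hc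
      exact this.congr (fun y hy => N.fold_closure A hF hy.1 (mem_ball'.1 hy.2))
        (N.fold_closure A hF hxF (mem_ball'.1 hx))
    · refine continuousWithinAt_of_notMem_closure fun hcl => hxF ?_
      exact closure_minimal inter_subset_left isClosed_closure hcl

open Classical in
theorem fold_cases (F : PC.faces) {x : X} (hd : dist w x < N.r) :
    N.fold {F} x = if x ∈ (F : Set X) then N.fold univ x else N.fold ∅ x := by
  rcases N.cover x hd with hx | ⟨F', hx, hF'⟩
  · rw [N.fold_edge _ hx, N.fold_edge _ hx, N.fold_edge _ hx, ite_self]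
  · rw [N.fold_face _ hF' hx, N.fold_face _ hF' hx, N.fold_face _ hF' hx]
    by_cases h : F' = F
    · subst h
      simp [hx]
    · have : x ∉ (F : Set X) := fun hxF => h (PC.face_eq_of_mem hx hxF)
      simp [h, this]

theorem fold_univ {x : X} (hd : dist w x < N.r) :
    N.fold univ x = (starRingEnd ℂ) (N.fold ∅ x) := by
  rcases N.cover x hd with hx | ⟨F', hx, hF'⟩
  · rw [N.fold_edge _ hx, N.fold_edge _ hx, Complex.conj_ofReal]
  · rw [N.fold_face _ hF' hx, N.fold_face _ hF' hx]
    simp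

theorem im_fold_empty_nonneg {x : X} (hd : dist w x < N.r) : 0 ≤ (N.fold ∅ x).im := by
  rcases N.cover x hd with hx | ⟨F', hx, hF'⟩
  · rw [N.fold_edge _ hx, Complex.ofReal_im]
  · rw [N.fold_face _ hF' hx, if_neg (notMem_empty _)]
    exact ((N.page F' hF').im_pos x hx).le

theorem eq_of_coord_eq {F : PC.faces} (hF : w ∈ closure (F : Set X)) {x : X}
    (hx : x ∈ closure (F : Set X)) (hd : dist w x < N.r) {ε : ℝ}
    (h : (N.page F hF).coord x = Complex.I * ε) : x = (N.page F hF).c.inv (Complex.I * ε) := by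
  have hre := congrArg Complex.re h
  have him := congrArg Complex.im h
  simp [EdgePage.coord] at hre him
  rw [(N.page F hF).map_inv_eq_zero_iff N.coord.map_base hF
    ((N.page F hF).abs_re_lt hx hd)] at hre
  have : (N.page F hF).c.toFun x = Complex.I * ε := Complex.ext (by simp [hre]) (by simp [him])
  rw [← this, (N.page F hF).c.left_inv x hx]

theorem fold_empty_eq_zero {x : X} (hd : dist w x < N.r) (h : N.fold ∅ x = 0) : x = w := by
  rcases N.cover x hd with hx | ⟨F, hx, hF⟩
  · rw [N.fold_edge _ hx, Complex.ofReal_eq_zero] at h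
    have := N.coord.dist_eq x hx w N.mem hd (by rw [dist_self]; exact N.r_pos)
    rw [h, N.coord.map_base, sub_zero, abs_zero, dist_eq_zero] at this
    exact this
  · rw [N.fold_face _ hF hx, if_neg (notMem_empty _)] at h
    rw [N.eq_of_coord_eq hF (subset_closure hx) hd (ε := 0) (by simpa using h)]
    simpa using (N.page F hF).inv_zero hF

theorem half_nonneg : 0 ≤ N.r / 2 := by linarith [N.r_pos]

variable [CNSpace X]

/-- The folding map precomposed with a retraction to a smaller ball. -/
noncomputable def foldRet (A : Set PC.faces) (x : X) : ℂ := N.fold A (ret w (N.r / 2) x)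

theorem dist_ret_lt (x : X) : dist w (ret w (N.r / 2) x) < N.r := by
  rw [dist_ret w N.half_nonneg]
  exact (min_le_right _ _).trans_lt (by linarith [N.r_pos])

theorem continuous_foldRet (A : Set PC.faces) : Continuous (N.foldRet A) :=
  (N.continuousOn_fold A).comp_continuous (continuous_ret w N.half_nonneg)
    fun x => mem_ball'.2 (N.dist_ret_lt x)

theorem foldRet_empty_add_ne (x : X) {ε : ℝ} (hε : 0 < ε) :
    N.foldRet ∅ x + Complex.I * ε ≠ 0 := by
  intro h
  have him := congrArg Complex.im h
  have := N.im_fold_empty_nonneg (N.dist_ret_lt x)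
  simp [foldRet] at him
  linarith

theorem foldRet_univ_sub_ne (x : X) {ε : ℝ} (hε : 0 < ε) :
    N.foldRet univ x - Complex.I * ε ≠ 0 := by
  intro h
  have him := congrArg Complex.im h
  have := N.im_fold_empty_nonneg (N.dist_ret_lt x)
  rw [foldRet, N.fold_univ (N.dist_ret_lt x)] at him
  simp at him
  linarith

theorem foldRet_univ_eq_zero {x : X} (h : N.foldRet univ x = 0) : x = w := by
  rw [foldRet, N.fold_univ (N.dist_ret_lt x), map_eq_zero] at h
  exact eq_of_ret_eq N.half_nonneg (N.fold_empty_eq_zero (N.dist_ret_lt x) h)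
    (by rw [dist_self]; linarith [N.r_pos])

theorem foldRet_singleton_add_ne {F : PC.faces} {x : X} {ε : ℝ} (hε : 0 < ε)
    (h : N.foldRet univ x + Complex.I * ε ≠ 0) : N.foldRet {F} x + Complex.I * ε ≠ 0 := by
  rw [foldRet, N.fold_cases F (N.dist_ret_lt x)]
  split_ifs
  · exact h
  · exact N.foldRet_empty_add_ne x hε

theorem sum_wind_eq {γ : ℝ → X} (hγ : IsLoop γ) {ε : ℝ} (hε : 0 < ε)
    (h : ∀ t, N.foldRet univ (γ t) + Complex.I * ε ≠ 0) :
    ∑ F ∈ N.finite.toFinset, wind (fun t => N.foldRet {F} (γ t) + Complex.I * ε) =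
      wind (fun t => N.foldRet univ (γ t) + Complex.I * ε) := by
  classical
  have hc : ∀ A, Continuous fun t => N.foldRet A (γ t) + Complex.I * ε := fun A =>
    ((N.continuous_foldRet A).comp hγ.continuous).add continuous_const
  have h0 : wind (fun t => N.foldRet ∅ (γ t) + Complex.I * ε) = 0 :=
    wind_comp_eq_zero (h := fun x => N.foldRet ∅ x + Complex.I * ε)
      ((N.continuous_foldRet ∅).add continuous_const) (fun x => N.foldRet_empty_add_ne x hε) hγ
  have hne0 : ∀ t, N.foldRet ∅ (γ t) + Complex.I * ε ≠ 0 := fun t => N.foldRet_empty_add_ne _ hε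
  have hne : ∀ F : PC.faces, ∀ t, N.foldRet {F} (γ t) + Complex.I * ε ≠ 0 := fun F t =>
    N.foldRet_singleton_add_ne hε (h t)
  have hprod : ∀ x, (∏ F ∈ N.finite.toFinset, (N.foldRet {F} x + Complex.I * ε)) *
      (N.foldRet ∅ x + Complex.I * ε) = (N.foldRet univ x + Complex.I * ε) *
        ∏ _F ∈ N.finite.toFinset, (N.foldRet ∅ x + Complex.I * ε) := by
    intro x
    have hd := N.dist_ret_lt x
    rcases N.cover _ hd with hx | ⟨F, hx, hF⟩
    · simp only [foldRet, N.fold_edge _ hx]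
      ring
    · have hmem : F ∈ N.finite.toFinset := by simpa using hF
      rw [← Finset.mul_prod_erase _ _ hmem, ← Finset.mul_prod_erase _ _ hmem]
      have h1 : N.foldRet {F} x = N.foldRet univ x := by
        rw [foldRet, N.fold_cases F hd, if_pos hx, foldRet]
      have h2 : ∏ F' ∈ N.finite.toFinset.erase F, (N.foldRet {F'} x + Complex.I * ε) =
          ∏ F' ∈ N.finite.toFinset.erase F, (N.foldRet ∅ x + Complex.I * ε) := by
        refine Finset.prod_congr rfl fun F' hF' => ?_
        rw [foldRet, N.fold_cases F' hd, if_neg, foldRet]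
        exact fun hx' => Finset.ne_of_mem_erase hF' (PC.face_eq_of_mem hx' hx)
      rw [h1, h2]
      ring
  have hw := wind_mul (c := fun t => ∏ F ∈ N.finite.toFinset, (N.foldRet {F} (γ t) + Complex.I * ε))
    (c' := fun t => N.foldRet ∅ (γ t) + Complex.I * ε)
    (continuous_finsetProd _ fun F _ => hc {F})
    (fun t => Finset.prod_ne_zero_iff.2 fun F _ => hne F t) (hc ∅) hne0
  simp only [hprod] at hw
  rw [wind_mul (hc univ) h (continuous_finsetProd _ fun F _ => hc ∅)
    (fun t => Finset.prod_ne_zero_iff.2 fun F _ => hne0 t),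
    wind_prod _ (fun F _ => hc ∅) (fun F _ => hne0), wind_prod _ (fun F _ => hc {F})
    (fun F _ => hne F), h0] at hw
  simpa using hw.symm

end EdgeNbhd
end Cat2Cx

namespace Cat2Cx
open Topology

theorem wind_const_mul {c : ℝ → ℂ} (hc : Continuous c) (h0 : ∀ t, c t ≠ 0) {a : ℂ} (ha : a ≠ 0) :
    wind (fun t => a * c t) = wind c := by
  rw [wind_mul continuous_const (fun _ => ha) hc h0, wind_const ha, zero_add]

theorem div_mem_slitPlane_of_mul_pos {B u v : ℝ} (hB : u ≠ 0 → 0 < B * u)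
    (hne : (⟨u, v⟩ : ℂ) ≠ 0) : (⟨B, v⟩ : ℂ) / ⟨u, v⟩ ∈ Complex.slitPlane := by
  left
  rw [Complex.div_re, ← add_div]
  refine div_pos ?_ (Complex.normSq_pos.2 hne)
  by_cases hu : u = 0
  · have hv : v ≠ 0 := fun hv => hne (by rw [hu, hv]; rfl)
    have := mul_self_pos.2 hv
    simpa [hu] using this
  · have := hB hu
    have := mul_self_nonneg v
    simp only
    linarith

variable {κ : ℝ} {X : Type*} [MetricSpace X] {PC : PolyComplex2 κ X} {ch : Charts PC}
  {e : Set X} {w : X}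

namespace EdgeNbhd
variable (N : EdgeNbhd ch e w) {F : PC.faces} (hF : w ∈ closure (F : Set X))

theorem coord_inv {ε : ℝ} (hε : 0 < ε) (hεδ : ε < (N.page F hF).δ) :
    (N.page F hF).coord ((N.page F hF).c.inv (Complex.I * ε)) = Complex.I * ε := by
  have hK : Complex.I * ε ∈ (N.page F hF).c.K :=
    (N.page F hF).mem_K _ (by simpa [abs_of_pos hε] using hεδ) (by simpa using hε.le)
  rw [EdgePage.coord, (N.page F hF).c.right_inv _ hK]
  refine Complex.ext ?_ (by simp)
  simp [(N.page F hF).inv_zero hF, N.coord.map_base]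

/-- Points on all pages sufficiently close to the base point. -/
theorem eventually_page {ρ : ℝ} (hρ : 0 < ρ) : ∀ᶠ ε in 𝓝[>] (0 : ℝ), ∀ F : PC.faces,
    ∀ hF : w ∈ closure (F : Set X), ε < (N.page F hF).δ ∧
      dist w ((N.page F hF).c.inv (Complex.I * ε)) < ρ := by
  have h : ∀ F ∈ {F : PC.faces | w ∈ closure (F : Set X)}, ∀ᶠ ε in 𝓝[>] (0 : ℝ),
      ∀ hF : w ∈ closure (F : Set X), ε < (N.page F hF).δ ∧
      dist w ((N.page F hF).c.inv (Complex.I * ε)) < ρ := by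
    intro F hF
    obtain ⟨ε₀, hε₀, hle, h⟩ := (N.page F hF).exists_forall_dist_inv_lt hF hρ
    filter_upwards [Ioo_mem_nhdsGT hε₀] with ε hε hF'
    exact ⟨hε.2.trans_le hle, h _ (by simpa [abs_of_pos hε.1] using hε.2) (by simpa using hε.1.le)⟩
  filter_upwards [(eventually_all_finite N.finite).2 h] with ε hε F hF
  exact hε F hF hF

variable [CNSpace X]

theorem foldRet_singleton_eq_conj {x : X} (hx : x ∈ (F : Set X)) (hd : dist w x < N.r / 2) :
    N.foldRet {F} x = (starRingEnd ℂ) ((N.page F hF).coord x) := by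
  rw [foldRet, ret_eq_self hd.le, N.fold_face _ hF hx, if_pos (mem_singleton F)]

theorem foldRet_singleton_add_eq_zero_iff {ε : ℝ} (hε : 0 < ε) (hεδ : ε < (N.page F hF).δ)
    (hd : dist w ((N.page F hF).c.inv (Complex.I * ε)) < N.r / 2) (x : X) :
    N.foldRet {F} x + Complex.I * ε = 0 ↔ x = (N.page F hF).c.inv (Complex.I * ε) := by
  classical
  constructor
  · intro h
    refine eq_of_ret_eq N.half_nonneg ?_ hd
    by_cases hx : ret w (N.r / 2) x ∈ (F : Set X)
    · refine N.eq_of_coord_eq hF (subset_closure hx) (N.dist_ret_lt x) ?_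
      rw [foldRet, N.fold_face _ hF hx, if_pos (mem_singleton F)] at h
      have := congrArg (starRingEnd ℂ) h
      simp at this
      linear_combination this
    · have := N.foldRet_empty_add_ne x hε
      rw [foldRet, N.fold_cases F (N.dist_ret_lt x), if_neg hx] at h
      exact absurd h this
  · rintro rfl
    rw [N.foldRet_singleton_eq_conj hF ((N.page F hF).inv_mem_face
      (by simpa [abs_of_pos hε] using hεδ) (by simpa using hε)) hd, N.coord_inv hF hε hεδ]
    simp

theorem page_mem_encl_iff {γ : ℝ → X} (hγ : IsLoop γ) {ε : ℝ} (hε : 0 < ε)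
    (hεδ : ε < (N.page F hF).δ)
    (hd : dist w ((N.page F hF).c.inv (Complex.I * ε)) < N.r / 2)
    (h : ∀ t, N.foldRet univ (γ t) + Complex.I * ε ≠ 0) :
    (N.page F hF).c.inv (Complex.I * ε) ∈ encl ch γ ↔
      wind (fun t => N.foldRet {F} (γ t) + Complex.I * ε) ≠ 0 := by
  set P := N.page F hF with hP
  set y := P.c.inv (Complex.I * ε) with hy
  have hKε : ‖Complex.I * ε‖ < P.δ := by simpa [abs_of_pos hε] using hεδ
  have hyF : y ∈ (F : Set X) := P.inv_mem_face hKε (by simpa using hε)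
  have hzero := N.foldRet_singleton_add_eq_zero_iff hF hε hεδ hd
  have hne : ∀ t, N.foldRet {F} (γ t) + Complex.I * ε ≠ 0 := fun t =>
    N.foldRet_singleton_add_ne hε (h t)
  have hyγ : y ∉ range γ := by
    rintro ⟨t, ht⟩
    exact hne t ((hzero _).2 ht)
  have hHc : Continuous fun x => N.foldRet {F} x + Complex.I * ε :=
    (N.continuous_foldRet {F}).add continuous_const
  have hcγ : Continuous fun t => N.foldRet {F} (γ t) + Complex.I * ε := hHc.comp hγ.continuous
  have hφy : P.c.toFun y = Complex.I * ε := P.c.right_inv _ (P.mem_K _ hKε (by simpa using hε.le))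
  have hnear : ∀ᶠ x in 𝓝 y, x ∈ (F : Set X) ∧ dist w x < N.r / 2 :=
    Eventually.and ((PC.faces_open F F.2).mem_nhds hyF)
      ((isOpen_lt (by fun_prop) continuous_const).mem_nhds hd)
  have hδ0 : (0 : ℝ) ∈ Ioo (-P.δ) P.δ := ⟨by linarith [P.δ_pos], P.δ_pos⟩
  have hB0 : N.b (P.c.inv ((0 : ℝ) : ℂ)) = 0 := by
    rw [Complex.ofReal_zero, P.inv_zero hF, N.coord.map_base]
  -- the two coordinates near `y`
  have hquot : ∀ x ∈ (F : Set X), dist w x < N.r / 2 → x ≠ y →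
      (ch F).toFun x - (ch F).toFun y =
        P.a⁻¹ * ⟨(P.c.toFun x).re, (P.c.toFun x).im - ε⟩ ∧
      N.foldRet {F} x + Complex.I * ε =
        ⟨N.b (P.c.inv ((P.c.toFun x).re : ℂ)), -((P.c.toFun x).im - ε)⟩ ∧
      (⟨(P.c.toFun x).re, (P.c.toFun x).im - ε⟩ : ℂ) ≠ 0 ∧
      (P.c.toFun x).re ∈ Ioo (-P.δ) P.δ := by
    intro x hx hdx hxy
    have e1 : (⟨(P.c.toFun x).re, (P.c.toFun x).im - ε⟩ : ℂ) = P.c.toFun x - P.c.toFun y := by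
      rw [hφy]; exact Complex.ext (by simp) (by simp)
    refine ⟨?_, ?_, ?_, abs_lt.1 (P.abs_re_lt (subset_closure hx) (by linarith [N.r_pos]))⟩
    · rw [e1, P.rel x, P.rel y]
      field_simp [P.a_ne]
      ring
    · rw [N.foldRet_singleton_eq_conj hF hx hdx]
      refine Complex.ext (by simp [EdgePage.coord, hP]) (by simp [EdgePage.coord, hP]; ring)
    · rw [e1, sub_ne_zero]
      exact fun h => hxy (P.c.injOn (subset_closure hx) (subset_closure hyF) h)
  rcases P.mono with hm | hm
  · rw [mem_encl_iff hγ hyF hyγ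
      (h := fun x => P.a⁻¹ * (starRingEnd ℂ) (N.foldRet {F} x + Complex.I * ε))
      (continuous_const.mul (Complex.continuous_conj.comp hHc))
      (fun x => by
        rw [mul_eq_zero, or_iff_right (inv_ne_zero P.a_ne), map_eq_zero, hzero x]) ?_,
      wind_const_mul (c := fun t => (starRingEnd ℂ) (N.foldRet {F} (γ t) + Complex.I * ε))
        (Complex.continuous_conj.comp hcγ) (fun t => (map_ne_zero _).2 (hne t))
        (inv_ne_zero P.a_ne), wind_conj hcγ hne, Ne, map_eq_zero]
    · filter_upwards [hnear] with x hx hxy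
      obtain ⟨e1, e2, e3, e4⟩ := hquot x hx.1 hx.2 hxy
      rw [e1, e2, mul_div_mul_left _ _ (inv_ne_zero P.a_ne)]
      have e5 : (starRingEnd ℂ) (⟨N.b (P.c.inv ((P.c.toFun x).re : ℂ)),
          -((P.c.toFun x).im - ε)⟩ : ℂ) =
          ⟨N.b (P.c.inv ((P.c.toFun x).re : ℂ)), (P.c.toFun x).im - ε⟩ :=
        Complex.ext (by simp) (by simp)
      rw [e5]
      have hpos : (P.c.toFun x).re ≠ 0 →
          0 < N.b (P.c.inv ((P.c.toFun x).re : ℂ)) * (P.c.toFun x).re := by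
        intro hu
        rcases lt_or_gt_of_ne hu with hu | hu
        · have := hm e4 hδ0 hu
          simp only [hB0] at this
          exact mul_pos_of_neg_of_neg this hu
        · have := hm hδ0 e4 hu
          simp only [hB0] at this
          exact mul_pos this hu
      exact div_mem_slitPlane_of_mul_pos hpos e3
  · rw [mem_encl_iff hγ hyF hyγ
      (h := fun x => -P.a⁻¹ * (N.foldRet {F} x + Complex.I * ε))
      (continuous_const.mul hHc)
      (fun x => by
        rw [mul_eq_zero, or_iff_right (neg_ne_zero.2 (inv_ne_zero P.a_ne)), hzero x]) ?_,
      wind_const_mul hcγ hne (neg_ne_zero.2 (inv_ne_zero P.a_ne))]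
    · filter_upwards [hnear] with x hx hxy
      obtain ⟨e1, e2, e3, e4⟩ := hquot x hx.1 hx.2 hxy
      have e5 : -P.a⁻¹ * (⟨N.b (P.c.inv ((P.c.toFun x).re : ℂ)),
          -((P.c.toFun x).im - ε)⟩ : ℂ) =
          P.a⁻¹ * ⟨-N.b (P.c.inv ((P.c.toFun x).re : ℂ)), (P.c.toFun x).im - ε⟩ := by
        rw [neg_mul, ← mul_neg]
        congr 1
        exact Complex.ext (by simp) (by simp)
      rw [e1, e2, e5, mul_div_mul_left _ _ (inv_ne_zero P.a_ne)]
      have hpos : (P.c.toFun x).re ≠ 0 →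
          0 < -N.b (P.c.inv ((P.c.toFun x).re : ℂ)) * (P.c.toFun x).re := by
        intro hu
        rcases lt_or_gt_of_ne hu with hu | hu
        · have := hm e4 hδ0 hu
          simp only [hB0] at this
          exact mul_pos_of_neg_of_neg (by linarith) hu
        · have := hm hδ0 e4 hu
          simp only [hB0] at this
          exact mul_pos (by linarith) hu
      exact div_mem_slitPlane_of_mul_pos hpos e3

end EdgeNbhd
end Cat2Cx

namespace Cat2Cx
open Topology

theorem eventually_wind_add_eq {c : ℝ → ℂ} (hc : IsLoop c) (h0 : ∀ t, c t ≠ 0) :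
    ∀ᶠ a : ℂ in 𝓝 0, (∀ t, c t + a ≠ 0) ∧ wind (fun t => c t + a) = wind c := by
  obtain ⟨_, ⟨s, rfl⟩, hmin⟩ := hc.isCompact_range.exists_isMinOn (range_nonempty _)
    (f := fun z => ‖z‖) continuous_norm.continuousOn
  have hpos : 0 < ‖c s‖ := norm_pos_iff.2 (h0 s)
  filter_upwards [Metric.ball_mem_nhds (0 : ℂ) hpos] with a ha
  rw [mem_ball_zero_iff] at ha
  have hlt : ∀ t, ‖a‖ < ‖c t‖ := fun t => ha.trans_le (hmin (mem_range_self t))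
  refine ⟨fun t h => ?_, wind_eq_of_div_mem_slitPlane hc h0 (hc.comp (f := fun z => z + a)
    (by fun_prop)) fun t => ?_⟩
  · have := hlt t
    rw [eq_neg_of_add_eq_zero_left h, norm_neg] at this
    exact lt_irrefl _ this
  · left
    have h1 : ‖a / c t‖ < 1 := by
      rw [norm_div, div_lt_one (norm_pos_iff.2 (h0 t))]
      exact hlt t
    rw [add_div, div_self (h0 t), Complex.add_re, Complex.one_re]
    linarith [(abs_lt.1 ((Complex.abs_re_le_norm _).trans_lt h1)).1]

variable {κ : ℝ} {X : Type*} [MetricSpace X] {PC : PolyComplex2 κ X} {ch : Charts PC}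
  {e : Set X} {w : X}

namespace EdgeNbhd
variable (N : EdgeNbhd ch e w)

theorem mem_closure_of_mem_face {F : PC.faces} {x : X} (hx : x ∈ (F : Set X))
    (hd : dist w x < N.r) : w ∈ closure (F : Set X) := by
  rcases N.cover x hd with h | ⟨F', h, hw⟩
  · exact absurd hx (N.notMem F x h)
  · rwa [PC.face_eq_of_mem hx h]

variable [CNSpace X]

theorem wind_foldRet_univ_sub {γ : ℝ → X} (hγ : IsLoop γ) {ε : ℝ} (hε : 0 < ε) :
    wind (fun t => N.foldRet univ (γ t) - Complex.I * ε) = 0 :=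
  wind_comp_eq_zero (h := fun x => N.foldRet univ x - Complex.I * ε)
    ((N.continuous_foldRet univ).sub continuous_const) (fun x => N.foldRet_univ_sub_ne x hε) hγ

/-- Near an edge which avoids the loop, the enclosed set meets no page or at least two pages. -/
theorem exists_ne_subset_encl {γ : ℝ → X} (hγ : IsLoop γ) (hdisj : Disjoint (ball w N.r) (range γ))
    {F₁ : PC.faces} {x₁ : X} (hx₁ : x₁ ∈ (F₁ : Set X)) (hd : dist w x₁ < N.r)
    (hx₁γ : x₁ ∈ encl ch γ) :
    ∃ F₂ : PC.faces, F₂ ≠ F₁ ∧ w ∈ closure (F₂ : Set X) ∧ (F₂ : Set X) ∩ ball w N.r ⊆ encl ch γ := by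
  have hF₁ := N.mem_closure_of_mem_face hx₁ hd
  have hball : ∀ F : PC.faces, ((F : Set X) ∩ ball w N.r ∩ encl ch γ).Nonempty →
      (F : Set X) ∩ ball w N.r ⊆ encl ch γ := fun F hne =>
    subset_encl_of_isPreconnected hγ ((ch F).isPreconnected_inter_ball w N.r) inter_subset_left
      (hdisj.mono_left inter_subset_right) hne
  have hsub₁ := hball F₁ ⟨x₁, ⟨hx₁, mem_ball'.2 hd⟩, hx₁γ⟩
  have hloop : IsLoop fun t => N.foldRet univ (γ t) := hγ.comp (N.continuous_foldRet univ)
  have hne : ∀ t, N.foldRet univ (γ t) ≠ 0 := fun t h =>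
    (disjoint_left.1 hdisj (mem_ball_self N.r_pos)) ⟨t, N.foldRet_univ_eq_zero h⟩
  have hadd := eventually_wind_add_eq hloop hne
  have hlim : ∀ s : ℂ, Tendsto (fun ε : ℝ => s * ε) (𝓝[>] 0) (𝓝 0) := fun s => by
    have : Continuous fun ε : ℝ => s * (ε : ℂ) := by fun_prop
    simpa using (this.tendsto 0).mono_left nhdsWithin_le_nhds
  have hall := ((hlim Complex.I).eventually hadd).and (((hlim (-Complex.I)).eventually hadd).and
    ((N.eventually_page (ρ := N.r / 2) (by linarith [N.r_pos])).and self_mem_nhdsWithin))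
  obtain ⟨ε, ⟨hp, hpw⟩, ⟨-, hmw⟩, hpage, hε : 0 < ε⟩ := hall.exists
  have hmw' : wind (fun t => N.foldRet univ (γ t)) = 0 := by
    rw [← hmw, ← N.wind_foldRet_univ_sub hγ hε]
    simp only [neg_mul, sub_eq_add_neg]
  have hsum := N.sum_wind_eq hγ hε hp
  rw [hpw, hmw'] at hsum
  have hmem : ∀ F : PC.faces, ∀ hF : w ∈ closure (F : Set X),
      (N.page F hF).c.inv (Complex.I * ε) ∈ (F : Set X) ∩ ball w N.r := fun F hF =>
    ⟨(N.page F hF).inv_mem_face (by simpa [abs_of_pos hε] using (hpage F hF).1) (by simpa using hε),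
      mem_ball'.2 ((hpage F hF).2.trans (by linarith [N.r_pos]))⟩
  have hn₁ := (N.page_mem_encl_iff hF₁ hγ hε (hpage F₁ hF₁).1 (hpage F₁ hF₁).2 hp).1
    (hsub₁ (hmem F₁ hF₁))
  by_contra! hcon
  refine hn₁ ?_
  rwa [Finset.sum_eq_single_of_mem F₁ (by simpa using hF₁) fun F hF hFne => ?_] at hsum
  have hwF : w ∈ closure (F : Set X) := by simpa using hF
  by_contra hn
  exact hcon F hFne hwF (hball F ⟨_, hmem F hwF,
    (N.page_mem_encl_iff hwF hγ hε (hpage F hwF).1 (hpage F hwF).2 hp).2 hn⟩)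

/-- A loop which locally runs along an edge and passes there only once encloses points
nearby. -/
theorem mem_closure_encl (N : EdgeNbhd ch e w) {γ : ℝ → X} (hγ : IsLoop γ) {t₀ η : ℝ} (ht₀ : t₀ ∈ Ioo (0 : ℝ) 1)
    (hw : γ t₀ = w) (honce : ∀ t, γ t = w ↔ t = t₀) (hη : 0 < η)
    (hinj : InjOn γ (Ioo (t₀ - η) (t₀ + η))) (he : ∀ t ∈ Ioo (t₀ - η) (t₀ + η), γ t ∈ e) :
    w ∈ closure (encl ch γ) := by
  have hloop : IsLoop fun t => N.foldRet univ (γ t) := hγ.comp (N.continuous_foldRet univ)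
  have hzero : ∀ t, N.foldRet univ (γ t) = 0 ↔ t = t₀ := by
    refine fun t => ⟨fun h => (honce t).1 (N.foldRet_univ_eq_zero h), ?_⟩
    rintro rfl
    rw [foldRet, hw, ret_eq_self (by rw [dist_self]; exact N.half_nonneg), N.fold_edge _ N.mem,
      N.coord.map_base, Complex.ofReal_zero]
  obtain ⟨ε₀, hε₀, hcross⟩ : ∃ ε₀ > (0 : ℝ), ∀ ε : ℝ, 0 < ε → ε < ε₀ →
      (∀ t, N.foldRet univ (γ t) + Complex.I * ε ≠ 0) ∧
      wind (fun t => N.foldRet univ (γ t) + Complex.I * ε) ≠ 0 := by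
    have hcont : Tendsto (fun t => dist w (γ t)) (𝓝 t₀) (𝓝 0) := by
      have : Continuous fun t => dist w (γ t) := continuous_const.dist hγ.continuous
      simpa [hw] using this.tendsto t₀
    obtain ⟨η₁, hη₁, hclose⟩ := Metric.eventually_nhds_iff.1
      (hcont.eventually (gt_mem_nhds (show 0 < N.r / 2 by linarith [N.r_pos])))
    set η' := min η η₁ / 2 with hη'
    have hm : 0 < min η η₁ := lt_min hη hη₁
    have hη'0 : 0 < η' := half_pos hm
    have hη'η : η' < η := (half_lt_self hm).trans_le (min_le_left _ _)
    have hη'1 : η' < η₁ := (half_lt_self hm).trans_le (min_le_right _ _)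
    have hIcc : ∀ t ∈ Icc (t₀ - η') (t₀ + η'), γ t ∈ e ∧ dist w (γ t) < N.r / 2 := by
      intro t ht
      refine ⟨he t ⟨by linarith [ht.1], by linarith [ht.2]⟩, hclose ?_⟩
      rw [Real.dist_eq, abs_lt]
      constructor <;> linarith [ht.1, ht.2]
    have hval : ∀ t ∈ Icc (t₀ - η') (t₀ + η'), N.foldRet univ (γ t) = N.b (γ t) := by
      intro t ht
      rw [foldRet, ret_eq_self (hIcc t ht).2.le, N.fold_edge _ (hIcc t ht).1]
    have hbinj : InjOn (fun t => N.b (γ t)) (Icc (t₀ - η') (t₀ + η')) := by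
      intro s hs t ht hst
      refine hinj ⟨by linarith [hs.1], by linarith [hs.2]⟩ ⟨by linarith [ht.1], by linarith [ht.2]⟩ ?_
      have hr := N.r_pos
      have := N.coord.dist_eq _ (hIcc s hs).1 _ (hIcc t ht).1
        (by linarith [(hIcc s hs).2]) (by linarith [(hIcc t ht).2])
      rw [show N.b (γ s) = N.b (γ t) from hst, sub_self, abs_zero, dist_eq_zero] at this
      exact this
    have hbc : ContinuousOn (fun t => N.b (γ t)) (Icc (t₀ - η') (t₀ + η')) :=
      (N.coord.continuous.comp hγ.continuous).continuousOn
    have hmid : t₀ ∈ Icc (t₀ - η') (t₀ + η') := ⟨by linarith, by linarith⟩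
    have hb0 : N.b (γ t₀) = 0 := by rw [hw, N.coord.map_base]
    have hre : ∀ t ∈ Icc (t₀ - η') (t₀ + η'), (N.foldRet univ (γ t)).re = N.b (γ t) :=
      fun t ht => by rw [hval t ht, Complex.ofReal_re]
    rcases hbc.strictMonoOn_of_injOn_Icc' (by linarith) hbinj with hmono | hanti
    · obtain ⟨ε₀, hε₀, h⟩ := exists_wind_ne_of_crossing hloop ht₀ hη'0 hzero
        (fun t ht => by
          have ht' : t ∈ Icc (t₀ - η') (t₀ + η') := ⟨ht.1.le, by linarith [ht.2]⟩
          rw [hre t ht', ← hb0]; exact hmono ht' hmid ht.2)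
        (fun t ht => by
          have ht' : t ∈ Icc (t₀ - η') (t₀ + η') := ⟨by linarith [ht.1], ht.2.le⟩
          rw [hre t ht', ← hb0]; exact hmono hmid ht' ht.1)
      refine ⟨ε₀, hε₀, fun ε hε hlt => ?_⟩
      obtain ⟨-, h2, h3⟩ := h ε hε hlt
      rw [N.wind_foldRet_univ_sub hγ hε] at h3
      exact ⟨h2, h3.symm⟩
    · obtain ⟨ε₀, hε₀, h⟩ := exists_wind_ne_of_crossing
        (z := fun t => -N.foldRet univ (γ t)) (hloop.comp continuous_neg) ht₀ hη'0
        (fun t => by rw [neg_eq_zero, hzero])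
        (fun t ht => by
          have ht' : t ∈ Icc (t₀ - η') (t₀ + η') := ⟨ht.1.le, by linarith [ht.2]⟩
          rw [Complex.neg_re, hre t ht', neg_lt_zero, ← hb0]; exact hanti ht' hmid ht.2)
        (fun t ht => by
          have ht' : t ∈ Icc (t₀ - η') (t₀ + η') := ⟨by linarith [ht.1], ht.2.le⟩
          rw [Complex.neg_re, hre t ht', neg_pos, ← hb0]; exact hanti hmid ht' ht.1)
      refine ⟨ε₀, hε₀, fun ε hε hlt => ?_⟩
      obtain ⟨h1, h2, h3⟩ := h ε hε hlt
      have e1 : ∀ t, -N.foldRet univ (γ t) - Complex.I * ε =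
          -1 * (N.foldRet univ (γ t) + Complex.I * ε) := fun t => by ring
      have e2 : ∀ t, -N.foldRet univ (γ t) + Complex.I * ε =
          -1 * (N.foldRet univ (γ t) - Complex.I * ε) := fun t => by ring
      have hne : ∀ t, N.foldRet univ (γ t) + Complex.I * ε ≠ 0 := fun t ht =>
        h1 t (by rw [e1, ht, mul_zero])
      refine ⟨hne, ?_⟩
      simp only [e1, e2] at h3
      rw [wind_const_mul (c := fun t => N.foldRet univ (γ t) + Complex.I * ε)
        (hloop.continuous.add continuous_const) hne (neg_ne_zero.2 one_ne_zero),
        wind_const_mul (c := fun t => N.foldRet univ (γ t) - Complex.I * ε)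
          (hloop.continuous.sub continuous_const)
          (fun t => N.foldRet_univ_sub_ne _ hε) (neg_ne_zero.2 one_ne_zero),
        N.wind_foldRet_univ_sub hγ hε] at h3
      exact h3
  rw [Metric.mem_closure_iff]
  intro ρ hρ
  have hall := (N.eventually_page (ρ := min ρ (N.r / 2))
    (lt_min hρ (by linarith [N.r_pos]))).and (Ioo_mem_nhdsGT hε₀)
  obtain ⟨ε, hpage, hε⟩ := hall.exists
  obtain ⟨hp, hpw⟩ := hcross ε hε.1 hε.2
  rw [← N.sum_wind_eq hγ hε.1 hp] at hpw
  obtain ⟨F, hF, hne⟩ := Finset.exists_ne_zero_of_sum_ne_zero hpw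
  have hwF : w ∈ closure (F : Set X) := by simpa using hF
  have hd := (hpage F hwF).2
  exact ⟨_, (N.page_mem_encl_iff hwF hγ hε.1 (hpage F hwF).1
    (hd.trans_le (min_le_right _ _)) hp).2 hne, hd.trans_le (min_le_left _ _)⟩

end EdgeNbhd
end Cat2Cx

namespace Cat2Cx
open Topology

namespace FaceChart
variable {X : Type*} [MetricSpace X] {F : Set X}

/-- Geodesics can be prolonged inside open faces. -/
theorem exists_btw (c : FaceChart F) {w y : X} (hw : w ∈ F) (hy : y ∈ closure F) (hyw : y ≠ w)
    {ρ : ℝ} (hρ : 0 < ρ) : ∃ x, dist w x < ρ ∧ Btw y w x ∧ x ≠ w := by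
  have hlim : Tendsto (fun τ : ℝ => (τ : ℂ) * (c.toFun w - c.toFun y)) (𝓝[>] 0) (𝓝 0) := by
    have : Continuous fun τ : ℝ => (τ : ℂ) * (c.toFun w - c.toFun y) := by fun_prop
    simpa using (this.tendsto 0).mono_left nhdsWithin_le_nhds
  obtain ⟨τ, ⟨x, hxF, hxd, hx⟩, hτ : 0 < τ⟩ :=
    ((hlim.eventually (c.eventually_exists_map_eq hw hρ)).and self_mem_nhdsWithin).exists
  refine ⟨x, hxd, ?_, ?_⟩
  · rw [← c.mem_segment_iff _ hy _ (subset_closure hxF) _ (subset_closure hw)]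
    refine ⟨τ / (1 + τ), 1 / (1 + τ), by positivity, by positivity, by field_simp; ring, ?_⟩
    have hne : (1 + τ : ℂ) ≠ 0 := by exact_mod_cast (by positivity : (1 + τ) ≠ 0)
    rw [Complex.real_smul, Complex.real_smul]
    push_cast
    field_simp
    linear_combination hx
  · rintro rfl
    rw [sub_self, eq_comm, mul_eq_zero, Complex.ofReal_eq_zero, sub_eq_zero] at hx
    rcases hx with hx | hx
    · exact hτ.ne' hx
    · exact hyw (c.injOn hy (subset_closure hw) hx.symm)

variable [CNSpace X]

theorem ret_mem_face {u : X} {r : ℝ} (hr : 0 ≤ r) (hF : closedBall u r ⊆ F) (x : X) :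
    ret u r x ∈ F := hF <| by
  rw [mem_closedBall, dist_comm, dist_ret u hr]
  exact min_le_right _ _

theorem disp_eq_zero_iff (c : FaceChart F) {u : X} {r : ℝ} (hr : 0 < r)
    (hF : closedBall u r ⊆ F) (x : X) : c.disp u r x = 0 ↔ x = u := by
  rw [← c.disp_eq_iff hr.le hF (y := u) (by rwa [dist_self]), sub_self]

/-- The displacement of a point between `u` and `x` points in the same direction. -/
theorem exists_disp_eq_mul (c : FaceChart F) {u : X} {r : ℝ} (hr : 0 < r)
    (hF : closedBall u r ⊆ F) {x y : X} (h : Btw u y x) :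
    ∃ τ : ℝ, 0 ≤ τ ∧ c.disp u r y = τ * c.disp u r x := by
  have hu : u ∈ F := hF (mem_closedBall_self hr.le)
  have h1 : Btw u (ret u r y) (ret u r x) := by
    refine ((h.trans_left (btw_ret u hr.le y))).btw_of_dist_le (btw_ret u hr.le x) ?_
    rw [dist_ret u hr.le, dist_ret u hr.le]
    exact min_le_min_right _ h.dist_left_le
  obtain ⟨a, b, -, hb, hab, e⟩ := c.mem_segment_of_btw (subset_closure hu)
    (subset_closure (ret_mem_face hr.le hF x)) h1
  refine ⟨b, hb, ?_⟩
  rw [disp, disp, ← e]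
  have ha : a = 1 - b := by linarith
  rw [ha, Complex.real_smul, Complex.real_smul]
  push_cast
  ring

theorem btw_of_disp_eq_neg_mul (c : FaceChart F) {u : X} {r : ℝ} (hr : 0 < r)
    (hF : closedBall u r ⊆ F) {x y : X} {τ : ℝ} (hτ : 0 < τ) (hx : x ≠ u)
    (h : c.disp u r x = -(τ * c.disp u r y)) : Btw x u y := by
  have hu : u ∈ F := hF (mem_closedBall_self hr.le)
  have hy : y ≠ u := by
    rintro rfl
    rw [(c.disp_eq_zero_iff hr hF y).2 rfl, mul_zero, neg_zero, c.disp_eq_zero_iff hr hF] at h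
    exact hx h
  have hret : ∀ z, z ≠ u → ret u r z ≠ u := fun z hz e =>
    hz (eq_of_ret_eq hr.le e (by rwa [dist_self]))
  have h1 : Btw (ret u r x) u (ret u r y) := by
    rw [← c.mem_segment_iff _ (subset_closure (ret_mem_face hr.le hF x)) _
      (subset_closure (ret_mem_face hr.le hF y)) _ (subset_closure hu)]
    refine ⟨1 / (1 + τ), τ / (1 + τ), by positivity, by positivity, by field_simp, ?_⟩
    rw [disp, disp] at h
    have hne : (1 + τ : ℂ) ≠ 0 := by exact_mod_cast (by positivity : (1 + τ) ≠ 0)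
    rw [Complex.real_smul, Complex.real_smul]
    push_cast
    field_simp
    linear_combination h
  have h2 := (btw_ret u hr.le x).symm.concat h1 (hret x hx)
  exact ((btw_ret u hr.le y).symm.concat h2.symm (hret y hy)).symm

end FaceChart

variable {κ : ℝ} {X : Type*} [MetricSpace X] {PC : PolyComplex2 κ X} {ch : Charts PC}
  {γ : ℝ → X}

theorem PolyComplex2.finite_vertices_inter (PC : PolyComplex2 κ X) {S : Set X} (hS : IsCompact S) :
    (PC.vertices ∩ S).Finite := by
  choose ε hε h using PC.locally_finite
  obtain ⟨T, -, hT⟩ := hS.elim_nhds_subcover (fun x => ball x (ε x)) fun x _ => ball_mem_nhds x (hε x)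
  refine (T.finite_toSet.biUnion fun x _ => (h x).2).subset ?_
  rintro v ⟨hv, hvS⟩
  obtain ⟨x, hx, hvx⟩ := mem_iUnion₂.1 (hT hvS)
  exact mem_biUnion (Finset.mem_coe.2 hx) ⟨hv, hvx⟩

variable [CNSpace X]

theorem isCompact_closure_encl (hγ : IsLoop γ) : IsCompact (closure (encl ch γ)) := by
  have hK : IsCompact ((fun q : X × ℝ => gp (γ 0) q.1 q.2) '' (range γ ×ˢ Icc 0 1)) :=
    (hγ.isCompact_range.prod isCompact_Icc).image_of_continuousOn
      ((continuousOn_gp_right (γ 0)).mono (prod_mono (subset_univ _) le_rfl))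
  refine hK.closure_of_subset ?_
  rintro y ⟨-, F, -, h, hh, h0, -, hw⟩
  by_contra hy
  refine hw (wind_comp_eq_zero_of_cone hh hγ fun t s hs e => hy ?_)
  exact ⟨(γ t, s), ⟨mem_range_self t, hs⟩, (h0 _).1 e⟩

theorem mem_encl_of_mem_closure (hγ : IsLoop γ) {F : PC.faces} {x : X} (hxF : x ∈ (F : Set X))
    (hx : x ∈ closure (encl ch γ)) (hxγ : x ∉ range γ) : x ∈ encl ch γ := by
  obtain ⟨y, hy, hy'⟩ := (mem_closure_iff_frequently.1 hx |>.and_eventually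
    (eventually_mem_encl_iff (ch := ch) hγ hxF hxγ)).exists
  exact hy'.1 hy

end Cat2Cx

namespace Cat2Cx
open Topology

theorem isClosed_setOf_exists_btw {X : Type*} [MetricSpace X] {K : Set ℝ} (hK : IsCompact K)
    {C : Set X} (hC : IsCompact C) {η : ℝ → X} (hη : ContinuousOn η K) (x : X) :
    IsClosed {τ | τ ∈ K ∧ ∃ p ∈ C, Btw x p (η τ)} := by
  have hcont : ContinuousOn (fun q : ℝ × X => dist x q.2 + dist q.2 (η q.1) - dist x (η q.1))
      (K ×ˢ C) := by
    have h1 : ContinuousOn (fun q : ℝ × X => η q.1) (K ×ˢ C) :=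
      hη.comp continuousOn_fst fun q hq => hq.1
    have h2 : ContinuousOn (fun q : ℝ × X => dist q.2 (η q.1)) (K ×ˢ C) :=
      continuous_dist.comp_continuousOn (continuousOn_snd.prodMk h1)
    have h3 : ContinuousOn (fun q : ℝ × X => dist x (η q.1)) (K ×ˢ C) :=
      continuous_dist.comp_continuousOn (continuousOn_const.prodMk h1)
    exact ((by fun_prop : Continuous fun q : ℝ × X => dist x q.2).continuousOn.add h2).sub h3
  have hcl := hcont.preimage_isClosed_of_isClosed (hK.prod hC).isClosed
    (isClosed_singleton (x := (0 : ℝ)))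
  have hcomp := ((hK.prod hC).of_isClosed_subset hcl inter_subset_left).image continuous_fst
  convert hcomp.isClosed using 1
  ext τ
  constructor
  · rintro ⟨hτ, p, hp, h⟩
    exact ⟨(τ, p), ⟨⟨hτ, hp⟩, sub_eq_zero.2 h⟩, rfl⟩
  · rintro ⟨⟨τ, p⟩, ⟨⟨hτ, hp⟩, h⟩, rfl⟩
    exact ⟨hτ, p, hp, sub_eq_zero.1 h⟩

variable {κ : ℝ} {X : Type*} [MetricSpace X] {PC : PolyComplex2 κ X} {ch : Charts PC}
  {e : Set X} {w : X}

theorem PolyComplex2.eq_of_mem_closure (PC : PolyComplex2 κ X) {F F' : PC.faces} {x : X}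
    (h : x ∈ (F : Set X)) (h' : x ∈ closure (F' : Set X)) : F = F' := by
  obtain ⟨y, hy, hy'⟩ := mem_closure_iff.1 h' _ (PC.faces_open F F.2) h
  exact PC.face_eq_of_mem hy hy'

theorem IsEdgeCoord.isCompact_inter {b : X → ℝ} {r : ℝ} (hb : IsEdgeCoord e w r b)
    (hw : w ∈ e) {ρ : ℝ} (hρ : ρ < r) : IsCompact (e ∩ closedBall w ρ) := by
  rcases lt_or_ge ρ 0 with h0 | h0
  · rw [closedBall_eq_empty.2 h0, inter_empty]
    exact isCompact_empty
  have hex : ∀ s ∈ Icc (-ρ) ρ, ∃ x ∈ e, b x = s ∧ dist w x = |s| := fun s hs =>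
    hb.exists_eq s ((abs_le.2 hs).trans_lt hρ)
  have : Nonempty X := ⟨w⟩
  choose! g hge hgb hgd using hex
  have hlt : ∀ s ∈ Icc (-ρ) ρ, dist w (g s) < r := fun s hs => by
    rw [hgd s hs]; exact (abs_le.2 hs).trans_lt hρ
  have hlip : LipschitzOnWith 1 g (Icc (-ρ) ρ) := by
    refine LipschitzOnWith.of_dist_le_mul fun s hs t ht => ?_
    rw [hb.dist_eq _ (hge s hs) _ (hge t ht) (hlt s hs) (hlt t ht), hgb s hs, hgb t ht,
      Real.dist_eq, NNReal.coe_one, one_mul]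
  convert isCompact_Icc.image_of_continuousOn hlip.continuousOn using 1
  refine Subset.antisymm ?_ ?_
  · rintro x ⟨hxe, hx⟩
    rw [mem_closedBall, dist_comm] at hx
    have h1 := hb.dist_eq x hxe w hw (hx.trans_lt hρ) (by rw [dist_self]; linarith)
    rw [hb.map_base, sub_zero, dist_comm] at h1
    have hs : b x ∈ Icc (-ρ) ρ := abs_le.1 (h1 ▸ hx)
    refine ⟨b x, hs, dist_le_zero.1 ?_⟩
    rw [hb.dist_eq _ (hge _ hs) _ hxe (hlt _ hs) (hx.trans_lt hρ), hgb _ hs, sub_self, abs_zero]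
  · rintro _ ⟨s, hs, rfl⟩
    refine ⟨hge s hs, ?_⟩
    rw [mem_closedBall, dist_comm, hgd s hs]
    exact abs_le.2 hs

namespace EdgeNbhd
variable [CNSpace X]

/-- A geodesic which leaves a page crosses the edge. -/
theorem exists_mem_edge_btw (N : EdgeNbhd ch e w) {F : PC.faces} {x y : X} (hx : x ∈ (F : Set X))
    (hxd : dist w x < N.r) (hy : y ∉ (F : Set X)) (hyd : dist w y < N.r) :
    ∃ p ∈ e, Btw x p y := by
  by_contra! hcon
  have hT : IsPreconnected (gp x y '' Icc 0 1) := isPreconnected_Icc.image _ (continuousOn_gp x y)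
  have hV : IsOpen (⋃ F' ∈ {F' : PC.faces | F' ≠ F}, (F' : Set X)) :=
    isOpen_biUnion fun F' _ => PC.faces_open F' F'.2
  have hne : (gp x y '' Icc 0 1 ∩ (F : Set X)).Nonempty :=
    ⟨x, ⟨0, ⟨le_rfl, zero_le_one⟩, gp_zero x y⟩, hx⟩
  refine hy (hT.subset_left_of_subset_union (PC.faces_open F F.2) hV ?_ ?_ hne
    ⟨1, ⟨zero_le_one, le_rfl⟩, gp_one x y⟩)
  · rw [disjoint_iUnion₂_right]
    exact fun F' hF' => disjoint_left.2 fun z hz hz' => hF' (PC.face_eq_of_mem hz' hz)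
  · rintro _ ⟨t, ht, rfl⟩
    have hb := btw_gp x y ht
    rcases N.cover _ (mem_ball'.1 (hb.mem_ball (mem_ball'.2 hxd) (mem_ball'.2 hyd))) with
      he | ⟨F', hF', -⟩
    · exact absurd hb (hcon _ he)
    · by_cases h : F' = F
      · left; rwa [← h]
      · right; exact mem_biUnion (x := F') h hF'

/-- A geodesic which reaches an edge from one page can be prolonged into any other page. -/
theorem exists_btw (N : EdgeNbhd ch e w) {F₁ F₂ : PC.faces} {x₁ : X} (hx₁ : x₁ ∈ (F₁ : Set X))
    (hd : dist w x₁ < N.r) (hne : F₂ ≠ F₁) (hF₂ : w ∈ closure (F₂ : Set X)) :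
    ∃ x ∈ closure (F₂ : Set X), x ≠ w ∧ dist w x < N.r ∧ Btw x₁ w x := by
  set P := N.page F₂ hF₂ with hP
  set ρ := (dist w x₁ + N.r) / 2 with hρ
  have hρ1 : dist w x₁ < ρ := by rw [hρ]; linarith
  have hρr : ρ < N.r := by rw [hρ]; linarith
  obtain ⟨ε, hε, hεδ, hinv⟩ := P.exists_forall_dist_inv_lt hF₂ (dist_nonneg.trans_lt hρ1)
  set s := ε / 2 with hs
  have hs0 : 0 < s := half_pos hε
  have hsε : s < ε := half_lt_self hε
  let z : ℝ → ℂ := fun τ => ⟨s * τ, s * (1 - |τ|)⟩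
  have hzc : Continuous z := by
    have : z = fun τ : ℝ => ((s * τ : ℝ) : ℂ) + ((s * (1 - |τ|) : ℝ) : ℂ) * Complex.I := by
      funext τ; exact Complex.mk_eq_add_mul_I _ _
    rw [this]; fun_prop
  have hzim : ∀ τ ∈ Icc (-1 : ℝ) 1, 0 ≤ (z τ).im := fun τ hτ =>
    mul_nonneg hs0.le (by linarith [abs_le.2 hτ])
  have hzn : ∀ τ ∈ Icc (-1 : ℝ) 1, ‖z τ‖ < ε := by
    intro τ hτ
    have h1 := abs_le.2 hτ
    refine (Complex.norm_le_abs_re_add_abs_im _).trans_lt ?_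
    change |s * τ| + |s * (1 - |τ|)| < ε
    rw [abs_mul, abs_mul, abs_of_pos hs0, abs_of_nonneg (by linarith : 0 ≤ 1 - |τ|)]
    linarith
  have hz0 : ∀ τ, z τ ≠ 0 := by
    intro τ h
    have h1 : s * τ = 0 := congrArg Complex.re h
    have h2 : s * (1 - |τ|) = 0 := congrArg Complex.im h
    rw [mul_eq_zero, or_iff_right hs0.ne'] at h1 h2
    rw [h1, abs_zero] at h2
    linarith
  have hzK : ∀ τ ∈ Icc (-1 : ℝ) 1, z τ ∈ P.c.K := fun τ hτ =>
    P.mem_K _ ((hzn τ hτ).trans_le hεδ) (hzim τ hτ)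
  let η : ℝ → X := fun τ => P.c.inv (z τ)
  have hηc : ContinuousOn η (Icc (-1) 1) := P.c.continuousOn_inv.comp hzc.continuousOn hzK
  have hηF : ∀ τ ∈ Icc (-1 : ℝ) 1, η τ ∈ closure (F₂ : Set X) := fun τ hτ =>
    P.c.inv_mem _ (hzK τ hτ)
  have hηd : ∀ τ ∈ Icc (-1 : ℝ) 1, dist w (η τ) < ρ := fun τ hτ =>
    hinv _ (hzn τ hτ) (hzim τ hτ)
  let C : ℝ → Set X := fun σ => (e ∩ closedBall w ρ) ∩ {p | 0 ≤ σ * N.b p}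
  have hC : ∀ σ, IsCompact (C σ) := fun σ =>
    (N.coord.isCompact_inter N.mem hρr).inter_right
      (isClosed_le continuous_const (continuous_const.mul N.coord.continuous))
  let A : ℝ → Set ℝ := fun σ => {τ | τ ∈ Icc (-1 : ℝ) 1 ∧ ∃ p ∈ C σ, Btw x₁ p (η τ)}
  have hA : ∀ σ, IsClosed (A σ) := fun σ => isClosed_setOf_exists_btw isCompact_Icc (hC σ) hηc x₁
  have hcover : Icc (-1 : ℝ) 1 ⊆ A 1 ∪ A (-1) := by
    intro τ hτ
    have hη1 : η τ ∉ (F₁ : Set X) := fun h => hne (PC.eq_of_mem_closure h (hηF τ hτ)).symm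
    obtain ⟨p, hpe, hp⟩ := N.exists_mem_edge_btw hx₁ hd hη1 ((hηd τ hτ).trans hρr)
    have hpρ : p ∈ closedBall w ρ := mem_closedBall'.2 (hp.mem_closedBall hρ1.le (hηd τ hτ).le)
    rcases le_total 0 (N.b p) with h | h
    · exact Or.inl ⟨hτ, p, ⟨⟨hpe, hpρ⟩, by simpa using h⟩, hp⟩
    · exact Or.inr ⟨hτ, p, ⟨⟨hpe, hpρ⟩, by simpa using h⟩, hp⟩
  have hendz : ∀ τ : ℝ, |τ| = 1 → z τ = ((s * τ : ℝ) : ℂ) := fun τ hτ =>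
    Complex.ext (by simp [z]) (by simp [z, hτ])
  have hend : ∀ τ : ℝ, |τ| = 1 → ∀ σ : ℝ, 0 ≤ σ * N.b (P.c.inv ((s * τ : ℝ) : ℂ)) →
      (Icc (-1) 1 ∩ A σ).Nonempty := by
    intro τ hτ σ hσ
    have hτ' : τ ∈ Icc (-1 : ℝ) 1 := abs_le.1 hτ.le
    have hη' : η τ = P.c.inv ((s * τ : ℝ) : ℂ) := by rw [← hendz τ hτ]
    refine ⟨τ, hτ', hτ', η τ, ⟨⟨?_, mem_closedBall'.2 (hηd τ hτ').le⟩, ?_⟩, btw_right _ _⟩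
    · rw [hη']
      refine P.inv_mem_edge _ ?_
      rw [abs_mul, hτ, mul_one, abs_of_pos hs0]
      exact hsε.trans_le hεδ
    · rw [mem_ofPred_eq, hη']; exact hσ
  have hsδ : s ∈ Ioo (-P.δ) P.δ := ⟨by linarith, by linarith⟩
  have hsδ' : -s ∈ Ioo (-P.δ) P.δ := ⟨by linarith, by linarith⟩
  have h0δ : (0 : ℝ) ∈ Ioo (-P.δ) P.δ := ⟨by linarith, by linarith⟩
  have hB0 : N.b (P.c.inv ((0 : ℝ) : ℂ)) = 0 := by
    rw [Complex.ofReal_zero, P.inv_zero hF₂, N.coord.map_base]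
  have hne : (Icc (-1) 1 ∩ A 1).Nonempty ∧ (Icc (-1) 1 ∩ A (-1)).Nonempty := by
    rcases P.mono with hm | hm
    · have h1 := hm h0δ hsδ hs0
      have h2 := hm hsδ' h0δ (neg_lt_zero.2 hs0)
      simp only [hB0] at h1 h2
      exact ⟨hend 1 abs_one 1 (by rw [mul_one, one_mul]; exact h1.le),
        hend (-1) (by simp) (-1) (by rw [mul_neg_one, neg_one_mul]; linarith)⟩
    · have h1 := hm h0δ hsδ hs0
      have h2 := hm hsδ' h0δ (neg_lt_zero.2 hs0)
      simp only [hB0] at h1 h2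
      exact ⟨hend (-1) (by simp) 1 (by rw [mul_neg_one, one_mul]; exact h2.le),
        hend 1 abs_one (-1) (by rw [mul_one, neg_one_mul]; linarith)⟩
  obtain ⟨τ, hτ, ⟨-, p, ⟨⟨hpe, hpρ⟩, hpb⟩, hp⟩, -, p', ⟨⟨hpe', hpρ'⟩, hpb'⟩, hp'⟩ :=
    isPreconnected_closed_iff.1 (isPreconnected_Icc (a := (-1 : ℝ)) (b := 1)) _ _ (hA 1) (hA (-1))
      hcover hne.1 hne.2
  refine ⟨η τ, hηF τ hτ, fun h => ?_, (hηd τ hτ).trans hρr, ?_⟩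
  · refine hz0 τ ?_
    rw [← P.c.right_inv _ (hzK τ hτ), ← P.map_base]
    exact congrArg P.c.toFun h
  · rw [mem_ofPred_eq, one_mul] at hpb
    rw [mem_ofPred_eq, neg_one_mul, neg_nonneg] at hpb'
    have hr0 : dist w w < N.r := by rw [dist_self]; exact N.r_pos
    have hpd : dist w p < N.r := (mem_closedBall'.1 hpρ).trans_lt hρr
    have hpd' : dist w p' < N.r := (mem_closedBall'.1 hpρ').trans_lt hρr
    have hwb : Btw p w p' := by
      rw [Btw, N.coord.dist_eq _ hpe _ N.mem hpd hr0, N.coord.dist_eq _ N.mem _ hpe' hr0 hpd',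
        N.coord.dist_eq _ hpe _ hpe' hpd hpd', N.coord.map_base, sub_zero, zero_sub, abs_neg,
        abs_of_nonneg hpb, abs_of_nonpos hpb', abs_of_nonneg (by linarith)]
      ring
    rcases le_total (dist x₁ p) (dist x₁ p') with hle | hle
    · have h1 := hp.btw_of_dist_le hp' hle
      exact hp'.trans_left (h1.trans_right hwb)
    · have h1 := hp'.btw_of_dist_le hp hle
      exact hp.trans_left (h1.trans_right hwb.symm)

end EdgeNbhd
end Cat2Cx

namespace Cat2Cx
open Topology

section
variable {X : Type*} [MetricSpace X] [CNSpace X]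

theorem Btw.or_of_btw {u w x v : X} (h : Btw u w x) (hv : Btw u v x) : Btw u v w ∨ Btw w v x := by
  rcases le_total (dist u v) (dist u w) with hle | hle
  · exact Or.inl (hv.btw_of_dist_le h hle)
  · exact Or.inr (hv.trans_left_right (h.btw_of_dist_le hv hle))

theorem exists_btw_dist_lt {u w : X} (h : u ≠ w) {ρ : ℝ} (hρ : 0 < ρ) :
    ∃ y, Btw u y w ∧ y ≠ w ∧ dist w y < ρ := by
  have hd : 0 < dist w u := dist_pos.2 h.symm
  obtain ⟨t, ht0, ht⟩ := exists_between (lt_min zero_lt_one (div_pos hρ hd))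
  have ht' : t ∈ Icc (0 : ℝ) 1 := ⟨ht0.le, (ht.trans_le (min_le_left _ _)).le⟩
  have e := dist_left_gp w u ht'
  refine ⟨gp w u t, (btw_gp w u ht').symm, fun hw => ?_, ?_⟩
  · rw [hw, dist_self] at e
    exact (mul_pos ht0 hd).ne e
  · rw [e]
    exact (lt_div_iff₀ hd).1 (ht.trans_le (min_le_right _ _))

theorem continuous_gp_left (u : X) {t : ℝ} (ht : t ∈ Icc (0 : ℝ) 1) :
    Continuous fun w => gp u w t := by
  refine LipschitzWith.continuous (K := 1) (LipschitzWith.of_dist_le_mul fun w w' => ?_)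
  refine (dist_gp_gp_le u w w' ht).trans ?_
  rw [NNReal.coe_one]
  exact mul_le_mul_of_nonneg_right ht.2 dist_nonneg

end

variable {κ : ℝ} {X : Type*} [MetricSpace X] {PC : PolyComplex2 κ X} {ch : Charts PC}
  {γ : ℝ → X} [CNSpace X]

theorem PolyComplex2.mem_edge_of_btw (PC : PolyComplex2 κ X) {e : Set X} (he : e ∈ PC.edges)
    {x y z : X} (hx : x ∈ e) (hy : y ∈ e) (h : Btw x z y) : z ∈ e := by
  obtain ⟨f, L, -, hf, rfl⟩ := PC.edge_geodesic e he
  obtain ⟨a, ha, rfl⟩ := hx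
  obtain ⟨b, hb, rfl⟩ := hy
  obtain ⟨t, ht, rfl⟩ := h.exists_eq_gp
  have key : ∀ s ∈ Ioo 0 L, ∀ t ∈ Ioo 0 L, dist (f s) (f t) = |s - t| := fun s hs t ht =>
    hf.2 s (Ioo_subset_Icc_self hs) t (Ioo_subset_Icc_self ht)
  have hm : a + t * (b - a) ∈ Ioo 0 L := by
    have := (convex_Ioo (0 : ℝ) L).add_smul_sub_mem ha hb ht
    simpa using this
  have h1 : dist (f a) (f (a + t * (b - a))) = t * dist (f a) (f b) := by
    rw [key _ ha _ hm, key _ ha _ hb, abs_sub_comm a b, ← abs_of_nonneg ht.1, ← abs_mul,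
      abs_of_nonneg ht.1, abs_sub_comm]
    congr 1; ring
  have h2 : dist (f (a + t * (b - a))) (f b) = (1 - t) * dist (f a) (f b) := by
    have h0 : 0 ≤ 1 - t := by linarith [ht.2]
    rw [key _ hm _ hb, key _ ha _ hb, abs_sub_comm a b, ← abs_of_nonneg h0, ← abs_mul,
      ← abs_neg]
    congr 1; ring
  have hb : Btw (f a) (f (a + t * (b - a))) (f b) := by
    rw [Btw, h1, h2]; ring
  exact ⟨_, hm, hb.eq_gp ht h1⟩

/-- A geodesic which comes from an open face and avoids the vertices meets an open edge only in
isolated points. -/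
theorem exists_notMem_edge_btw (ch : Charts PC) {e : Set X} (he : e ∈ PC.edges) {u w : X}
    (hw : w ∈ e) {F : PC.faces} (hu : u ∈ (F : Set X)) (hv : ∀ v, Btw u v w → v ∉ PC.vertices)
    {ρ : ℝ} (hρ : 0 < ρ) : ∃ x, Btw u x w ∧ dist w x < ρ ∧ x ∉ e := by
  by_contra! hcon
  have hue : u ∉ e := fun h => by
    have := PC.disjoint_edge_face he F.2 (ch F)
    exact (this ▸ (⟨h, hu⟩ : u ∈ e ∩ F) : u ∈ (∅ : Set X))
  have hd : 0 < dist w u := dist_pos.2 fun h => hue (h ▸ hw)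
  have hcl : IsClosed ({t | gp w u t ∈ e} ∩ Icc 0 1) := by
    have h1 := (continuousOn_gp w u).preimage_isClosed_of_isClosed isClosed_Icc
      (isClosed_closure (s := e))
    convert h1 using 1
    ext t
    constructor
    · exact fun h => ⟨h.2, subset_closure h.1⟩
    · rintro ⟨ht, hte⟩
      refine ⟨by_contra fun hn => ?_, ht⟩
      exact hv _ (btw_gp w u ht).symm (PC.edge_closure e he ⟨hte, hn⟩)
  have hsub := hcl.Icc_subset_of_forall_mem_nhdsWithin (by simpa using hw) ?_
  · refine hue ?_
    have := hsub (right_mem_Icc.2 zero_le_one)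
    simpa using this
  · rintro t₀ ⟨ht₀, h0, h1⟩
    have ht₀' : t₀ ∈ Icc (0 : ℝ) 1 := ⟨h0, h1.le⟩
    have hcont : Tendsto (fun t => gp w u t) (𝓝[>] t₀) (𝓝 (gp w u t₀)) :=
      ((continuousOn_gp w u) t₀ ht₀').mono_left
        ((nhdsWithin_le_iff).2 (mem_of_superset (Ioo_mem_nhdsGT h1) fun t ht =>
          ⟨h0.trans ht.1.le, ht.2.le⟩))
    rcases h0.eq_or_lt with rfl | h0
    · filter_upwards [Ioo_mem_nhdsGT h1, hcont.eventually (ball_mem_nhds _ hρ)] with t ht hb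
      rw [gp_zero, dist_comm] at hb
      exact hcon _ (btw_gp w u ⟨ht.1.le, ht.2.le⟩).symm hb
    · set v := gp w u t₀ with hvdef
      have hvw : w ≠ v := fun h => by
        have := dist_left_gp w u ht₀'
        rw [← hvdef, ← h, dist_self] at this
        exact (mul_pos h0 hd).ne this
      obtain ⟨N, -⟩ := exists_edgeNbhd ch he (w := v) ht₀ one_pos
      obtain ⟨z, hz, hzv, hzd⟩ := exists_btw_dist_lt hvw N.r_pos
      have hze : z ∈ e := PC.mem_edge_of_btw he hw ht₀ hz
      filter_upwards [Ioo_mem_nhdsGT h1, hcont.eventually (ball_mem_nhds _ N.r_pos)] with t ht hb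
      by_contra hte
      rcases N.cover _ (mem_ball'.1 hb) with h | ⟨F', hF', hvF'⟩
      · exact hte h
      · have htI : t ∈ Icc (0 : ℝ) 1 := ⟨(h0.trans ht.1).le, ht.2.le⟩
        have hb1 : Btw w v (gp w u t) := by
          refine (btw_gp w u ht₀').btw_of_dist_le (btw_gp w u htI) ?_
          rw [dist_left_gp w u htI, ← hvdef, hvdef, dist_left_gp w u ht₀']
          exact mul_le_mul_of_nonneg_right ht.1.le hd.le
        have hb2 : Btw z v (gp w u t) := hb1.trans_left_right hz
        exact N.notMem F' v ht₀ ((ch F').mem_face_of_btw hF'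
          ((N.page F' hvF').edge_subset z hze hzd) hb2.symm hzv.symm)

/-- Geodesics can be prolonged inside the closure of the enclosed set, away from the loop and the
vertices. -/
theorem exists_btw_subset_closure_encl (hγ : IsLoop γ) {u w : X} {F : PC.faces}
    (hu : u ∈ (F : Set X)) (huw : u ≠ w) (hwγ : w ∉ range γ)
    (hS : ∀ v, Btw u v w → v ∈ closure (encl ch γ)) (hv : ∀ v, Btw u v w → v ∉ PC.vertices) :
    ∃ x, x ≠ w ∧ Btw u w x ∧ ∀ v, Btw w v x → v ∈ closure (encl ch γ) := by
  have hwS := hS w (btw_right u w)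
  rcases (by rw [PC.cover]; trivial : w ∈ ⋃₀ PC.faces ∪ ⋃₀ PC.edges ∪ PC.vertices) with
    (⟨F', hF', hwF'⟩ | ⟨e, he, hwe⟩) | hw
  · have hw : w ∈ encl ch γ := mem_encl_of_mem_closure (F := ⟨F', hF'⟩) hγ hwF' hwS hwγ
    obtain ⟨ρ, hρ, hball⟩ := Metric.mem_nhds_iff.1
      (((isOpen_encl hγ).inter (PC.faces_open F' hF')).mem_nhds ⟨hw, hwF'⟩)
    obtain ⟨y, hy, hyw, hyd⟩ := exists_btw_dist_lt huw hρ
    obtain ⟨x, hxd, hx, hxw⟩ := (ch ⟨F', hF'⟩).exists_btw hwF'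
      (subset_closure (hball (mem_ball'.2 hyd)).2) hyw hρ
    exact ⟨x, hxw, hy.concat hx hyw, fun v hv => subset_closure
      (hball (hv.mem_ball (mem_ball_self hρ) (mem_ball'.2 hxd))).1⟩
  · obtain ⟨ρ, hρ, hball⟩ := Metric.mem_nhds_iff.1
      (hγ.isCompact_range.isClosed.isOpen_compl.mem_nhds hwγ)
    obtain ⟨N, hN⟩ := exists_edgeNbhd ch he hwe hρ
    have hdisj : Disjoint (ball w N.r) (range γ) :=
      disjoint_left.2 fun x hx => hball (ball_subset_ball hN hx)
    obtain ⟨x₁, hx₁, hx₁d, hx₁e⟩ := exists_notMem_edge_btw ch he hwe hu hv N.r_pos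
    obtain ⟨F₁, hF₁, -⟩ := (N.cover x₁ hx₁d).resolve_left hx₁e
    have hx₁γ : x₁ ∈ encl ch γ := mem_encl_of_mem_closure hγ hF₁ (hS _ hx₁)
      (disjoint_left.1 hdisj (mem_ball'.2 hx₁d))
    obtain ⟨F₂, hne, hwF₂, hF₂⟩ := N.exists_ne_subset_encl hγ hdisj hF₁ hx₁d hx₁γ
    obtain ⟨x, hx, hxw, hxd, hbx⟩ := N.exists_btw hF₁ hx₁d hne hwF₂
    refine ⟨x, hxw, hx₁.concat hbx fun h => hx₁e (h ▸ hwe), fun v hv => ?_⟩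
    have hvF : v ∈ closure (F₂ : Set X) := (ch F₂).mem_closure_of_btw hwF₂ hx hv
    have hvb := hv.mem_ball (mem_ball_self N.r_pos) (mem_ball'.2 hxd)
    refine closure_mono hF₂ ?_
    rw [inter_comm]
    exact isOpen_ball.inter_closure ⟨hvb, hvF⟩
  · exact absurd hw (hv w (btw_right u w))

end Cat2Cx

/-! ### Chords through enclosed points -/

namespace Cat2Cx
open Topology

theorem countable_setOf_eq_norm_mul_exp {z : ℂ} (hz : z ≠ 0) :
    {φ : ℝ | z = ‖z‖ * Complex.exp (φ * Complex.I)}.Countable := by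
  rcases eq_empty_or_nonempty {φ : ℝ | z = ‖z‖ * Complex.exp (φ * Complex.I)} with h | ⟨φ₀, h₀⟩
  · rw [h]; exact countable_empty
  · refine (countable_range fun n : ℤ => φ₀ + n * (2 * Real.pi)).mono fun φ h => ?_
    rw [mem_ofPred_eq] at h h₀
    have hn : (‖z‖ : ℂ) ≠ 0 := by simpa using hz
    obtain ⟨n, hn⟩ := Complex.exp_eq_exp_iff_exists_int.1 (mul_left_cancel₀ hn (h.symm.trans h₀))
    refine ⟨n, ?_⟩
    have := congrArg Complex.im hn
    simp at this
    linarith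

variable {κ : ℝ} {X : Type*} [MetricSpace X] {PC : PolyComplex2 κ X} {ch : Charts PC}
  {γ : ℝ → X} [CNSpace X] {F : PC.faces} {u : X} {r : ℝ}

/-- The endpoints of the geodesics which start at `u` in direction `φ` and stay in the closure of
the enclosed set. -/
def halfChord (ch : Charts PC) (γ : ℝ → X) (F : PC.faces) (u : X) (r φ : ℝ) : Set X :=
  {w | (ch F).disp u r w = ‖(ch F).disp u r w‖ * Complex.exp (φ * Complex.I) ∧
    ∀ v, Btw u v w → v ∈ closure (encl ch γ)}

theorem isClosed_setOf_mem_halfChord (hr : 0 < r) (hF : closedBall u r ⊆ F) :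
    IsClosed {q : ℝ × X | q.2 ∈ halfChord ch γ F u r q.1} := by
  have hc := (ch F).continuous_disp hr.le hF
  have h1 : IsClosed {q : ℝ × X | (ch F).disp u r q.2 =
      ‖(ch F).disp u r q.2‖ * Complex.exp (q.1 * Complex.I)} :=
    isClosed_eq (by fun_prop) (by fun_prop)
  have h2 : IsClosed {q : ℝ × X | ∀ t ∈ Icc (0 : ℝ) 1, gp u q.2 t ∈ closure (encl ch γ)} := by
    simp only [ofPred_forall]
    exact isClosed_biInter fun t ht =>
      isClosed_closure.preimage ((continuous_gp_left u ht).comp continuous_snd)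
  convert h1.inter h2 using 1
  ext q
  refine and_congr Iff.rfl ⟨fun h t ht => h _ (btw_gp u q.2 ht), fun h v hv => ?_⟩
  obtain ⟨t, ht, rfl⟩ := hv.exists_eq_gp
  exact h t ht

theorem mem_halfChord_of_btw (hr : 0 < r) (hF : closedBall u r ⊆ F) {φ : ℝ} {w v : X}
    (hw : w ∈ halfChord ch γ F u r φ) (hv : Btw u v w) : v ∈ halfChord ch γ F u r φ := by
  refine ⟨?_, fun v' hv' => hw.2 v' (hv.trans_left hv')⟩
  obtain ⟨τ, hτ, e⟩ := (ch F).exists_disp_eq_mul hr hF hv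
  rw [e, norm_mul, Complex.norm_real, Real.norm_of_nonneg hτ, Complex.ofReal_mul, mul_assoc,
    ← hw.1]

/-- In a direction which avoids the vertices, some geodesic from an enclosed point reaches the loop
inside the closure of the enclosed set. -/
theorem exists_mem_range_mem_halfChord (hγ : IsLoop γ) (hu : u ∈ encl ch γ) (hr : 0 < r)
    (hF : closedBall u r ⊆ F) {φ : ℝ}
    (hφ : Disjoint (halfChord ch γ F u r φ) PC.vertices) :
    ∃ w ∈ range γ, w ∈ halfChord ch γ F u r φ := by
  have huF : u ∈ (F : Set X) := hF (mem_closedBall_self hr.le)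
  have hcl : IsClosed (halfChord ch γ F u r φ) :=
    (isClosed_setOf_mem_halfChord hr hF).preimage (Continuous.prodMk_right φ)
  have hcomp : IsCompact (halfChord ch γ F u r φ) :=
    (isCompact_closure_encl hγ).of_isClosed_subset hcl fun w hw => hw.2 w (btw_right u w)
  obtain ⟨ρ, hρ, hball⟩ := Metric.mem_nhds_iff.1 ((isOpen_encl hγ).mem_nhds hu)
  have hlim : Tendsto (fun τ : ℝ => (τ : ℂ) * Complex.exp (φ * Complex.I)) (𝓝[>] 0) (𝓝 0) := by
    have : Continuous fun τ : ℝ => (τ : ℂ) * Complex.exp (φ * Complex.I) := by fun_prop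
    simpa using (this.tendsto 0).mono_left nhdsWithin_le_nhds
  obtain ⟨τ, ⟨x, hxF, hxd, hx⟩, hτ : 0 < τ⟩ := ((hlim.eventually
    ((ch F).eventually_exists_map_eq huF (lt_min hρ hr))).and self_mem_nhdsWithin).exists
  have hxdisp : (ch F).disp u r x = τ * Complex.exp (φ * Complex.I) := by
    rw [(ch F).disp_eq (hxd.le.trans (min_le_right _ _)), hx]
  have hxu : x ≠ u := by
    rw [Ne, ← (ch F).disp_eq_zero_iff hr hF, hxdisp]
    exact mul_ne_zero (by exact_mod_cast hτ.ne') (Complex.exp_ne_zero _)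
  have hxM : x ∈ halfChord ch γ F u r φ := by
    refine ⟨?_, fun v hv => subset_closure (hball ?_)⟩
    · rw [hxdisp, norm_mul, Complex.norm_real, Real.norm_of_nonneg hτ.le,
        Complex.norm_exp_ofReal_mul_I, mul_one]
    · exact hv.mem_ball (mem_ball_self hρ) (mem_ball'.2 (hxd.trans_le (min_le_left _ _)))
  obtain ⟨w, hwM, hmax⟩ := hcomp.exists_isMaxOn ⟨x, hxM⟩ (f := fun w => dist u w)
    (by fun_prop : Continuous fun w => dist u w).continuousOn
  have huw : u ≠ w := fun h => by
    have : dist u x ≤ dist u w := hmax hxM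
    rw [← h, dist_self] at this
    exact hxu (dist_le_zero.1 this).symm
  by_contra! hcon
  obtain ⟨y, hyw, hy, hyS⟩ := exists_btw_subset_closure_encl (ch := ch) hγ huF huw
    (fun h => hcon w h hwM) hwM.2
    (fun v hv => disjoint_left.1 hφ (mem_halfChord_of_btw hr hF hwM hv))
  have hyM : y ∈ halfChord ch γ F u r φ := by
    refine ⟨?_, fun v hv => (hy.or_of_btw hv).elim (hwM.2 v) (hyS v)⟩
    obtain ⟨τ, hτ, e⟩ := (ch F).exists_disp_eq_mul hr hF hy
    have hw0 : (ch F).disp u r w ≠ 0 := fun h => huw (((ch F).disp_eq_zero_iff hr hF w).1 h).symm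
    have hτ' : (τ : ℂ) ≠ 0 := fun h => hw0 (by rw [e, h, zero_mul])
    have h1 := hwM.1
    rw [e, norm_mul, Complex.norm_real, Real.norm_of_nonneg hτ, Complex.ofReal_mul,
      mul_assoc] at h1
    exact mul_left_cancel₀ hτ' h1
  have h1 : dist u y ≤ dist u w := hmax hyM
  rw [← (show dist u w + dist w y = dist u y from hy)] at h1
  exact hyw (dist_le_zero.1 (by linarith : dist w y ≤ 0)).symm

/-- Half chords in opposite directions combine to a chord. -/
theorem btw_of_mem_halfChord (hr : 0 < r) (hF : closedBall u r ⊆ F) {φ : ℝ} {w w' : X}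
    (hw : w ∈ halfChord ch γ F u r φ) (hw' : w' ∈ halfChord ch γ F u r (φ + Real.pi))
    (hwu : w ≠ u) (hwu' : w' ≠ u) :
    Btw w u w' ∧ ∀ v, Btw w v w' → v ∈ closure (encl ch γ) := by
  have h0 : 0 < ‖(ch F).disp u r w‖ :=
    norm_pos_iff.2 fun h => hwu (((ch F).disp_eq_zero_iff hr hF w).1 h)
  have h0' : 0 < ‖(ch F).disp u r w'‖ :=
    norm_pos_iff.2 fun h => hwu' (((ch F).disp_eq_zero_iff hr hF w').1 h)
  have hb : Btw w u w' := by
    refine (ch F).btw_of_disp_eq_neg_mul hr hF (div_pos h0 h0') hwu ?_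
    have h1 : (‖(ch F).disp u r w'‖ : ℂ) ≠ 0 := by exact_mod_cast h0'.ne'
    have h2 := hw'.1
    rw [Complex.ofReal_add, add_mul, Complex.exp_add, Complex.exp_pi_mul_I, mul_neg_one,
      mul_neg] at h2
    refine hw.1.trans (Eq.trans ?_ (congrArg (fun z => -(_ * z)) h2.symm))
    rw [Complex.ofReal_div]
    field_simp
  exact ⟨hb, fun v hv => (hb.or_of_btw hv).elim (fun h => hw.2 v h.symm) (hw'.2 v)⟩

/-- If no chord through an enclosed point joins two points of `A`, then some chord joins two points
of `B`. -/
theorem exists_chord (hγ : IsLoop γ) (hu : u ∈ encl ch γ) {A B : Set X} (hB : IsCompact B)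
    (hBγ : B ⊆ range γ) (hcover : range γ ⊆ A ∪ B)
    (hA : ∀ w ∈ A, ∀ w' ∈ A, Btw w u w' → ¬ ∀ v, Btw w v w' → v ∈ closure (encl ch γ)) :
    ∃ w ∈ B, ∃ w' ∈ B, Btw w u w' ∧ ∀ v, Btw w v w' → v ∈ closure (encl ch γ) := by
  obtain ⟨F, huF⟩ : ∃ F : PC.faces, u ∈ (F : Set X) := hu.2.imp fun F h => h.1
  obtain ⟨r, hr, hF⟩ := nhds_basis_closedBall.mem_iff.1 ((PC.faces_open F F.2).mem_nhds huF)
  have hne : ∀ w ∈ range γ, w ≠ u := fun w hw h => hu.1 (h ▸ hw)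
  set D : Set ℝ := {φ | ∃ w ∈ B, w ∈ halfChord ch γ F u r φ} with hD
  have hDc : IsClosed D := by
    have : CompactSpace B := isCompact_iff_compactSpace.1 hB
    have hcl : IsClosed {q : ℝ × B | (q.2 : X) ∈ halfChord ch γ F u r q.1} :=
      (isClosed_setOf_mem_halfChord hr hF).preimage
        (continuous_fst.prodMk (continuous_subtype_val.comp continuous_snd))
    convert isClosedMap_fst_of_compactSpace _ hcl using 1
    ext φ
    constructor
    · rintro ⟨w, hw, h⟩
      exact ⟨(φ, ⟨w, hw⟩), h, rfl⟩
    · rintro ⟨⟨φ, w⟩, h, rfl⟩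
      exact ⟨w, w.2, h⟩
  have hcont : Continuous fun φ : ℝ => φ + Real.pi := by fun_prop
  set bad : Set ℝ := {φ | ¬ Disjoint (halfChord ch γ F u r φ) PC.vertices} with hbad
  have hbadc : bad.Countable := by
    have hfin := PC.finite_vertices_inter (isCompact_closure_encl (ch := ch) hγ)
    refine (hfin.countable.biUnion (t := fun v _ => {φ : ℝ | (ch F).disp u r v =
      ‖(ch F).disp u r v‖ * Complex.exp (φ * Complex.I)}) fun v hv =>
        countable_setOf_eq_norm_mul_exp ?_).mono ?_
    · rw [Ne, (ch F).disp_eq_zero_iff hr hF]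
      rintro rfl
      have := PC.cells_vertex_disjoint F (Or.inl F.2)
      exact (this ▸ (⟨huF, hv.1⟩ : v ∈ (F : Set X) ∩ PC.vertices) : v ∈ (∅ : Set X))
    · intro φ hφ
      obtain ⟨v, hv, hv'⟩ := not_disjoint_iff.1 hφ
      exact mem_biUnion (x := v) ⟨hv', hv.2 v (btw_right u v)⟩ hv.1
  have hbadc' : ((fun φ : ℝ => φ + Real.pi) ⁻¹' bad).Countable :=
    hbadc.preimage_of_injOn (add_left_injective Real.pi).injOn
  have huniv : D ∪ (fun φ : ℝ => φ + Real.pi) ⁻¹' D = univ := by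
    rw [← (hDc.union (hDc.preimage hcont)).closure_eq]
    refine Dense.closure_eq (((hbadc.union hbadc').dense_compl ℝ).mono fun φ hφ => ?_)
    rw [mem_compl_iff, mem_union, not_or] at hφ
    obtain ⟨w, hwγ, hw⟩ := exists_mem_range_mem_halfChord hγ hu hr hF (not_not.1 hφ.1)
    obtain ⟨w', hwγ', hw'⟩ := exists_mem_range_mem_halfChord hγ hu hr hF (not_not.1 hφ.2)
    rcases hcover hwγ with hwA | hwB
    · rcases hcover hwγ' with hwA' | hwB'
      · have := btw_of_mem_halfChord hr hF hw hw' (hne _ hwγ) (hne _ hwγ')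
        exact absurd this.2 (hA w hwA w' hwA' this.1)
      · exact Or.inr ⟨w', hwB', hw'⟩
    · exact Or.inl ⟨w, hwB, hw⟩
  have hneD : D.Nonempty := by
    have h0 : (0 : ℝ) ∈ D ∪ (fun φ : ℝ => φ + Real.pi) ⁻¹' D := huniv ▸ mem_univ _
    exact h0.elim (fun h => ⟨_, h⟩) fun h => ⟨_, h⟩
  obtain ⟨φ₀, hφ₀⟩ := hneD
  obtain ⟨φ, -, ⟨w, hwB, hw⟩, ⟨w', hwB', hw'⟩⟩ := isPreconnected_closed_iff.1
    (isPreconnected_univ (α := ℝ)) _ _ hDc (hDc.preimage hcont) huniv.ge ⟨φ₀, trivial, hφ₀⟩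
    ⟨φ₀ - Real.pi, trivial, by rwa [mem_preimage, sub_add_cancel]⟩
  exact ⟨w, hwB, w', hwB', btw_of_mem_halfChord hr hF hw hw' (hne _ (hBγ hwB)) (hne _ (hBγ hwB'))⟩

end Cat2Cx

/-! ### Concatenation of paths and the path metric -/

namespace Cat2Cx
open Topology

section Concat
variable {X : Type*}

/-- The concatenation of two paths parametrized by the unit interval. -/
noncomputable def concat (f g : ℝ → X) (t : ℝ) : X :=
  if t ≤ 1 / 2 then f (max 0 (min 1 (2 * t))) else g (max 0 (min 1 (2 * t - 1)))

theorem max_min_mem_Icc (t : ℝ) : max 0 (min 1 t) ∈ Icc (0 : ℝ) 1 :=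
  ⟨le_max_left _ _, max_le zero_le_one (min_le_left _ _)⟩

theorem max_min_eq_self {t : ℝ} (ht : t ∈ Icc (0 : ℝ) 1) : max 0 (min 1 t) = t := by
  rw [min_eq_right ht.2, max_eq_right ht.1]

theorem concat_of_le {f g : ℝ → X} {t : ℝ} (h0 : 0 ≤ t) (h : t ≤ 1 / 2) :
    concat f g t = f (2 * t) := by
  rw [concat, if_pos h, max_min_eq_self ⟨by linarith, by linarith⟩]

theorem concat_of_ge {f g : ℝ → X} (hfg : f 1 = g 0) {t : ℝ} (h : 1 / 2 ≤ t) (h1 : t ≤ 1) :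
    concat f g t = g (2 * t - 1) := by
  rcases h.eq_or_lt with rfl | h
  · rw [concat_of_le (by norm_num) le_rfl]
    norm_num [hfg]
  · rw [concat, if_neg (not_le.2 h), max_min_eq_self ⟨by linarith, by linarith⟩]

theorem range_concat (f g : ℝ → X) : range (concat f g) ⊆ f '' Icc 0 1 ∪ g '' Icc 0 1 := by
  rintro _ ⟨t, rfl⟩
  unfold concat
  split_ifs
  · exact Or.inl (mem_image_of_mem f (max_min_mem_Icc _))
  · exact Or.inr (mem_image_of_mem g (max_min_mem_Icc _))

theorem image_subset_range_concat {f g : ℝ → X} (hfg : f 1 = g 0) :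
    g '' Icc 0 1 ⊆ range (concat f g) := by
  rintro _ ⟨t, ht, rfl⟩
  refine ⟨(t + 1) / 2, ?_⟩
  rw [concat_of_ge hfg (by linarith [ht.1]) (by linarith [ht.2])]
  congr 1; ring

end Concat

section PathDist
variable {X : Type*} [MetricSpace X] {E : Set X} {x y z : X}

theorem IsPathIn.comp {g : ℝ → X} (hg : IsPathIn E g x y) {φ : ℝ → ℝ} (hφ : Continuous φ)
    (hm : MapsTo φ (Icc 0 1) (Icc 0 1)) : IsPathIn E (g ∘ φ) (g (φ 0)) (g (φ 1)) :=
  ⟨hg.1.comp hφ.continuousOn hm, rfl, rfl, hg.2.2.2.comp hm⟩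

theorem pathDistIn_le {g : ℝ → X} (hg : IsPathIn E g x y) {c : ℝ} (hc : 0 ≤ c)
    (h : eVariationOn g (Icc 0 1) ≤ ENNReal.ofReal c) : pathDistIn E x y ≤ c :=
  ENNReal.toReal_le_of_le_ofReal hc ((iInf_le _ (⟨g, hg⟩ : {g // IsPathIn E g x y})).trans h)

theorem pathDistIn_le_of_dist_le {g : ℝ → X} {a b C : ℝ} (hab : a ≤ b) (hC : 0 ≤ C)
    (hg : MapsTo g (Icc a b) E)
    (h : ∀ s ∈ Icc a b, ∀ t ∈ Icc a b, dist (g s) (g t) ≤ C * |s - t|) :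
    pathDistIn E (g a) (g b) ≤ C * (b - a) := by
  have hlip : LipschitzOnWith (Real.toNNReal C) g (Icc a b) :=
    LipschitzOnWith.of_dist_le_mul fun s hs t ht => by
      rw [Real.coe_toNNReal C hC, Real.dist_eq]; exact h s hs t ht
  set φ : ℝ → ℝ := fun t => a + t * (b - a) with hφ
  have hmono : Monotone φ := fun s t hst => by
    simp only [hφ]
    have := mul_le_mul_of_nonneg_right hst (sub_nonneg.2 hab)
    linarith
  have h0 : φ 0 = a := by simp [hφ]
  have h1 : φ 1 = b := by simp [hφ]
  have hm : MapsTo φ (Icc 0 1) (Icc a b) := fun t ht =>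
    ⟨h0 ▸ hmono ht.1, h1 ▸ hmono ht.2⟩
  have hφc : Continuous φ := by fun_prop
  have hpath : IsPathIn E (g ∘ φ) (g a) (g b) :=
    ⟨hlip.continuousOn.comp hφc.continuousOn hm, by simp [h0], by simp [h1], hg.comp hm⟩
  refine pathDistIn_le hpath (mul_nonneg hC (sub_nonneg.2 hab)) ?_
  refine (hlip.comp_eVariationOn_le hm).trans ?_
  have h2 := (hmono.monotoneOn univ).eVariationOn_eq (mem_univ 0) (mem_univ 1)
  rw [univ_inter, h0, h1] at h2
  rw [ENNReal.ofReal_mul hC]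
  exact mul_le_mul_right h2.le _

theorem exists_isPathIn_of_pathDistIn_lt (hE : RectConnected E) (hx : x ∈ E) (hy : y ∈ E) {δ : ℝ}
    (h : pathDistIn E x y < δ) :
    ∃ g, IsPathIn E g x y ∧ eVariationOn g (Icc 0 1) < ENNReal.ofReal δ := by
  obtain ⟨g₀, hg₀, hfin⟩ := hE x hx y hy
  have hne : (⨅ g : {g : ℝ → X // IsPathIn E g x y}, eVariationOn g.1 (Icc 0 1)) ≠ ⊤ :=
    ne_top_of_le_ne_top hfin (iInf_le _ (⟨g₀, hg₀⟩ : {g // IsPathIn E g x y}))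
  obtain ⟨g, hg⟩ := iInf_lt_iff.1 ((ENNReal.lt_ofReal_iff_toReal_lt hne).2 h)
  exact ⟨g.1, g.2, hg⟩

theorem pathDistIn_nonneg : 0 ≤ pathDistIn E x y := ENNReal.toReal_nonneg

theorem dist_le_pathDistIn (hE : RectConnected E) (hx : x ∈ E) (hy : y ∈ E) :
    dist x y ≤ pathDistIn E x y := by
  refine le_of_forall_gt fun δ hδ => ?_
  obtain ⟨g, hg, hlt⟩ := exists_isPathIn_of_pathDistIn_lt hE hx hy hδ
  have h := eVariationOn.edist_le g (left_mem_Icc.2 (zero_le_one' ℝ)) (right_mem_Icc.2 zero_le_one)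
  rw [hg.2.1, hg.2.2.1, edist_dist] at h
  exact (ENNReal.ofReal_lt_ofReal_iff (pathDistIn_nonneg.trans_lt hδ)).1 (h.trans_lt hlt)

theorem pathDistIn_comm_le (hE : RectConnected E) (hx : x ∈ E) (hy : y ∈ E) :
    pathDistIn E y x ≤ pathDistIn E x y := by
  refine le_of_forall_gt_imp_ge_of_dense fun δ hδ => ?_
  obtain ⟨g, hg, hlt⟩ := exists_isPathIn_of_pathDistIn_lt hE hx hy hδ
  have hm : MapsTo (fun t : ℝ => 1 - t) (Icc 0 1) (Icc 0 1) := fun t ht =>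
    ⟨by linarith [ht.2], by linarith [ht.1]⟩
  have hp := hg.comp (by fun_prop) hm
  simp only [sub_zero, sub_self, hg.2.1, hg.2.2.1] at hp
  refine pathDistIn_le hp (pathDistIn_nonneg.trans hδ.le)
    ((eVariationOn.comp_le_of_antitoneOn g _ (fun s _ t _ h => ?_) hm).trans hlt.le)
  exact sub_le_sub_left h 1

theorem pathDistIn_comm (hE : RectConnected E) (hx : x ∈ E) (hy : y ∈ E) :
    pathDistIn E x y = pathDistIn E y x :=
  le_antisymm (pathDistIn_comm_le hE hy hx) (pathDistIn_comm_le hE hx hy)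

theorem continuous_concat {f g : ℝ → X} (hf : ContinuousOn f (Icc 0 1))
    (hg : ContinuousOn g (Icc 0 1)) (hfg : f 1 = g 0) : Continuous (concat f g) := by
  refine Continuous.if_le (hf.comp_continuous (by fun_prop) fun t => max_min_mem_Icc _)
    (hg.comp_continuous (by fun_prop) fun t => max_min_mem_Icc _) continuous_id continuous_const
    fun t ht => ?_
  have h1 : 2 * t = 1 := by rw [ht]; norm_num
  rw [h1]
  simpa using hfg

theorem isLoop_concat {f g : ℝ → X} (hf : ContinuousOn f (Icc 0 1))
    (hg : ContinuousOn g (Icc 0 1)) (hfg : f 1 = g 0) (hgf : g 1 = f 0) : IsLoop (concat f g) where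
  continuous := continuous_concat hf hg hfg
  eq_of_nonpos t ht := by
    rw [concat_of_le le_rfl (by norm_num), concat, if_pos (by linarith),
      max_eq_left ((min_le_right _ _).trans (by linarith)), mul_zero]
  eq_of_one_le t ht := by
    rw [concat_of_le le_rfl (by norm_num), concat, if_neg (by linarith), min_eq_left (by linarith),
      max_eq_right zero_le_one, mul_zero, hgf]

theorem IsPathIn.concat {f g : ℝ → X} (hf : IsPathIn E f x y) (hg : IsPathIn E g y z) :
    IsPathIn E (concat f g) x z := by
  have hfg : f 1 = g 0 := hf.2.2.1.trans hg.2.1.symm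
  refine ⟨(continuous_concat hf.1 hg.1 hfg).continuousOn, ?_, ?_, fun t _ => ?_⟩
  · rw [concat_of_le le_rfl (by norm_num), mul_zero, hf.2.1]
  · rw [concat_of_ge hfg (by norm_num) le_rfl]
    norm_num [hg.2.2.1]
  · rcases range_concat f g (mem_range_self t) with ⟨s, hs, h⟩ | ⟨s, hs, h⟩
    · exact h ▸ hf.2.2.2 hs
    · exact h ▸ hg.2.2.2 hs

theorem eVariationOn_concat_le {f g : ℝ → X} (hfg : f 1 = g 0) :
    eVariationOn (concat f g) (Icc 0 1) ≤ eVariationOn f (Icc 0 1) + eVariationOn g (Icc 0 1) := by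
  have h := eVariationOn.Icc_add_Icc (concat f g) (s := univ) (a := (0 : ℝ)) (b := 1 / 2) (c := 1)
    (by norm_num) (by norm_num) (mem_univ _)
  simp only [univ_inter] at h
  rw [← h]
  refine add_le_add ?_ ?_
  · rw [eVariationOn.congr (g := f ∘ fun t => 2 * t) fun t ht => concat_of_le ht.1 ht.2]
    refine eVariationOn.comp_le_of_monotoneOn f _ (fun s _ t _ hst => ?_) fun t ht => ?_
    · simpa using hst
    · exact ⟨by linarith [ht.1], by linarith [ht.2]⟩
  · rw [eVariationOn.congr (g := g ∘ fun t => 2 * t - 1) fun t ht => concat_of_ge hfg ht.1 ht.2]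
    refine eVariationOn.comp_le_of_monotoneOn g _ (fun s _ t _ hst => ?_) fun t ht => ?_
    · simpa using hst
    · exact ⟨by linarith [ht.1], by linarith [ht.2]⟩

theorem pathDistIn_triangle (hE : RectConnected E) (hx : x ∈ E) (hy : y ∈ E) (hz : z ∈ E) :
    pathDistIn E x z ≤ pathDistIn E x y + pathDistIn E y z := by
  refine le_of_forall_pos_le_add fun ε hε => ?_
  obtain ⟨f, hf, hfl⟩ := exists_isPathIn_of_pathDistIn_lt hE hx hy
    (lt_add_of_pos_right _ (half_pos hε))
  obtain ⟨g, hg, hgl⟩ := exists_isPathIn_of_pathDistIn_lt hE hy hz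
    (lt_add_of_pos_right _ (half_pos hε))
  have h0 := pathDistIn_nonneg (E := E) (x := x) (y := y)
  have h1 := pathDistIn_nonneg (E := E) (x := y) (y := z)
  refine pathDistIn_le (hf.concat hg) (by positivity)
    ((eVariationOn_concat_le (hf.2.2.1.trans hg.2.1.symm)).trans
      ((add_le_add hfl.le hgl.le).trans ?_))
  rw [← ENNReal.ofReal_add (by positivity) (by positivity)]
  exact ENNReal.ofReal_le_ofReal (by linarith)

theorem pathDistIn_le_of_eVariationOn_le {g : ℝ → X} (hg : IsPathIn E g x y) {δ : ℝ} (hδ : 0 ≤ δ)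
    (h : eVariationOn g (Icc 0 1) ≤ ENNReal.ofReal δ) {t : ℝ} (ht : t ∈ Icc (0 : ℝ) 1) :
    pathDistIn E x (g t) ≤ δ := by
  have hm : MapsTo (fun s : ℝ => s * t) (Icc 0 1) (Icc 0 1) := fun s hs =>
    ⟨mul_nonneg hs.1 ht.1, mul_le_one₀ hs.2 ht.1 ht.2⟩
  have hp := hg.comp (by fun_prop) hm
  simp only [zero_mul, one_mul, hg.2.1] at hp
  exact pathDistIn_le hp hδ ((eVariationOn.comp_le_of_monotoneOn g _
    (fun s _ s' _ hs => mul_le_mul_of_nonneg_right hs ht.1) hm).trans h)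

end PathDist
end Cat2Cx

/-! ### Geodesics bound the enclosed set -/

namespace Cat2Cx
open Topology

theorem exists_hasDerivAt_ne_zero {ψ : ℝ → ℂ} {C : NNReal} {c d : ℝ} (hcd : c < d)
    (h : LipschitzOnWith C ψ (Icc c d)) (hne : ψ c ≠ ψ d) :
    ∃ t ∈ Ioo c d, ∃ D ≠ 0, HasDerivAt ψ D t := by
  by_contra! hcon
  have hac : AbsolutelyContinuousOnInterval ψ c d :=
    LipschitzOnWith.absolutelyContinuousOnInterval (by rwa [uIcc_of_le hcd.le])
  have hae : ∀ᵐ x, x ∈ uIcc c d → HasDerivAt ψ 0 x := by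
    have hc : ∀ᵐ x : ℝ, x ≠ c := by simp [MeasureTheory.ae_iff]
    have hd : ∀ᵐ x : ℝ, x ≠ d := by simp [MeasureTheory.ae_iff]
    filter_upwards [(MeasureTheory.ae_restrict_iff' measurableSet_Icc).1
      (h.ae_differentiableWithinAt_real measurableSet_Icc), hc, hd] with x hx hxc hxd hxm
    rw [uIcc_of_le hcd.le] at hxm
    have hxo : x ∈ Ioo c d := ⟨lt_of_le_of_ne hxm.1 hxc.symm, lt_of_le_of_ne hxm.2 hxd⟩
    have hder := ((hx hxm).differentiableAt (Icc_mem_nhds hxo.1 hxo.2)).hasDerivAt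
    by_cases h0 : deriv ψ x = 0
    · rwa [h0] at hder
    · exact absurd hder (hcon x hxo _ h0)
  obtain ⟨K, hK⟩ := hac.const_of_ae_hasDerivAt_zero hae
  exact hne ((hK c left_mem_uIcc).trans (hK d right_mem_uIcc).symm)

theorem exists_re_mul_pos_of_hasDerivAt {ψ : ℝ → ℂ} {D : ℂ} (hD : D ≠ 0) {t₀ : ℝ}
    (h : HasDerivAt ψ D t₀) : ∃ a : ℂ, a ≠ 0 ∧ ∃ η > 0,
      (∀ t ∈ Ioo (t₀ - η) t₀, (a * (ψ t - ψ t₀)).re < 0) ∧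
      ∀ t ∈ Ioo t₀ (t₀ + η), 0 < (a * (ψ t - ψ t₀)).re := by
  refine ⟨starRingEnd ℂ D, by simpa using hD, ?_⟩
  have hlim := hasDerivAt_iff_tendsto_slope.1 h
  have hc : Continuous fun z : ℂ => (starRingEnd ℂ D * z).re := by fun_prop
  have hpos : 0 < (starRingEnd ℂ D * D).re := by
    rw [mul_comm, Complex.mul_conj, Complex.ofReal_re]
    exact Complex.normSq_pos.2 hD
  have hev := ((hc.tendsto D).comp hlim).eventually (lt_mem_nhds hpos)
  rw [eventually_nhdsWithin_iff, Metric.eventually_nhds_iff] at hev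
  obtain ⟨η, hη, hev⟩ := hev
  have key : ∀ t, dist t t₀ < η → t ≠ t₀ → 0 < (t - t₀)⁻¹ * (starRingEnd ℂ D * (ψ t - ψ t₀)).re := by
    intro t ht htne
    have := hev ht htne
    rw [Function.comp, slope_def_module, mul_smul_comm, Complex.smul_re, smul_eq_mul] at this
    exact this
  refine ⟨η, hη, fun t ht => ?_, fun t ht => ?_⟩
  · have h1 := key t (by rw [Real.dist_eq, abs_lt]; constructor <;> linarith [ht.1, ht.2]) ht.2.ne
    exact neg_of_mul_pos_right h1 (inv_nonpos.2 (by linarith [ht.2]))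
  · have h1 := key t (by rw [Real.dist_eq, abs_lt]; constructor <;> linarith [ht.1, ht.2]) ht.1.ne'
    exact pos_of_mul_pos_right h1 (inv_nonneg.2 (by linarith [ht.1]))

theorem concat_eq_iff {X : Type*} {f g : ℝ → X} (hinj : InjOn f (Icc 0 1)) (hfg : f 1 = g 0) {t₀ : ℝ}
    (ht₀ : t₀ ∈ Icc (0 : ℝ) 1) (h0 : f t₀ ≠ f 0) (hR : f t₀ ∉ g '' Icc 0 1) (t : ℝ) :
    concat f g t = f t₀ ↔ t = t₀ / 2 := by
  have h1 : f t₀ ≠ f 1 := fun h => hR ⟨0, ⟨le_rfl, zero_le_one⟩, (h.trans hfg).symm⟩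
  constructor
  · intro h
    unfold concat at h
    split_ifs at h
    · have h2 := hinj (max_min_mem_Icc _) ht₀ h
      have h3 : t₀ ≠ 0 := fun h => h0 (by rw [h])
      have h4 : t₀ ≠ 1 := fun h => h1 (by rw [h])
      grind
    · exact absurd ⟨_, max_min_mem_Icc _, h⟩ hR
  · rintro rfl
    rw [concat_of_le (by linarith [ht₀.1]) (by linarith [ht₀.2])]
    congr 1; ring

section Geodesic
variable {X : Type*} [MetricSpace X] {E : Set X} {a b : X} {f : ℝ → X}

theorem IsConstSpeedYGeodesic.dist_le (hf : IsConstSpeedYGeodesic E f a b) (hE : RectConnected E)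
    {s t : ℝ} (hs : s ∈ Icc (0 : ℝ) 1) (ht : t ∈ Icc (0 : ℝ) 1) :
    dist (f s) (f t) ≤ pathDistIn E a b * |s - t| :=
  (dist_le_pathDistIn hE (hf.2.2.1 hs) (hf.2.2.1 ht)).trans (hf.2.2.2 s hs t ht).le

theorem IsConstSpeedYGeodesic.lipschitzOnWith (hf : IsConstSpeedYGeodesic E f a b)
    (hE : RectConnected E) : LipschitzOnWith (Real.toNNReal (pathDistIn E a b)) f (Icc 0 1) :=
  LipschitzOnWith.of_dist_le_mul fun s hs t ht => by
    rw [Real.coe_toNNReal _ pathDistIn_nonneg, Real.dist_eq]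
    exact hf.dist_le hE hs ht

theorem IsConstSpeedYGeodesic.injOn (hf : IsConstSpeedYGeodesic E f a b)
    (h : pathDistIn E a b ≠ 0) : InjOn f (Icc 0 1) := by
  intro s hs t ht hst
  have h1 := hf.2.2.2 s hs t ht
  have h2 := hf.2.2.2 s hs s hs
  rw [← hst, h2, sub_self, abs_zero, mul_zero] at h1
  exact sub_eq_zero.1 (abs_eq_zero.1 ((mul_eq_zero.1 h1.symm).resolve_left h))

end Geodesic

variable {κ : ℝ} {X : Type*} [MetricSpace X] {PC : PolyComplex2 κ X} {ch : Charts PC}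
  [CNSpace X] {E : Set X} {a b : X} {f g : ℝ → X}

/-- A geodesic of `E` lies in the closure of the set enclosed by the geodesic and a return path,
outside the return path. -/
theorem IsConstSpeedYGeodesic.mem_closure_encl (hf : IsConstSpeedYGeodesic E f a b)
    (hE : RectConnected E) (hg : IsPathIn E g b a) {t₁ : ℝ} (ht₁ : t₁ ∈ Icc (0 : ℝ) 1)
    (hR : f t₁ ∉ g '' Icc 0 1) : f t₁ ∈ closure (encl ch (concat f g)) := by
  by_contra hcl
  have hfg : f 1 = g 0 := hf.2.1.trans hg.2.1.symm
  have hgf : g 1 = f 0 := hg.2.2.1.trans hf.1.symm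
  have hfc : ContinuousOn f (Icc 0 1) := (hf.lipschitzOnWith hE).continuousOn
  have hγ := isLoop_concat hfc hg.1 hfg hgf
  have hRc : IsCompact (g '' Icc 0 1) := isCompact_Icc.image_of_continuousOn hg.1
  have h0R : f 0 ∈ g '' Icc 0 1 := ⟨1, ⟨zero_le_one, le_rfl⟩, hgf⟩
  have h1R : f 1 ∈ g '' Icc 0 1 := ⟨0, ⟨le_rfl, zero_le_one⟩, hfg.symm⟩
  have hl : pathDistIn E a b ≠ 0 := fun h => hR <| by
    have := hf.dist_le hE ht₁ ⟨le_rfl, zero_le_one⟩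
    rw [h, zero_mul] at this
    rwa [dist_le_zero.1 this]
  have hinj := hf.injOn hl
  have ht₁' : t₁ ∈ Ioo (0 : ℝ) 1 :=
    ⟨lt_of_le_of_ne ht₁.1 fun h => hR (h ▸ h0R), lt_of_le_of_ne ht₁.2 fun h => hR (h ▸ h1R)⟩
  have hcat : ∀ t ∈ Ioo (0 : ℝ) 1, ContinuousAt f t := fun t ht =>
    hfc.continuousAt (Icc_mem_nhds ht.1 ht.2)
  have hev : ∀ᶠ t in 𝓝 t₁, t ∈ Ioo (0 : ℝ) 1 ∧ f t ∉ g '' Icc 0 1 ∧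
      f t ∉ closure (encl ch (concat f g)) :=
    Eventually.and (Ioo_mem_nhds ht₁'.1 ht₁'.2)
      (((hcat t₁ ht₁').eventually (hRc.isClosed.isOpen_compl.mem_nhds hR)).and
        ((hcat t₁ ht₁').eventually (isClosed_closure.isOpen_compl.mem_nhds hcl)))
  obtain ⟨ρ, hρ, hball⟩ := Metric.eventually_nhds_iff_ball.1 hev
  set J := ball t₁ ρ with hJ
  have honce : ∀ t₀ ∈ J, ∀ t, concat f g t = f t₀ ↔ t = t₀ / 2 := fun t₀ ht₀ =>
    concat_eq_iff hinj hfg (Ioo_subset_Icc_self (hball _ ht₀).1)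
      (fun h => (hball _ ht₀).2.1 (h ▸ h0R)) (hball _ ht₀).2.1
  have hval : ∀ t ∈ Ioo (0 : ℝ) (1 / 2), concat f g t = f (2 * t) := fun t ht =>
    concat_of_le ht.1.le ht.2.le
  have hmid : ∀ t₀ ∈ J, concat f g (t₀ / 2) = f t₀ := fun t₀ ht₀ => ((honce t₀ ht₀ _).2 rfl)
  have hhalf : ∀ t₀ ∈ J, t₀ / 2 ∈ Ioo (0 : ℝ) 1 := fun t₀ ht₀ =>
    ⟨by linarith [(hball _ ht₀).1.1], by linarith [(hball _ ht₀).1.2]⟩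
  by_cases hface : ∃ t₂ ∈ J, ∃ F : PC.faces, f t₂ ∈ (F : Set X)
  · obtain ⟨t₂, ht₂, F, hF⟩ := hface
    have hev2 : ∀ᶠ t in 𝓝 t₂, t ∈ J ∧ f t ∈ (F : Set X) :=
      Eventually.and (isOpen_ball.mem_nhds ht₂) ((hcat t₂ (hball _ ht₂).1).eventually
        ((PC.faces_open F F.2).mem_nhds hF))
    obtain ⟨ε, hε, hεb⟩ := Metric.eventually_nhds_iff_ball.1 hev2
    have hIcc : Icc t₂ (t₂ + ε / 2) ⊆ ball t₂ ε := fun t ht => by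
      rw [mem_ball, Real.dist_eq, abs_lt]
      constructor <;> linarith [ht.1, ht.2]
    obtain ⟨C, hC⟩ := (ch F).lipschitz
    have hlip : LipschitzOnWith (C * Real.toNNReal (pathDistIn E a b)) (fun t => (ch F).toFun (f t))
        (Icc t₂ (t₂ + ε / 2)) :=
      hC.comp ((hf.lipschitzOnWith hE).mono fun t ht =>
        Ioo_subset_Icc_self (hball _ (hεb _ (hIcc ht)).1).1)
        fun t ht => subset_closure (hεb _ (hIcc ht)).2
    have hm : ∀ t ∈ Icc t₂ (t₂ + ε / 2), t ∈ J ∧ f t ∈ (F : Set X) := fun t ht => hεb _ (hIcc ht)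
    have hlt : t₂ < t₂ + ε / 2 := by linarith
    obtain ⟨t₀, ht₀, D, hD, hder⟩ := exists_hasDerivAt_ne_zero hlt hlip fun h => by
      have h1 := (ch F).injOn (subset_closure (hm _ (left_mem_Icc.2 hlt.le)).2)
        (subset_closure (hm _ (right_mem_Icc.2 hlt.le)).2) h
      exact hlt.ne (hinj (Ioo_subset_Icc_self (hball _ (hm _ (left_mem_Icc.2 hlt.le)).1).1)
        (Ioo_subset_Icc_self (hball _ (hm _ (right_mem_Icc.2 hlt.le)).1).1) h1)
    obtain ⟨α, hα, η, hη, hneg, hpos⟩ := exists_re_mul_pos_of_hasDerivAt hD hder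
    obtain ⟨ht₀J, ht₀F⟩ := hm t₀ (Ioo_subset_Icc_self ht₀)
    have ht₀I := (hball _ ht₀J).1
    refine (hball _ ht₀J).2.2 ?_
    rw [← hmid t₀ ht₀J]
    set η' := min (η / 2) (min (t₀ / 2) ((1 - t₀) / 2)) with hη'
    have e1 : η' ≤ η / 2 := min_le_left _ _
    have e2 : η' ≤ t₀ / 2 := (min_le_right _ _).trans (min_le_left _ _)
    have e3 : η' ≤ (1 - t₀) / 2 := (min_le_right _ _).trans (min_le_right _ _)
    have e0 : 0 < η' := lt_min (by linarith)
      (lt_min (by linarith [ht₀I.1]) (by linarith [ht₀I.2]))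
    refine mem_closure_encl_of_crossing hγ (hhalf t₀ ht₀J) (by rwa [hmid t₀ ht₀J])
      (fun t => by rw [hmid t₀ ht₀J]; exact honce t₀ ht₀J t) hα e0 (fun t ht => ?_) fun t ht => ?_
    · rw [hmid t₀ ht₀J, hval t ⟨by linarith [ht.1], by linarith [ht.2, ht₀I.2]⟩]
      exact hneg _ ⟨by linarith [ht.1], by linarith [ht.2]⟩
    · rw [hmid t₀ ht₀J, hval t ⟨by linarith [ht.1, ht₀I.1], by linarith [ht.2]⟩]
      exact hpos _ ⟨by linarith [ht.1], by linarith [ht.2]⟩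
  · push Not at hface
    obtain ⟨t₂, ht₂, hv⟩ : ∃ t₂ ∈ J, f t₂ ∉ PC.vertices := by
      by_contra! hcon
      have hfin := PC.finite_vertices_inter (isCompact_Icc.image_of_continuousOn hfc)
      have hJI : J ⊆ Icc 0 1 := fun t ht => Ioo_subset_Icc_self (hball _ ht).1
      have hJfin : J.Finite := Finite.of_finite_image (f := f) (hfin.subset fun x hx => by
        obtain ⟨t, ht, rfl⟩ := hx
        exact ⟨hcon t ht, mem_image_of_mem f (hJI ht)⟩) (hinj.mono hJI)
      exact infinite_of_mem_nhds t₁ (ball_mem_nhds t₁ hρ) hJfin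
    obtain ⟨e, he, hwe⟩ : ∃ e ∈ PC.edges, f t₂ ∈ e := by
      rcases (by rw [PC.cover]; trivial : f t₂ ∈ ⋃₀ PC.faces ∪ ⋃₀ PC.edges ∪ PC.vertices) with
        (⟨F, hF, h⟩ | h) | h
      · exact absurd h (hface t₂ ht₂ ⟨F, hF⟩)
      · exact h
      · exact absurd h hv
    obtain ⟨N, -⟩ := exists_edgeNbhd ch he hwe one_pos
    have hev2 : ∀ᶠ t in 𝓝 t₂, t ∈ J ∧ f t ∈ e := by
      filter_upwards [isOpen_ball.mem_nhds ht₂, (hcat t₂ (hball _ ht₂).1).eventually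
        (ball_mem_nhds _ N.r_pos)] with t htJ htb
      refine ⟨htJ, (N.cover _ (mem_ball'.1 htb)).resolve_right ?_⟩
      rintro ⟨F, hF, -⟩
      exact hface t htJ F hF
    obtain ⟨ε, hε, hεb⟩ := Metric.eventually_nhds_iff_ball.1 hev2
    have hsub : ∀ t ∈ Ioo (t₂ / 2 - ε / 2) (t₂ / 2 + ε / 2), 2 * t ∈ ball t₂ ε := fun t ht => by
      rw [mem_ball, Real.dist_eq, abs_lt]
      constructor <;> linarith [ht.1, ht.2]
    have hval' : ∀ t ∈ Ioo (t₂ / 2 - ε / 2) (t₂ / 2 + ε / 2), concat f g t = f (2 * t) := by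
      intro t ht
      have := (hball _ (hεb _ (hsub t ht)).1).1
      exact hval t ⟨by linarith [this.1], by linarith [this.2]⟩
    refine (hball _ ht₂).2.2 (N.mem_closure_encl hγ (hhalf t₂ ht₂) (hmid t₂ ht₂) (honce t₂ ht₂)
      (half_pos hε) (fun s hs t ht hst => ?_) fun t ht => ?_)
    · rw [hval' s hs, hval' t ht] at hst
      have := hinj (Ioo_subset_Icc_self (hball _ (hεb _ (hsub s hs)).1).1)
        (Ioo_subset_Icc_self (hball _ (hεb _ (hsub t ht)).1).1) hst
      linarith
    · rw [hval' t ht]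
      exact (hεb _ (hsub t ht)).2

end Cat2Cx

/-! ### Closeness and convergence of geodesics -/

namespace Cat2Cx
open Topology

variable {X : Type*} [MetricSpace X] [CNSpace X] {E : Set X}

theorem pathDistIn_le_dist_of_btw {x y : X} (h : ∀ v, Btw x v y → v ∈ E) :
    pathDistIn E x y ≤ dist x y := by
  have := pathDistIn_le_of_dist_le (E := E) (g := gp x y) zero_le_one (dist_nonneg (x := x) (y := y))
    (fun t ht => h _ (btw_gp x y ht))
    (fun s hs t ht => ((dist_gp_gp x y hs ht).trans (mul_comm _ _)).le)
  simpa using this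

theorem IsConstSpeedYGeodesic.mem_image_of_btw {a b u w w' : X} {f : ℝ → X}
    (hf : IsConstSpeedYGeodesic E f a b) (hE : RectConnected E) (hw : w ∈ f '' Icc 0 1)
    (hw' : w' ∈ f '' Icc 0 1) (hu : Btw w u w') (h : pathDistIn E w w' ≤ dist w w') :
    u ∈ f '' Icc 0 1 := by
  obtain ⟨s, hs, rfl⟩ := hw
  obtain ⟨t, ht, rfl⟩ := hw'
  obtain ⟨θ, hθ, rfl⟩ := hu.exists_eq_gp
  have hm : s + θ * (t - s) ∈ Icc (0 : ℝ) 1 := by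
    constructor <;> nlinarith [hs.1, hs.2, ht.1, ht.2, hθ.1, hθ.2]
  refine ⟨_, hm, ?_⟩
  rw [hf.2.2.2 s hs t ht] at h
  have h1 := hf.dist_le hE hs hm
  have h2 := hf.dist_le hE hm ht
  rw [show s - (s + θ * (t - s)) = θ * (s - t) by ring, abs_mul, abs_of_nonneg hθ.1] at h1
  rw [show s + θ * (t - s) - t = (1 - θ) * (s - t) by ring, abs_mul,
    abs_of_nonneg (sub_nonneg.2 hθ.2)] at h2
  have h3 := dist_triangle (f s) (f (s + θ * (t - s))) (f t)
  have h4 := mul_le_mul_of_nonneg_left h hθ.1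
  have h5 := mul_le_mul_of_nonneg_left h (sub_nonneg.2 hθ.2)
  refine Btw.eq_gp (le_antisymm ?_ h3) hθ ?_ <;> linarith

/-- Every geodesic of `E` lies in the closure of the union of the chords in `E` between points of
a path with the same endpoints. -/
theorem IsConstSpeedYGeodesic.mem_closure_chords {κ : ℝ} {PC : PolyComplex2 κ X} (ch : Charts PC)
    {a b : X} {f g : ℝ → X} (hf : IsConstSpeedYGeodesic E f a b) (hEc : IsClosed E)
    (hE : RectConnected E) (hH : H1Trivial E) (hg : IsPathIn E g b a) {t : ℝ}
    (ht : t ∈ Icc (0 : ℝ) 1) :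
    f t ∈ closure {u | ∃ w ∈ g '' Icc 0 1, ∃ w' ∈ g '' Icc 0 1, Btw w u w' ∧
      pathDistIn E w w' ≤ dist w w'} := by
  by_cases hR : f t ∈ g '' Icc 0 1
  · refine subset_closure ⟨f t, hR, f t, hR, by simp [Btw], pathDistIn_le_dist_of_btw fun v hv => ?_⟩
    have : dist (f t) v = 0 := by
      have := hv.symm ▸ dist_self (f t)
      linarith [dist_nonneg (x := f t) (y := v), dist_nonneg (x := v) (y := f t)]
    exact dist_eq_zero.1 this ▸ hf.2.2.1 ht
  have hfg : f 1 = g 0 := hf.2.1.trans hg.2.1.symm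
  have hγ : IsLoop (concat f g) := isLoop_concat (hf.lipschitzOnWith hE).continuousOn hg.1 hfg
    (hg.2.2.1.trans hf.1.symm)
  have hcl : closure (encl ch (concat f g)) ⊆ E := by
    refine closure_minimal (encl_subset hH hγ fun t => ?_) hEc
    rcases range_concat f g (mem_range_self t) with ⟨s, hs, h⟩ | ⟨s, hs, h⟩
    exacts [h ▸ hf.2.2.1 hs, h ▸ hg.2.2.2 hs]
  refine closure_mono (fun u hu => ?_) (hf.mem_closure_encl (ch := ch) hE hg ht hR)
  obtain ⟨w, hw, w', hw', hb, hch⟩ := exists_chord hγ hu (A := f '' Icc 0 1)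
    (isCompact_Icc.image_of_continuousOn hg.1) (image_subset_range_concat hfg) (range_concat f g)
    fun w hw w' hw' hb hch => by
      obtain ⟨s, hs, rfl⟩ := hf.mem_image_of_btw hE hw hw' hb
        (pathDistIn_le_dist_of_btw fun v hv => hcl (hch v hv))
      refine hu.1 ⟨s / 2, ?_⟩
      rw [concat_of_le (by linarith [hs.1]) (by linarith [hs.2]), mul_div_cancel₀ _ two_ne_zero]
  exact ⟨w, hw, w', hw', hb, pathDistIn_le_dist_of_btw fun v hv => hcl (hch v hv)⟩

/-- A chord of `E` whose endpoints are close to a geodesic of `E` is close to that geodesic. -/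
theorem IsConstSpeedYGeodesic.exists_dist_sq_le {p q r r' u : X} {σ : ℝ → X} {δ s s' : ℝ}
    (hσ : IsConstSpeedYGeodesic E σ p q) (hE : RectConnected E) (hr : r ∈ E) (hr' : r' ∈ E)
    (hs : s ∈ Icc (0 : ℝ) 1) (hs' : s' ∈ Icc (0 : ℝ) 1) (hrs : pathDistIn E r (σ s) ≤ δ)
    (hrs' : pathDistIn E r' (σ s') ≤ δ) (hu : Btw r u r') (h : pathDistIn E r r' ≤ dist r r') :
    ∃ t ∈ Icc (0 : ℝ) 1, dist (σ t) u ^ 2 ≤ 12 * δ * (pathDistIn E p q + 2 * δ) + 9 * δ ^ 2 := by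
  obtain ⟨θ, hθ, rfl⟩ := hu.exists_eq_gp
  have hm : s + θ * (s' - s) ∈ Icc (0 : ℝ) 1 := by
    constructor <;> nlinarith [hs.1, hs.2, hs'.1, hs'.2, hθ.1, hθ.2]
  refine ⟨_, hm, (dist_gp_sq_le r r' _ hθ).trans ?_⟩
  have hδ : 0 ≤ δ := pathDistIn_nonneg.trans hrs
  have hE1 := hσ.2.2.1 hs
  have hE2 := hσ.2.2.1 hs'
  have hL : pathDistIn E p q * |s - s'| ≤ dist r r' + 2 * δ := by
    rw [← hσ.2.2.2 s hs s' hs']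
    have h1 := pathDistIn_triangle hE hE1 hr hE2
    have h2 := pathDistIn_triangle hE hr hr' hE2
    rw [pathDistIn_comm hE hE1 hr] at h1
    linarith
  have hd := (dist_le_pathDistIn hE hr hE1).trans hrs
  have hd' := (dist_le_pathDistIn hE hr' hE2).trans hrs'
  have hL' : dist r r' ≤ pathDistIn E p q + 2 * δ := by
    have h1 := dist_triangle4 r (σ s) (σ s') r'
    have h2 := hσ.dist_le hE hs hs'
    have h3 : |s - s'| ≤ 1 := by
      rw [abs_le]; constructor <;> linarith [hs.1, hs.2, hs'.1, hs'.2]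
    have h4 := mul_le_mul_of_nonneg_left h3 (pathDistIn_nonneg (E := E) (x := p) (y := q))
    rw [dist_comm (σ s')] at h1
    linarith
  have h1 := hσ.dist_le hE hs hm
  have h2 := hσ.dist_le hE hs' hm
  rw [show s - (s + θ * (s' - s)) = θ * (s - s') by ring, abs_mul, abs_of_nonneg hθ.1] at h1
  rw [show s' - (s + θ * (s' - s)) = -((1 - θ) * (s - s')) by ring, abs_neg, abs_mul,
    abs_of_nonneg (sub_nonneg.2 hθ.2)] at h2
  have h3 := mul_le_mul_of_nonneg_left hL hθ.1
  have h4 := mul_le_mul_of_nonneg_left hL (sub_nonneg.2 hθ.2)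
  set m := σ (s + θ * (s' - s))
  have h5 : dist r m ≤ θ * dist r r' + 3 * δ := by
    nlinarith [dist_triangle r (σ s) m, hθ.2]
  have h6 : dist r' m ≤ (1 - θ) * dist r r' + 3 * δ := by
    nlinarith [dist_triangle r' (σ s') m, hθ.1]
  have h7 := mul_le_mul_of_nonneg_left (pow_le_pow_left₀ dist_nonneg h5 2) (sub_nonneg.2 hθ.2)
  have h8 := mul_le_mul_of_nonneg_left (pow_le_pow_left₀ dist_nonneg h6 2) hθ.1
  have h9 : θ * (1 - θ) * (12 * δ * dist r r') ≤ 1 * (12 * δ * dist r r') :=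
    mul_le_mul_of_nonneg_right (by nlinarith [sq_nonneg (θ - 1 / 2)]) (by positivity)
  have h10 := mul_le_mul_of_nonneg_left hL' (show 0 ≤ 12 * δ by positivity)
  nlinarith

/-- Geodesics of `E` with nearby endpoints are close in the metric of `X`. -/
theorem IsConstSpeedYGeodesic.exists_dist_lt {κ : ℝ} {PC : PolyComplex2 κ X} (ch : Charts PC)
    {a b p q : X} {f σ : ℝ → X} {δ ε : ℝ} (hf : IsConstSpeedYGeodesic E f a b)
    (hσ : IsConstSpeedYGeodesic E σ p q) (hEc : IsClosed E) (hE : RectConnected E)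
    (hH : H1Trivial E) (hap : pathDistIn E a p < δ) (hbq : pathDistIn E b q < δ) (hε : 0 < ε)
    (hδε : 12 * δ * (pathDistIn E p q + 2 * δ) + 9 * δ ^ 2 ≤ (ε / 2) ^ 2) {t : ℝ}
    (ht : t ∈ Icc (0 : ℝ) 1) : ∃ s ∈ Icc (0 : ℝ) 1, dist (f t) (σ s) < ε := by
  have hδ : 0 ≤ δ := pathDistIn_nonneg.trans hap.le
  have h0 : (0 : ℝ) ∈ Icc (0 : ℝ) 1 := ⟨le_rfl, zero_le_one⟩
  have h1 : (1 : ℝ) ∈ Icc (0 : ℝ) 1 := ⟨zero_le_one, le_rfl⟩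
  have ha : a ∈ E := hf.1 ▸ hf.2.2.1 h0
  have hb : b ∈ E := hf.2.1 ▸ hf.2.2.1 h1
  have hp : p ∈ E := hσ.1 ▸ hσ.2.2.1 h0
  have hq : q ∈ E := hσ.2.1 ▸ hσ.2.2.1 h1
  rw [pathDistIn_comm hE ha hp] at hap
  rw [pathDistIn_comm hE hb hq] at hbq
  obtain ⟨α, hα, hαδ⟩ := exists_isPathIn_of_pathDistIn_lt hE hp ha hap
  obtain ⟨β, hβ, hβδ⟩ := exists_isPathIn_of_pathDistIn_lt hE hq hb hbq
  have hm : MapsTo (fun t : ℝ => 1 - t) (Icc 0 1) (Icc 0 1) := fun t ht =>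
    ⟨by linarith [ht.2], by linarith [ht.1]⟩
  have hφ : Continuous fun t : ℝ => 1 - t := by fun_prop
  have hβ' := hβ.comp hφ hm
  have hσp : IsPathIn E σ p q :=
    ⟨(hσ.lipschitzOnWith hE).continuousOn, hσ.1, hσ.2.1, hσ.2.2.1⟩
  have hσ' := hσp.comp hφ hm
  simp only [sub_zero, sub_self, hβ.2.1, hβ.2.2.1] at hβ'
  simp only [sub_zero, sub_self, hσ.1, hσ.2.1] at hσ'
  have hR := hβ'.concat (hσ'.concat hα)
  have hnear : ∀ r ∈ concat (β ∘ fun t => 1 - t) (concat (σ ∘ fun t => 1 - t) α) '' Icc 0 1,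
      r ∈ E ∧ ∃ s ∈ Icc (0 : ℝ) 1, pathDistIn E r (σ s) ≤ δ := by
    rintro r ⟨x, hx, rfl⟩
    have hxE := hR.2.2.2 hx
    refine ⟨hxE, ?_⟩
    rcases range_concat _ _ (mem_range_self x) with ⟨y, hy, h⟩ | ⟨y, hy, h⟩
    · rw [← h]
      refine ⟨1, h1, ?_⟩
      rw [hσ.2.1, pathDistIn_comm hE (h ▸ hxE) hq]
      exact pathDistIn_le_of_eVariationOn_le hβ hδ hβδ.le (hm hy)
    rcases range_concat _ _ (mem_range_self y) with ⟨z, hz, h'⟩ | ⟨z, hz, h'⟩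
    · rw [← h, ← h']
      refine ⟨1 - z, hm hz, ?_⟩
      rw [Function.comp, hσ.2.2.2 _ (hm hz) _ (hm hz), sub_self, abs_zero, mul_zero]
      exact hδ
    · rw [← h, ← h']
      refine ⟨0, h0, ?_⟩
      rw [hσ.1, pathDistIn_comm hE (hα.2.2.2 hz) hp]
      exact pathDistIn_le_of_eVariationOn_le hα hδ hαδ.le hz
  obtain ⟨u, ⟨r, hr, r', hr', hu, hch⟩, hd⟩ := Metric.mem_closure_iff.1
    (hf.mem_closure_chords ch hEc hE hH hR ht) (ε / 2) (half_pos hε)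
  obtain ⟨hrE, s, hs, hrs⟩ := hnear r hr
  obtain ⟨hrE', s', hs', hrs'⟩ := hnear r' hr'
  obtain ⟨m, hmI, hdm⟩ := hσ.exists_dist_sq_le hE hrE hrE' hs hs' hrs hrs' hu hch
  refine ⟨m, hmI, ?_⟩
  have h2 := le_of_sq_le_sq (hdm.trans hδε) (half_pos hε).le
  have h3 := dist_triangle_right (f t) (σ m) u
  linarith

end Cat2Cx

namespace Cat2Cx
open Topology

variable {X : Type*} [MetricSpace X] {E : Set X}

theorem abs_pathDistIn_sub_le (hE : RectConnected E) {a b p q : X} (ha : a ∈ E) (hb : b ∈ E)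
    (hp : p ∈ E) (hq : q ∈ E) :
    |pathDistIn E a b - pathDistIn E p q| ≤ pathDistIn E a p + pathDistIn E b q := by
  rw [abs_le]
  constructor
  · have h1 := pathDistIn_triangle hE hp ha hq
    have h2 := pathDistIn_triangle hE ha hb hq
    rw [pathDistIn_comm hE hp ha] at h1
    linarith
  · have h1 := pathDistIn_triangle hE ha hp hb
    have h2 := pathDistIn_triangle hE hp hq hb
    rw [pathDistIn_comm hE hq hb] at h2
    linarith

/-- A map into a geodesic of `E` with the same endpoints and the same Lipschitz constant is that
geodesic. -/
theorem IsConstSpeedYGeodesic.apply_eq_of_dist_le {p q : X} {σ : ℝ → X} {g : ℝ → ℝ}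
    (hσ : IsConstSpeedYGeodesic E σ p q) (hE : RectConnected E) (hg : MapsTo g (Icc 0 1) (Icc 0 1))
    (h0 : σ (g 0) = p) (h1 : σ (g 1) = q) (hd : ∀ s ∈ Icc (0 : ℝ) 1, ∀ t ∈ Icc (0 : ℝ) 1,
      dist (σ (g s)) (σ (g t)) ≤ pathDistIn E p q * |s - t|) {t : ℝ} (ht : t ∈ Icc (0 : ℝ) 1) :
    σ (g t) = σ t := by
  have hl : Icc 0 t ⊆ Icc (0 : ℝ) 1 := Icc_subset_Icc le_rfl ht.2
  have hr : Icc t 1 ⊆ Icc (0 : ℝ) 1 := Icc_subset_Icc ht.1 le_rfl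
  have h2 := pathDistIn_le_of_dist_le (E := E) (g := fun t => σ (g t)) ht.1 pathDistIn_nonneg
    (fun s hs => hσ.2.2.1 (hg (hl hs))) fun s hs t ht => hd s (hl hs) t (hl ht)
  have h3 := pathDistIn_le_of_dist_le (E := E) (g := fun t => σ (g t)) ht.2 pathDistIn_nonneg
    (fun s hs => hσ.2.2.1 (hg (hr hs))) fun s hs t ht => hd s (hr hs) t (hr ht)
  have hI0 : (0 : ℝ) ∈ Icc (0 : ℝ) 1 := ⟨le_rfl, zero_le_one⟩
  have hI1 : (1 : ℝ) ∈ Icc (0 : ℝ) 1 := ⟨zero_le_one, le_rfl⟩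
  have h4 := hσ.2.2.2 0 hI0 (g t) (hg ht)
  have h5 := hσ.2.2.2 (g t) (hg ht) 1 hI1
  rw [hσ.1, ← h0, h0, zero_sub, abs_neg, abs_of_nonneg (hg ht).1] at h4
  rw [hσ.2.1, abs_of_nonpos (sub_nonpos.2 (hg ht).2)] at h5
  simp only [h0, h1] at h2 h3
  have h6 := hσ.dist_le hE (hg ht) ht
  have h7 : pathDistIn E p q * (g t - t) = 0 := by linarith
  rw [← abs_of_nonneg (pathDistIn_nonneg (E := E) (x := p) (y := q)), ← abs_mul, h7, abs_zero] at h6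
  exact dist_le_zero.1 h6

/-- Constant-speed geodesics of `E` with converging endpoints which accumulate only on a geodesic
`σ` of `E` converge uniformly to `σ`. -/
theorem IsConstSpeedYGeodesic.tendstoUniformlyOn {p q : X} {σ : ℝ → X} {pk qk : ℕ → X}
    {σk : ℕ → ℝ → X} (hσ : IsConstSpeedYGeodesic E σ p q) (hE : RectConnected E)
    (hσk : ∀ n, IsConstSpeedYGeodesic E (σk n) (pk n) (qk n))
    (hp : Tendsto (fun n => pathDistIn E (pk n) p) atTop (𝓝 0))
    (hq : Tendsto (fun n => pathDistIn E (qk n) q) atTop (𝓝 0))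
    (hclose : ∀ ε > 0, ∀ᶠ n in atTop, ∀ t ∈ Icc (0 : ℝ) 1, ∃ s ∈ Icc (0 : ℝ) 1,
      dist (σk n t) (σ s) < ε) :
    TendstoUniformlyOn σk σ atTop (Icc 0 1) := by
  have hI0 : (0 : ℝ) ∈ Icc (0 : ℝ) 1 := ⟨le_rfl, zero_le_one⟩
  have hI1 : (1 : ℝ) ∈ Icc (0 : ℝ) 1 := ⟨zero_le_one, le_rfl⟩
  have hpE : p ∈ E := hσ.1 ▸ hσ.2.2.1 hI0
  have hqE : q ∈ E := hσ.2.1 ▸ hσ.2.2.1 hI1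
  have hpkE : ∀ n, pk n ∈ E := fun n => (hσk n).1 ▸ (hσk n).2.2.1 hI0
  have hqkE : ∀ n, qk n ∈ E := fun n => (hσk n).2.1 ▸ (hσk n).2.2.1 hI1
  have hpX : Tendsto pk atTop (𝓝 p) := tendsto_iff_dist_tendsto_zero.2 <|
    squeeze_zero (fun _ => dist_nonneg) (fun n => dist_le_pathDistIn hE (hpkE n) hpE) hp
  have hqX : Tendsto qk atTop (𝓝 q) := tendsto_iff_dist_tendsto_zero.2 <|
    squeeze_zero (fun _ => dist_nonneg) (fun n => dist_le_pathDistIn hE (hqkE n) hqE) hq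
  have hL : Tendsto (fun n => pathDistIn E (pk n) (qk n)) atTop (𝓝 (pathDistIn E p q)) := by
    rw [tendsto_iff_dist_tendsto_zero]
    exact squeeze_zero (fun _ => dist_nonneg)
      (fun n => abs_pathDistIn_sub_le hE (hpkE n) (hqkE n) hpE hqE) (by simpa using hp.add hq)
  have hσc : ContinuousOn σ (Icc 0 1) := (hσ.lipschitzOnWith hE).continuousOn
  have hmin : ∀ n t, ∃ s ∈ Icc (0 : ℝ) 1, ∀ s' ∈ Icc (0 : ℝ) 1,
      dist (σk n t) (σ s) ≤ dist (σk n t) (σ s') := fun n t => by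
    have hc : ContinuousOn (fun s => dist (σk n t) (σ s)) (Icc 0 1) := by fun_prop
    obtain ⟨s, hs, hmin⟩ := isCompact_Icc.exists_isMinOn ⟨0, hI0⟩ hc
    exact ⟨s, hs, fun s' hs' => hmin hs'⟩
  choose s hs hsmin using hmin
  rw [Metric.tendstoUniformlyOn_iff]
  by_contra! hcon
  obtain ⟨ε, hε, hfr⟩ := hcon
  have : (atTop ⊓ 𝓟 {n | ∃ t ∈ Icc (0 : ℝ) 1, ε ≤ dist (σ t) (σk n t)}).NeBot :=
    frequently_mem_iff_neBot.1 (hfr.mono fun n hn => by simpa using hn)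
  set 𝒰 := Ultrafilter.of (atTop ⊓ 𝓟 {n | ∃ t ∈ Icc (0 : ℝ) 1, ε ≤ dist (σ t) (σk n t)})
  have h𝒰 : (𝒰 : Filter ℕ) ≤ atTop := (Ultrafilter.of_le _).trans inf_le_left
  have hbad : ∀ᶠ n in (𝒰 : Filter ℕ), ∃ t ∈ Icc (0 : ℝ) 1, ε ≤ dist (σ t) (σk n t) :=
    (Ultrafilter.of_le _).trans inf_le_right (mem_principal_self _)
  have hcpt : ∀ c : ℕ → ℝ, (∀ᶠ n in (𝒰 : Filter ℕ), c n ∈ Icc (0 : ℝ) 1) →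
      ∃ l ∈ Icc (0 : ℝ) 1, Tendsto c 𝒰 (𝓝 l) := fun c hc =>
    isCompact_Icc.ultrafilter_le_nhds (𝒰.map c) (le_principal_iff.2 hc)
  choose! g hg hgt using fun t : ℝ => hcpt (fun n => s n t) (Eventually.of_forall fun n => hs n t)
  have hlim : ∀ t ∈ Icc (0 : ℝ) 1, Tendsto (fun n => σk n t) 𝒰 (𝓝 (σ (g t))) := by
    intro t ht
    have h1 : Tendsto (fun n => σ (s n t)) 𝒰 (𝓝 (σ (g t))) :=
      (hσc (g t) (hg t)).tendsto.comp
        (tendsto_nhdsWithin_iff.2 ⟨hgt t, Eventually.of_forall fun n => hs n t⟩)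
    refine (tendsto_iff_of_dist (Metric.tendsto_nhds.2 fun η hη => ?_)).2 h1
    filter_upwards [h𝒰 (hclose η hη)] with n hn
    obtain ⟨s', hs', hlt⟩ := hn t ht
    rw [Real.dist_0_eq_abs, abs_of_nonneg dist_nonneg]
    exact (hsmin n t s' hs').trans_lt hlt
  have hLip : ∀ a ∈ Icc (0 : ℝ) 1, ∀ b ∈ Icc (0 : ℝ) 1,
      dist (σ (g a)) (σ (g b)) ≤ pathDistIn E p q * |a - b| := fun a ha b hb =>
    le_of_tendsto_of_tendsto' ((hlim a ha).dist (hlim b hb)) ((hL.mono_left h𝒰).mul_const _)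
      fun n => (hσk n).dist_le hE ha hb
  have h0 : σ (g 0) = p := tendsto_nhds_unique (hlim 0 hI0)
    (by simpa only [fun n => (hσk n).1] using hpX.mono_left h𝒰)
  have h1 : σ (g 1) = q := tendsto_nhds_unique (hlim 1 hI1)
    (by simpa only [fun n => (hσk n).2.1] using hqX.mono_left h𝒰)
  have hbad' : ∀ n, ∃ t, (∃ t ∈ Icc (0 : ℝ) 1, ε ≤ dist (σ t) (σk n t)) →
      t ∈ Icc (0 : ℝ) 1 ∧ ε ≤ dist (σ t) (σk n t) := fun n => by
    by_cases h : ∃ t ∈ Icc (0 : ℝ) 1, ε ≤ dist (σ t) (σk n t)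
    exacts [h.imp fun t ht _ => ht, ⟨0, fun h' => absurd h' h⟩]
  choose t ht using hbad'
  obtain ⟨l, hl, htl⟩ := hcpt t (hbad.mono fun n hn => (ht n hn).1)
  have hσl := hσ.apply_eq_of_dist_le hE (fun t _ => hg t) h0 h1 hLip hl
  have habs : Tendsto (fun n => |t n - l|) 𝒰 (𝓝 0) := by
    simpa using (htl.sub_const l).abs
  have hd : Tendsto (fun n => dist (σk n l) (σ l)) 𝒰 (𝓝 0) :=
    tendsto_iff_dist_tendsto_zero.1 (hσl ▸ hlim l hl)
  have hsum : Tendsto (fun n => pathDistIn E p q * |t n - l| + dist (σk n l) (σ l) +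
      pathDistIn E (pk n) (qk n) * |t n - l|) 𝒰 (𝓝 0) := by
    simpa using ((habs.const_mul (pathDistIn E p q)).add hd).add ((hL.mono_left h𝒰).mul habs)
  obtain ⟨n, hn, hn'⟩ := (hbad.and (hsum.eventually_lt_const hε)).exists
  obtain ⟨htn, hge⟩ := ht n hn
  have h2 := hσ.dist_le hE htn hl
  have h3 := (hσk n).dist_le hE htn hl
  have h4 := dist_triangle4 (σ (t n)) (σ l) (σk n l) (σk n (t n))
  rw [dist_comm (σ l), dist_comm (σk n l) (σk n (t n))] at h4
  linarith

end Cat2Cx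

open Cat2Cx in
/-- **Lemma (continuous_variation).**  Let `p_k → p` and `q_k → q` in `Y`, and let `σ_k`
be the constant-speed parametrization of the `Y`-geodesic from `p_k` to `q_k`.  Then the
maps `σ_k` converge uniformly in `X` to the constant-speed parametrization `σ` of the
`Y`-geodesic from `p` to `q`. -/
theorem Y_geodesics_converge_uniformly_in_X
    {κ : ℝ} (hκ : κ ≤ 0) {X : Type*} [MetricSpace X]
    (PC : PolyComplex2 κ X) (hX : IsCATSpace κ X)
    (E : Set X) (hEclosed : IsClosed E) (hErc : RectConnected E) (hH1 : H1Trivial ↥E)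
    (p q : X) (hp : p ∈ E) (hq : q ∈ E)
    (pk qk : ℕ → X) (hpk : ∀ n, pk n ∈ E) (hqk : ∀ n, qk n ∈ E)
    (hpconv : ∀ ε > 0, ∃ N, ∀ n ≥ N, pathDistIn E (pk n) p < ε)
    (hqconv : ∀ ε > 0, ∃ N, ∀ n ≥ N, pathDistIn E (qk n) q < ε)
    (σk : ℕ → ℝ → X) (hσk : ∀ n, IsConstSpeedYGeodesic E (σk n) (pk n) (qk n))
    (σ : ℝ → X) (hσ : IsConstSpeedYGeodesic E σ p q) :
    ∀ ε > 0, ∃ N, ∀ n ≥ N, ∀ t ∈ Set.Icc (0:ℝ) 1, dist (σk n t) (σ t) < ε := by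
  have : CNSpace X := IsCATSpace.cnSpace hκ hX
  have ch : Charts PC := fun F => (PC.exists_faceChart hκ F.2).some
  have htend : ∀ (xk : ℕ → X) (x : X), (∀ ε > 0, ∃ N, ∀ n ≥ N, pathDistIn E (xk n) x < ε) →
      Tendsto (fun n => pathDistIn E (xk n) x) atTop (nhds 0) := fun xk x h =>
    Metric.tendsto_atTop.2 fun ε hε => (h ε hε).imp fun N hN n hn => by
      rw [Real.dist_0_eq_abs, abs_of_nonneg pathDistIn_nonneg]
      exact hN n hn
  have hunif : TendstoUniformlyOn σk σ atTop (Icc 0 1) := by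
    refine hσ.tendstoUniformlyOn hErc hσk (htend _ _ hpconv) (htend _ _ hqconv) fun ε hε => ?_
    obtain ⟨δ, hδε, hδ⟩ : ∃ δ, 12 * δ * (pathDistIn E p q + 2 * δ) + 9 * δ ^ 2 ≤ (ε / 2) ^ 2 ∧
        0 < δ := by
      have hc : Continuous fun δ : ℝ => 12 * δ * (pathDistIn E p q + 2 * δ) + 9 * δ ^ 2 := by
        fun_prop
      have hev := (hc.tendsto 0).eventually_lt_const
        (show _ < (ε / 2) ^ 2 by norm_num; positivity)
      exact (((hev.filter_mono nhdsWithin_le_nhds).and self_mem_nhdsWithin).exists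
        (f := nhdsWithin 0 (Ioi 0))).imp fun δ h => ⟨h.1.le, h.2⟩
    filter_upwards [eventually_atTop.2 (hpconv δ hδ), eventually_atTop.2 (hqconv δ hδ)]
      with n hpn hqn t ht
    exact (hσk n).exists_dist_lt ch hσ hEclosed hErc hH1 hpn hqn hε hδε ht
  intro ε hε
  obtain ⟨N, hN⟩ := eventually_atTop.1 (Metric.tendstoUniformlyOn_iff.1 hunif ε hε)
  exact ⟨N, fun n hn t ht => by rw [dist_comm]; exact hN n hn t ht⟩
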